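/- arXiv:2009.12884 — 4 statements merged into one kernel-verified Lean document; each statement's English description precedes it below -/
import Mathlib

section
/- Well-posedness for mixed Young–ODE equations: Let α, β ∈ (0,1) with α(1+β) > 1, let A ∈ C^α_t C^{1+β}_V, and let F : [0,T] × V → V be continuous with ‖F(t,y)‖_V ≤ C_F and ‖F(t,y) − F(t,z)‖_V ≤ C_F ‖y − z‖_V for all t ∈ [0,T] and y, z ∈ V, for some constant C_F > 0. Then for every x₀ ∈ V there exists exactly one x ∈ C^α([0,T];V) with x(0) = x₀ such that for some K ≥ 0, ‖x_t − x_s − ∫_s^t F(r, x_r) dr − A_{s,t}(x_s)‖_V ≤ K (t−s)^{α(1+β)} for all 0 ≤ s ≤ t ≤ T, where ∫_s^t F(r,x_r) dr is the Bochner integral; i.e. the equation x_t = x₀ + ∫_0^t F(s,x_s) ds + ∫_0^t A(ds, x_s) is globally well-posed. -/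
open Filter Topology

/-- The Riemann sum of the germ `Ξ` along the first `k` cells of the dyadic grid of level `m`. -/
noncomputable def dyadicSum {V : Type*} [AddCommMonoid V] (Ξ : ℝ → ℝ → V) (m k : ℕ) : V :=
  ∑ i ∈ Finset.range k, Ξ ((i : ℝ) / 2 ^ m) (((i : ℝ) + 1) / 2 ^ m)

/-- The Riemann sum of the germ `Ξ` over `[0, t]` along the dyadic grid of level `m`. -/
noncomputable def dyadicIntegral {V : Type*} [AddCommMonoid V] (Ξ : ℝ → ℝ → V) (m : ℕ)
    (t : ℝ) : V :=
  dyadicSum Ξ m ⌊t * 2 ^ m⌋₊ + Ξ ((⌊t * 2 ^ m⌋₊ : ℝ) / 2 ^ m) t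

/-- `C` is an admissible constant in the sewing lemma with exponent `γ` for `V`-valued germs on
intervals of length at most one. -/
def IsSewingConstant (V : Type*) [NormedAddCommGroup V] (γ C : ℝ) : Prop :=
  ∀ (a b M : ℝ) (Ξ : ℝ → ℝ → V), a ≤ b → b - a ≤ 1 → 0 ≤ M →
    (∀ s u t, a ≤ s → s ≤ u → u ≤ t → t ≤ b → ‖Ξ s t - Ξ s u - Ξ u t‖ ≤ M * (t - s) ^ γ) →
    ∃ I : ℝ → V, ∀ s t, a ≤ s → s ≤ t → t ≤ b → ‖I t - I s - Ξ s t‖ ≤ C * M * (t - s) ^ γ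

section Sewing

variable {V : Type*} [NormedAddCommGroup V] {Ξ : ℝ → ℝ → V} {M γ : ℝ}

lemma germ_self_eq_zero (hγ : 1 < γ)
    (hΞ : ∀ s u t, 0 ≤ s → s ≤ u → u ≤ t → ‖Ξ s t - Ξ s u - Ξ u t‖ ≤ M * (t - s) ^ γ)
    {s : ℝ} (hs : 0 ≤ s) : Ξ s s = 0 := by
  have h := hΞ s s s hs le_rfl le_rfl
  rw [sub_self (Ξ s s), sub_self s, Real.zero_rpow (by linarith), mul_zero, zero_sub, norm_neg] at h
  exact norm_le_zero_iff.mp h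

lemma dyadicIntegral_sub_germ_le (hM : 0 ≤ M) (hγ : 1 < γ)
    (hΞ : ∀ s u t, 0 ≤ s → s ≤ u → u ≤ t → ‖Ξ s t - Ξ s u - Ξ u t‖ ≤ M * (t - s) ^ γ)
    (m : ℕ) {s t : ℝ} (hs : 0 ≤ s) (hst : s ≤ t) (hlen : t - s ≤ 1 / 2 ^ m) :
    ‖dyadicIntegral Ξ m t - dyadicIntegral Ξ m s - Ξ s t‖ ≤ M * (2 * (2 / 2 ^ m) ^ γ) := by
  have h2 : (0 : ℝ) < 2 ^ m := by positivity
  unfold dyadicIntegral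
  set k := ⌊s * 2 ^ m⌋₊ with hk
  set l := ⌊t * 2 ^ m⌋₊ with hl
  have hk1 : (k : ℝ) ≤ s * 2 ^ m := Nat.floor_le (by positivity)
  have hk2 : s * 2 ^ m < k + 1 := Nat.lt_floor_add_one _
  have hl1 : (l : ℝ) ≤ t * 2 ^ m := Nat.floor_le (mul_nonneg (hs.trans hst) h2.le)
  have hl2 : t * 2 ^ m < l + 1 := Nat.lt_floor_add_one _
  have hkl : k ≤ l := Nat.floor_le_floor (by gcongr)
  have hlen' : t * 2 ^ m ≤ s * 2 ^ m + 1 := by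
    rw [le_div_iff₀ h2] at hlen; linarith
  have hks : (k : ℝ) / 2 ^ m ≤ s := by rwa [div_le_iff₀ h2]
  have hk0 : (0 : ℝ) ≤ (k : ℝ) / 2 ^ m := by positivity
  have hsk : s < ((k : ℝ) + 1) / 2 ^ m := by rwa [lt_div_iff₀ h2]
  have hlt : l < k + 2 := by
    have : (l : ℝ) < ((k + 2 : ℕ) : ℝ) := by push_cast; linarith
    exact_mod_cast this
  have key : ∀ r : ℝ, 0 ≤ r → r ≤ 2 / 2 ^ m → M * r ^ γ ≤ M * (2 / 2 ^ m) ^ γ := by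
    intro r hr hr'
    gcongr
  have hp : 0 ≤ M * (2 / 2 ^ m : ℝ) ^ γ := by positivity
  have hdist : t - k / 2 ^ m ≤ 2 / 2 ^ m := by
    rw [add_div] at hsk
    have : (2 : ℝ) / 2 ^ m = 1 / 2 ^ m + 1 / 2 ^ m := by ring
    linarith
  obtain h | h : l = k ∨ l = k + 1 := by omega
  · rw [h]
    have e : dyadicSum Ξ m k + Ξ ((k : ℝ) / 2 ^ m) t - (dyadicSum Ξ m k + Ξ ((k : ℝ) / 2 ^ m) s)
      - Ξ s t = Ξ ((k : ℝ) / 2 ^ m) t - Ξ ((k : ℝ) / 2 ^ m) s - Ξ s t := by abel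
    rw [e]
    refine (hΞ _ s t hk0 hks hst).trans ?_
    have := key (t - k / 2 ^ m) (by linarith) hdist
    linarith
  · rw [h] at hl1 ⊢
    push_cast at hl1 ⊢
    have hkt : ((k : ℝ) + 1) / 2 ^ m ≤ t := by rwa [div_le_iff₀ h2]
    have e : dyadicSum Ξ m (k + 1) + Ξ (((k : ℝ) + 1) / 2 ^ m) t
          - (dyadicSum Ξ m k + Ξ ((k : ℝ) / 2 ^ m) s) - Ξ s t
        = (Ξ ((k : ℝ) / 2 ^ m) (((k : ℝ) + 1) / 2 ^ m) - Ξ ((k : ℝ) / 2 ^ m) s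
            - Ξ s (((k : ℝ) + 1) / 2 ^ m))
          - (Ξ s t - Ξ s (((k : ℝ) + 1) / 2 ^ m) - Ξ (((k : ℝ) + 1) / 2 ^ m) t) := by
      rw [dyadicSum, Finset.sum_range_succ, ← dyadicSum]; abel
    rw [e]
    refine (norm_sub_le _ _).trans ?_
    have h1 := hΞ _ s _ hk0 hks hsk.le
    have h3 := hΞ s _ t hs hsk.le hkt
    have h4 := key (((k : ℝ) + 1) / 2 ^ m - k / 2 ^ m) (by linarith) (by linarith)
    have h5 := key (t - s) (by linarith) (by linarith)
    linarith

lemma dyadicIntegral_succ_sub (hM : 0 ≤ M) (hγ : 1 < γ)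
    (hΞ : ∀ s u t, 0 ≤ s → s ≤ u → u ≤ t → ‖Ξ s t - Ξ s u - Ξ u t‖ ≤ M * (t - s) ^ γ)
    (m : ℕ) {t : ℝ} (ht : 0 ≤ t) :
    ‖dyadicIntegral Ξ (m + 1) t - dyadicIntegral Ξ m t
      - (dyadicSum Ξ (m + 1) (2 * ⌊t * 2 ^ m⌋₊) - dyadicSum Ξ m ⌊t * 2 ^ m⌋₊)‖
      ≤ M * (1 / 2 ^ m) ^ γ := by
  have h2 : (0 : ℝ) < 2 ^ m := by positivity
  have h2' : (0 : ℝ) < 2 ^ (m + 1) := by positivity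
  unfold dyadicIntegral
  set k := ⌊t * 2 ^ m⌋₊ with hk
  set l := ⌊t * 2 ^ (m + 1)⌋₊ with hl
  have hk1 : (k : ℝ) ≤ t * 2 ^ m := Nat.floor_le (by positivity)
  have hk2 : t * 2 ^ m < k + 1 := Nat.lt_floor_add_one _
  have hl1 : (l : ℝ) ≤ t * 2 ^ (m + 1) := Nat.floor_le (by positivity)
  have hl2 : t * 2 ^ (m + 1) < l + 1 := Nat.lt_floor_add_one _
  have e2 : t * 2 ^ (m + 1) = 2 * (t * 2 ^ m) := by ring
  have hp : 0 ≤ M * (1 / 2 ^ m : ℝ) ^ γ := by positivity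
  have a1 : l < 2 * k + 2 := by
    have : (l : ℝ) < ((2 * k + 2 : ℕ) : ℝ) := by push_cast; linarith
    exact_mod_cast this
  have a2 : 2 * k < l + 1 := by
    have : ((2 * k : ℕ) : ℝ) < ((l + 1 : ℕ) : ℝ) := by push_cast; linarith
    exact_mod_cast this
  have e3 : ((2 * (k : ℝ))) / 2 ^ (m + 1) = k / 2 ^ m := by
    rw [pow_succ]; field_simp
  obtain h | h : l = 2 * k ∨ l = 2 * k + 1 := by omega
  · rw [h]
    push_cast
    rw [e3]
    simpa using hp
  · rw [h] at hl1 ⊢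
    push_cast at hl1 ⊢
    have e : dyadicSum Ξ (m + 1) (2 * k + 1) = dyadicSum Ξ (m + 1) (2 * k)
        + Ξ ((k : ℝ) / 2 ^ m) ((2 * (k : ℝ) + 1) / 2 ^ (m + 1)) := by
      rw [dyadicSum, Finset.sum_range_succ, ← dyadicSum]; push_cast; rw [e3]
    have hu1 : (k : ℝ) / 2 ^ m ≤ (2 * (k : ℝ) + 1) / 2 ^ (m + 1) := by
      rw [← e3]; gcongr; linarith
    have hu2 : (2 * (k : ℝ) + 1) / 2 ^ (m + 1) ≤ t := by rwa [div_le_iff₀ h2']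
    have := hΞ _ _ t (by positivity) hu1 hu2
    rw [← norm_neg] at this
    rw [e]
    refine (le_of_eq ?_).trans (this.trans ?_)
    · congr 1; abel
    · gcongr
      · linarith
      · rw [sub_le_iff_le_add, ← add_div, le_div_iff₀ h2]; linarith

lemma dyadicSum_succ_sub
    (hΞ : ∀ s u t, 0 ≤ s → s ≤ u → u ≤ t → ‖Ξ s t - Ξ s u - Ξ u t‖ ≤ M * (t - s) ^ γ)
    (m k j : ℕ) :
    ‖dyadicSum Ξ (m + 1) (2 * (k + j)) - dyadicSum Ξ m (k + j)
      - (dyadicSum Ξ (m + 1) (2 * k) - dyadicSum Ξ m k)‖ ≤ j * (M * (1 / 2 ^ m) ^ γ) := by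
  induction j with
  | zero => simp
  | succ j ih =>
    set n := k + j with hn
    have e3 : ((2 * (n : ℝ))) / 2 ^ (m + 1) = n / 2 ^ m := by
      rw [pow_succ]; field_simp
    have e4 : ((2 * (n : ℝ)) + 1 + 1) / 2 ^ (m + 1) = (n + 1) / 2 ^ m := by
      rw [pow_succ]; field_simp; ring
    have e1 : dyadicSum Ξ (m + 1) (2 * (n + 1)) = dyadicSum Ξ (m + 1) (2 * n)
        + Ξ ((n : ℝ) / 2 ^ m) ((2 * (n : ℝ) + 1) / 2 ^ (m + 1))
        + Ξ ((2 * (n : ℝ) + 1) / 2 ^ (m + 1)) (((n : ℝ) + 1) / 2 ^ m) := by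
      rw [show 2 * (n + 1) = 2 * n + 1 + 1 by ring, dyadicSum, Finset.sum_range_succ,
        Finset.sum_range_succ, ← dyadicSum]
      push_cast
      rw [e3, e4]
    have e2 : dyadicSum Ξ m (n + 1) = dyadicSum Ξ m n
        + Ξ ((n : ℝ) / 2 ^ m) (((n : ℝ) + 1) / 2 ^ m) := by
      rw [dyadicSum, Finset.sum_range_succ, ← dyadicSum]
    have hu1 : (n : ℝ) / 2 ^ m ≤ (2 * (n : ℝ) + 1) / 2 ^ (m + 1) := by
      rw [← e3]; gcongr; linarith
    have hu2 : (2 * (n : ℝ) + 1) / 2 ^ (m + 1) ≤ ((n : ℝ) + 1) / 2 ^ m := by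
      rw [← e4]; gcongr; linarith
    have h := hΞ _ _ _ (by positivity) hu1 hu2
    have e5 : ((n : ℝ) + 1) / 2 ^ m - n / 2 ^ m = 1 / 2 ^ m := by ring
    rw [e5] at h
    rw [show k + (j + 1) = n + 1 by omega, e1, e2]
    have e6 : ∀ a b c d e f x y : V, a + b + c - (d + e) - (x - y)
      = (a - d - (x - y)) - (e - b - c) := by intros; abel
    rw [e6 _ _ _ _ _ 0]
    refine (norm_sub_le _ _).trans ?_
    push_cast
    linarith

lemma dyadicIntegral_refine_le (hM : 0 ≤ M) (hγ : 1 < γ)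
    (hΞ : ∀ s u t, 0 ≤ s → s ≤ u → u ≤ t → ‖Ξ s t - Ξ s u - Ξ u t‖ ≤ M * (t - s) ^ γ)
    (m : ℕ) {s t : ℝ} (hs : 0 ≤ s) (hst : s ≤ t) :
    ‖dyadicIntegral Ξ (m + 1) t - dyadicIntegral Ξ (m + 1) s
      - (dyadicIntegral Ξ m t - dyadicIntegral Ξ m s)‖
      ≤ ((t - s) * 2 ^ m + 3) * (M * (1 / 2 ^ m) ^ γ) := by
  have h1 := dyadicIntegral_succ_sub hM hγ hΞ m hs
  have h2 := dyadicIntegral_succ_sub hM hγ hΞ m (hs.trans hst)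
  set k := ⌊s * 2 ^ m⌋₊ with hk
  have hkl : k ≤ ⌊t * 2 ^ m⌋₊ := Nat.floor_le_floor (by gcongr)
  obtain ⟨j, hj⟩ := Nat.exists_eq_add_of_le hkl
  have h3 := dyadicSum_succ_sub hΞ m k j
  rw [hj] at h2
  have hj' : (j : ℝ) ≤ (t - s) * 2 ^ m + 1 := by
    have b1 : ((k + j : ℕ) : ℝ) ≤ t * 2 ^ m := by
      rw [← hj]; exact Nat.floor_le (mul_nonneg (hs.trans hst) (by positivity))
    have b2 : s * 2 ^ m < k + 1 := Nat.lt_floor_add_one _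
    push_cast at b1
    linarith
  have hp : 0 ≤ M * (1 / 2 ^ m : ℝ) ^ γ := by positivity
  have h4 := mul_le_mul_of_nonneg_right hj' hp
  have e : ∀ a b c d x y : V, a - b - (c - d) = (a - c - x) - (b - d - y) + (x - y) := by
    intros; abel
  rw [e _ _ _ _ _ _]
  refine (norm_add_le _ _).trans ((add_le_add ((norm_sub_le _ _).trans
    (add_le_add h2 h1)) h3).trans ?_)
  linarith

/-- **Sewing lemma** on intervals of length at most one. -/
lemma exists_sewing_of_nonneg [CompleteSpace V] (hM : 0 ≤ M) (hγ : 1 < γ)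
    (hΞ : ∀ s u t, 0 ≤ s → s ≤ u → u ≤ t → ‖Ξ s t - Ξ s u - Ξ u t‖ ≤ M * (t - s) ^ γ) :
    ∃ I : ℝ → V, ∀ s t, 0 ≤ s → s ≤ t → t - s ≤ 1 →
      ‖I t - I s - Ξ s t‖ ≤
        (2 * 4 ^ γ + 7 * 2 ^ (γ - 1) / (1 - (1 / 2) ^ (γ - 1))) * M * (t - s) ^ γ := by
  set q : ℝ := (1 / 2) ^ (γ - 1) with hq
  have hq0 : 0 ≤ q := by positivity
  have hq1 : q < 1 := Real.rpow_lt_one (by norm_num) (by norm_num) (by linarith)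
  have hqm : ∀ m : ℕ, (1 / 2 ^ m : ℝ) ^ γ = 1 / 2 ^ m * q ^ m := by
    intro m
    rw [hq, Real.rpow_pow_comm (by norm_num), ← one_div_pow]
    conv_lhs => rw [show γ = 1 + (γ - 1) by ring]
    rw [Real.rpow_add (by positivity), Real.rpow_one]
  have h0 : ∀ m, dyadicIntegral Ξ m 0 = 0 := by
    intro m
    simp [dyadicIntegral, dyadicSum, germ_self_eq_zero hγ hΞ le_rfl]
  have hlim : ∀ t : ℝ, ∃ L, 0 ≤ t → Tendsto (fun m => dyadicIntegral Ξ m t) atTop (𝓝 L) := by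
    intro t
    by_cases ht : 0 ≤ t
    swap
    · exact ⟨0, fun h => absurd h ht⟩
    have hc : CauchySeq (fun m => dyadicIntegral Ξ m t) := by
      refine cauchySeq_of_le_geometric q ((t + 3) * M) hq1 fun m => ?_
      have h := dyadicIntegral_refine_le hM hγ hΞ m le_rfl ht
      rw [h0, h0, sub_zero, sub_zero, sub_zero, hqm] at h
      rw [dist_comm, dist_eq_norm]
      refine h.trans ?_
      have h1 : (1 : ℝ) ≤ 2 ^ m := one_le_pow₀ (by norm_num)
      have e : (t * 2 ^ m + 3) * (M * (1 / 2 ^ m * q ^ m)) = (t + 3 / 2 ^ m) * M * q ^ m := by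
        field_simp
      rw [e]
      gcongr
      exact div_le_self (by norm_num) h1
    obtain ⟨L, hL⟩ := cauchySeq_tendsto_of_complete hc
    exact ⟨L, fun _ => hL⟩
  choose I hI using hlim
  refine ⟨I, fun s t hs hst h1 => ?_⟩
  obtain rfl | hlt := hst.eq_or_lt
  · rw [germ_self_eq_zero hγ hΞ hs, sub_self s, Real.zero_rpow (by linarith)]
    simp
  have hpos : 0 < t - s := by linarith
  obtain ⟨n, hn1, hn2⟩ := exists_nat_pow_near_of_lt_one hpos h1 (by norm_num : (0 : ℝ) < 1 / 2)
    (by norm_num)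
  have hn3 : (1 / 2 ^ n : ℝ) ≤ 2 * (t - s) := by
    rw [← one_div_pow]
    rw [pow_succ] at hn1
    linarith
  rw [one_div_pow] at hn2
  have hA := dyadicIntegral_sub_germ_le hM hγ hΞ n hs hst hn2
  have hB : ‖(dyadicIntegral Ξ n t - dyadicIntegral Ξ n s) - (I t - I s)‖
      ≤ 7 * M * (t - s) * q ^ n / (1 - q) := by
    have hT : Tendsto (fun m => dyadicIntegral Ξ (m + n) t - dyadicIntegral Ξ (m + n) s) atTop
        (𝓝 (I t - I s)) :=
      ((tendsto_add_atTop_iff_nat n).mpr (hI t (hs.trans hst))).sub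
        ((tendsto_add_atTop_iff_nat n).mpr (hI s hs))
    have := dist_le_of_le_geometric_of_tendsto₀ q (7 * M * (t - s) * q ^ n) hq1
      (fun m => ?_) hT
    · simpa [dist_eq_norm] using this
    · have h := dyadicIntegral_refine_le hM hγ hΞ (m + n) hs hst
      rw [dist_comm, dist_eq_norm, show m + 1 + n = m + n + 1 by ring]
      refine h.trans ?_
      rw [hqm]
      have hmn : (1 / 2 ^ (m + n) : ℝ) ≤ 2 * (t - s) := by
        refine le_trans ?_ hn3
        gcongr
        · norm_num
        · omega
      have e : ((t - s) * 2 ^ (m + n) + 3) * (M * (1 / 2 ^ (m + n) * q ^ (m + n)))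
          = ((t - s) + 3 * (1 / 2 ^ (m + n))) * M * q ^ (m + n) := by
        field_simp
      rw [e]
      calc ((t - s) + 3 * (1 / 2 ^ (m + n))) * M * q ^ (m + n)
          ≤ (7 * (t - s)) * M * q ^ (m + n) := by gcongr; linarith
        _ = 7 * M * (t - s) * q ^ n * q ^ m := by rw [pow_add]; ring
  have hqn : q ^ n ≤ 2 ^ (γ - 1) * (t - s) ^ (γ - 1) := by
    rw [← Real.mul_rpow (by norm_num) hpos.le, hq, Real.rpow_pow_comm (by norm_num), one_div_pow]
    gcongr
  have hA' : (2 / 2 ^ n : ℝ) ^ γ ≤ 4 ^ γ * (t - s) ^ γ := by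
    rw [← Real.mul_rpow (by norm_num) hpos.le]
    gcongr
    have : (2 / 2 ^ n : ℝ) = 2 * (1 / 2 ^ n) := by ring
    linarith
  have hts : (t - s) * (t - s) ^ (γ - 1) = (t - s) ^ γ := by
    rw [Real.rpow_sub_one hpos.ne']; field_simp
  have hB' : 7 * M * (t - s) * q ^ n / (1 - q)
      ≤ 7 * 2 ^ (γ - 1) / (1 - q) * M * (t - s) ^ γ := by
    have h1q : 0 < 1 - q := by linarith
    calc 7 * M * (t - s) * q ^ n / (1 - q)
        ≤ 7 * M * (t - s) * (2 ^ (γ - 1) * (t - s) ^ (γ - 1)) / (1 - q) := by gcongr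
      _ = 7 * 2 ^ (γ - 1) / (1 - q) * M * ((t - s) * (t - s) ^ (γ - 1)) := by ring
      _ = _ := by rw [hts]
  have hA'' : M * (2 * (2 / 2 ^ n) ^ γ) ≤ M * (2 * (4 ^ γ * (t - s) ^ γ)) := by gcongr
  have e : I t - I s - Ξ s t = (dyadicIntegral Ξ n t - dyadicIntegral Ξ n s - Ξ s t)
      - ((dyadicIntegral Ξ n t - dyadicIntegral Ξ n s) - (I t - I s)) := by abel
  rw [e]
  refine (norm_sub_le _ _).trans ?_
  rw [add_mul, add_mul]
  linarith

/-- **Sewing lemma** on a compact interval of length at most one, with a constant depending only on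
the exponent. -/
lemma exists_sewing [CompleteSpace V] (hγ : 1 < γ) :
    ∃ C : ℝ, 0 ≤ C ∧ IsSewingConstant V γ C := by
  refine ⟨2 * 4 ^ γ + 7 * 2 ^ (γ - 1) / (1 - (1 / 2) ^ (γ - 1)), ?_, ?_⟩
  · have : (1 / 2 : ℝ) ^ (γ - 1) < 1 := Real.rpow_lt_one (by norm_num) (by norm_num) (by linarith)
    have : 0 < 1 - (1 / 2 : ℝ) ^ (γ - 1) := by linarith
    positivity
  · intro a b M Ξ hab hlen hM hΞ
    obtain ⟨I, hI⟩ := exists_sewing_of_nonneg (Ξ := fun s t => Ξ (min (a + s) b) (min (a + t) b))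
      hM hγ (fun s u t hs hsu hut => by
        refine (hΞ _ _ _ (le_min (by linarith) hab) (min_le_min_right _ (by linarith))
          (min_le_min_right _ (by linarith)) (min_le_right _ _)).trans ?_
        have h1 : min (a + s) b ≤ min (a + t) b := min_le_min_right _ (by linarith)
        have h2 : min (a + t) b - min (a + s) b ≤ t - s := by
          rcases min_cases (a + s) b with h | h <;> rcases min_cases (a + t) b with h' | h' <;>
            linarith
        exact mul_le_mul_of_nonneg_left
          (Real.rpow_le_rpow (by linarith) h2 (by linarith)) hM)
    refine ⟨fun t => I (t - a), fun s t hs hst ht => ?_⟩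
    have := hI (s - a) (t - a) (by linarith) (by linarith) (by linarith)
    simpa [min_eq_left ht, min_eq_left (hst.trans ht)] using this

end Sewing

lemma exists_short_step {G δ : ℝ} (hG : 0 ≤ G) (hδ : 0 < δ) :
    ∃ τ : ℝ, 0 < τ ∧ τ ≤ 1 ∧ ∀ l, 0 ≤ l → l ≤ τ → G * l ^ δ ≤ 1 / 2 := by
  have h1 : (0 : ℝ) < 1 / (2 * (G + 1)) := by positivity
  have h2 : (1 : ℝ) / (2 * (G + 1)) ≤ 1 := by
    rw [div_le_one (by positivity)]; linarith
  refine ⟨(1 / (2 * (G + 1))) ^ δ⁻¹, by positivity, Real.rpow_le_one h1.le h2 (by positivity),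
    fun l hl hl' => ?_⟩
  have h3 := Real.rpow_le_rpow hl hl' hδ.le
  rw [Real.rpow_inv_rpow h1.le hδ.ne'] at h3
  calc G * l ^ δ ≤ G * (1 / (2 * (G + 1))) := by gcongr
    _ ≤ (G + 1) * (1 / (2 * (G + 1))) := by gcongr; linarith
    _ = 1 / 2 := by field_simp

section HolderPath

variable {V : Type*} [NormedAddCommGroup V]

/-- The path `x` is `α`-Hölder on `[a, b]` with constant `H`. -/
def HolderOnIcc (α H a b : ℝ) (x : ℝ → V) : Prop :=
  ∀ s t, a ≤ s → s ≤ t → t ≤ b → ‖x t - x s‖ ≤ H * (t - s) ^ α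

lemma HolderOnIcc.mono {α H a b a' b' : ℝ} {x : ℝ → V} (hx : HolderOnIcc α H a b x)
    (ha : a ≤ a') (hb : b' ≤ b) : HolderOnIcc α H a' b' x :=
  fun s t hs hst ht => hx s t (ha.trans hs) hst (ht.trans hb)

lemma HolderOnIcc.mono_const {α H H' a b : ℝ} {x : ℝ → V} (hx : HolderOnIcc α H a b x)
    (hH : H ≤ H') : HolderOnIcc α H' a b x := fun s t hs hst ht =>
  (hx s t hs hst ht).trans
    (mul_le_mul_of_nonneg_right hH (Real.rpow_nonneg (by linarith) _))

lemma HolderOnIcc.continuousOn {α H a b : ℝ} {x : ℝ → V} (hα : 0 < α)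
    (hx : HolderOnIcc α H a b x) : ContinuousOn x (Set.Icc a b) := by
  intro s hs
  have hlim : Tendsto (fun t => H * |t - s| ^ α) (𝓝[Set.Icc a b] s) (𝓝 0) := by
    have : Continuous fun t : ℝ => H * |t - s| ^ α :=
      continuous_const.mul ((continuous_id.sub continuous_const).abs.rpow_const
        fun _ => Or.inr hα.le)
    have h := this.tendsto s
    simp only [sub_self, abs_zero, Real.zero_rpow hα.ne', mul_zero] at h
    exact h.mono_left nhdsWithin_le_nhds
  refine tendsto_iff_norm_sub_tendsto_zero.mpr (squeeze_zero' (Eventually.of_forall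
    fun _ => norm_nonneg _) ?_ hlim)
  filter_upwards [self_mem_nhdsWithin] with t ht
  rcases le_total s t with h | h
  · rw [abs_of_nonneg (by linarith)]
    exact hx s t hs.1 h ht.2
  · rw [norm_sub_rev, abs_sub_comm, abs_of_nonneg (by linarith)]
    exact hx t s ht.1 h hs.2

lemma HolderOnIcc.congr {α H a b : ℝ} {x y : ℝ → V} (hx : HolderOnIcc α H a b x)
    (h : ∀ t, a ≤ t → t ≤ b → y t = x t) : HolderOnIcc α H a b y := fun s t hs hst ht => by
  rw [h s hs (hst.trans ht), h t (hs.trans hst) ht]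
  exact hx s t hs hst ht

lemma HolderOnIcc.trans {α H H' a b c : ℝ} {x : ℝ → V} (hα : 0 ≤ α) (hH : 0 ≤ H) (hH' : 0 ≤ H')
    (h₁ : HolderOnIcc α H a b x) (h₂ : HolderOnIcc α H' b c x) :
    HolderOnIcc α (H + H') a c x := by
  intro s t hs hst ht
  have hp : 0 ≤ (t - s) ^ α := Real.rpow_nonneg (by linarith) _
  rcases le_total t b with htb | htb
  · exact (h₁ s t hs hst htb).trans (by nlinarith)
  rcases le_total b s with hbs | hbs
  · exact (h₂ s t hbs hst ht).trans (by nlinarith)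
  have e : x t - x s = (x b - x s) + (x t - x b) := by abel
  rw [e, add_mul]
  refine (norm_add_le _ _).trans (add_le_add ((h₁ s b hs hbs le_rfl).trans ?_)
    ((h₂ b t le_rfl htb ht).trans ?_))
  · exact mul_le_mul_of_nonneg_left (Real.rpow_le_rpow (by linarith) (by linarith) hα) hH
  · exact mul_le_mul_of_nonneg_left (Real.rpow_le_rpow (by linarith) (by linarith) hα) hH'

/-- A path which is Hölder continuous with exponent larger than one is constant. -/
lemma eq_of_norm_sub_le_rpow {γ K a b : ℝ} (hγ : 1 < γ) {J : ℝ → V}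
    (hJ : HolderOnIcc γ K a b J) {s t : ℝ} (hs : a ≤ s) (hst : s ≤ t) (ht : t ≤ b) :
    J t = J s := by
  have key : ∀ n : ℕ, ∀ s t, a ≤ s → s ≤ t → t ≤ b →
      ‖J t - J s‖ ≤ K * (t - s) ^ γ * (2 * (1 / 2) ^ γ) ^ n := by
    intro n
    induction n with
    | zero => intro s t hs hst ht; simpa using hJ s t hs hst ht
    | succ n ih =>
      intro s t hs hst ht
      have h1 := ih s ((s + t) / 2) hs (by linarith) (by linarith)
      have h2 := ih ((s + t) / 2) t (by linarith) (by linarith) ht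
      have e1 : (s + t) / 2 - s = (t - s) * (1 / 2) := by ring
      have e2 : t - (s + t) / 2 = (t - s) * (1 / 2) := by ring
      rw [e1, Real.mul_rpow (by linarith) (by norm_num)] at h1
      rw [e2, Real.mul_rpow (by linarith) (by norm_num)] at h2
      have e : J t - J s = (J ((s + t) / 2) - J s) + (J t - J ((s + t) / 2)) := by abel
      rw [e, pow_succ]
      refine (norm_add_le _ _).trans ((add_le_add h1 h2).trans (le_of_eq ?_))
      ring
  have hr : (2 : ℝ) * (1 / 2) ^ γ < 1 := by
    have : (1 / 2 : ℝ) ^ γ < (1 / 2) ^ (1 : ℝ) :=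
      Real.rpow_lt_rpow_of_exponent_gt (by norm_num) (by norm_num) hγ
    rw [Real.rpow_one] at this
    linarith
  have hlim : Tendsto (fun n : ℕ => K * (t - s) ^ γ * (2 * (1 / 2) ^ γ) ^ n) atTop
      (𝓝 (K * (t - s) ^ γ * 0)) :=
    (tendsto_pow_atTop_nhds_zero_of_lt_one (by positivity) hr).const_mul _
  rw [mul_zero] at hlim
  have := ge_of_tendsto' hlim fun n => key n s t hs hst ht
  exact sub_eq_zero.mp (norm_le_zero_iff.mp this)

end HolderPath

section YoungEquation

variable {V : Type*} [NormedAddCommGroup V] [NormedSpace ℝ V]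

/-- On `[a, b]`, the increments of `z` agree with those of `∫ F(r, x_r) dr + ∫ A(dr, x_r)` up to
an error of order `γ`. -/
def RemainderBound (A F : ℝ → V → V) (γ K a b : ℝ) (x z : ℝ → V) : Prop :=
  ∀ s t, a ≤ s → s ≤ t → t ≤ b →
    ‖z t - z s - (∫ r in s..t, F r (x r)) - (A t (x s) - A s (x s))‖ ≤ K * (t - s) ^ γ

/-- The coefficients `A ∈ C^α_t C^{1+β}_V` and `F` bounded, continuous and Lipschitz in space. -/
structure IsMixedDriver (α β T MA CF : ℝ) (A : ℝ → V → V) (DA : ℝ → V → (V →L[ℝ] V))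
    (F : ℝ → V → V) : Prop where
  α_pos : 0 < α
  α_lt_one : α < 1
  β_pos : 0 < β
  β_lt_one : β < 1
  one_lt : 1 < α * (1 + β)
  MA_nonneg : 0 ≤ MA
  CF_nonneg : 0 ≤ CF
  hasFDerivAt : ∀ t z, 0 ≤ t → t ≤ T → HasFDerivAt (A t) (DA t z) z
  norm_A_sub_le : ∀ s t z, 0 ≤ s → s ≤ t → t ≤ T → ‖A t z - A s z‖ ≤ MA * (t - s) ^ α
  norm_A_sub_sub_le : ∀ s t z w, 0 ≤ s → s ≤ t → t ≤ T →
    ‖A t z - A s z - (A t w - A s w)‖ ≤ MA * (t - s) ^ α * ‖z - w‖ ^ β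
  norm_DA_sub_le : ∀ s t z, 0 ≤ s → s ≤ t → t ≤ T → ‖DA t z - DA s z‖ ≤ MA * (t - s) ^ α
  norm_DA_sub_sub_le : ∀ s t z w, 0 ≤ s → s ≤ t → t ≤ T →
    ‖DA t z - DA s z - (DA t w - DA s w)‖ ≤ MA * (t - s) ^ α * ‖z - w‖ ^ β
  continuousOn : ContinuousOn (fun p : ℝ × V => F p.1 p.2) (Set.Icc 0 T ×ˢ Set.univ)
  norm_F_le : ∀ t y, 0 ≤ t → t ≤ T → ‖F t y‖ ≤ CF
  norm_F_sub_le : ∀ t y z, 0 ≤ t → t ≤ T → ‖F t y - F t z‖ ≤ CF * ‖y - z‖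

lemma RemainderBound.congr {A F : ℝ → V → V} {γ K a b : ℝ} {x y : ℝ → V}
    (hx : RemainderBound A F γ K a b x x) (h : ∀ t, a ≤ t → t ≤ b → y t = x t) :
    RemainderBound A F γ K a b y y := fun s t hs hst ht => by
  have e : ∫ r in s..t, F r (y r) = ∫ r in s..t, F r (x r) := by
    refine intervalIntegral.integral_congr fun r hr => ?_
    rw [Set.uIcc_of_le hst] at hr
    simp only [h r (hs.trans hr.1) (hr.2.trans ht)]
  rw [h s hs (hst.trans ht), h t (hs.trans hst) ht, e]
  exact hx s t hs hst ht

/-- Second-order increments of a map with bounded `β`-Hölder derivative. -/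
lemma norm_sub_sub_sub_le_of_holder_deriv {f : V → V} {f' : V → V →L[ℝ] V} {m β : ℝ}
    (hf : ∀ z, HasFDerivAt f (f' z) z) (hbd : ∀ z, ‖f' z‖ ≤ m)
    (hhol : ∀ z w, ‖f' z - f' w‖ ≤ m * ‖z - w‖ ^ β) (p p' q q' : V) :
    ‖f p - f p' - (f q - f q')‖ ≤ m * (‖p' - q'‖ ^ β * ‖p - p'‖ + ‖p - p' - (q - q')‖) := by
  have h1 : ‖f (q' + (p - p')) - f q‖ ≤ m * ‖p - p' - (q - q')‖ := by
    have := convex_univ.norm_image_sub_le_of_norm_hasFDerivWithin_le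
      (fun z _ => (hf z).hasFDerivWithinAt) (fun z _ => hbd z) (Set.mem_univ q)
      (Set.mem_univ (q' + (p - p')))
    rwa [show q' + (p - p') - q = p - p' - (q - q') by abel] at this
  have h2 : ‖(f p - f (q' + (p - p'))) - (f p' - f q')‖ ≤ m * ‖p' - q'‖ ^ β * ‖p - p'‖ := by
    have hd : ∀ v ∈ (Set.univ : Set V), HasFDerivWithinAt (fun v => f (v + (p' - q')) - f v)
        (f' (v + (p' - q')) - f' v) Set.univ v := fun v _ =>
      (((hasFDerivAt_comp_add_right (p' - q')).mpr (hf _)).sub (hf v)).hasFDerivWithinAt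
    have := convex_univ.norm_image_sub_le_of_norm_hasFDerivWithin_le hd
      (fun v _ => by
        have := hhol (v + (p' - q')) v
        rwa [add_sub_cancel_left] at this) (Set.mem_univ q') (Set.mem_univ (q' + (p - p')))
    simp only [add_sub_cancel_left] at this
    rwa [show q' + (p - p') + (p' - q') = p by abel, show q' + (p' - q') = p' by abel] at this
  have e : f p - f p' - (f q - f q')
      = ((f p - f (q' + (p - p'))) - (f p' - f q')) + (f (q' + (p - p')) - f q) := by abel
  rw [e]
  refine (norm_add_le _ _).trans ((add_le_add h2 h1).trans (le_of_eq (by ring)))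

namespace IsMixedDriver

variable {α β T MA CF : ℝ} {A : ℝ → V → V} {DA : ℝ → V → (V →L[ℝ] V)} {F : ℝ → V → V}
  {C H a b : ℝ}

lemma intervalIntegrable (h : IsMixedDriver α β T MA CF A DA F) {x : ℝ → V}
    (hx : HolderOnIcc α H a b x) (ha : 0 ≤ a) (hb : b ≤ T) {s t : ℝ} (hs : a ≤ s) (hst : s ≤ t)
    (ht : t ≤ b) : IntervalIntegrable (fun r => F r (x r)) MeasureTheory.volume s t := by
  refine ContinuousOn.intervalIntegrable_of_Icc hst ?_
  have hxc := (hx.continuousOn h.α_pos).mono (Set.Icc_subset_Icc hs ht)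
  exact h.continuousOn.comp (continuousOn_id.prodMk hxc) fun r hr =>
    ⟨⟨ha.trans (hs.trans hr.1), hr.2.trans (ht.trans hb)⟩, Set.mem_univ _⟩

lemma norm_integral_le (h : IsMixedDriver α β T MA CF A DA F) (x : ℝ → V) {s t : ℝ}
    (hs : 0 ≤ s) (hst : s ≤ t) (ht : t ≤ T) (hlen : t - s ≤ 1) :
    ‖∫ r in s..t, F r (x r)‖ ≤ CF * (t - s) ^ α := by
  have := intervalIntegral.norm_integral_le_of_norm_le_const (a := s) (b := t) (C := CF)
    (f := fun r => F r (x r)) (fun r hr => by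
      rw [Set.uIoc_of_le hst] at hr
      exact h.norm_F_le r _ (by linarith [hr.1]) (by linarith [hr.2]))
  rw [abs_of_nonneg (by linarith)] at this
  exact this.trans (mul_le_mul_of_nonneg_left
    (Real.self_le_rpow_of_le_one (by linarith) hlen h.α_lt_one.le) h.CF_nonneg)

lemma norm_integral_sub_le (h : IsMixedDriver α β T MA CF A DA F) {x x' : ℝ → V} {S : ℝ}
    (hx : HolderOnIcc α H a b x) (hx' : HolderOnIcc α H a b x') (ha : 0 ≤ a) (hb : b ≤ T)
    (hS : ∀ t, a ≤ t → t ≤ b → ‖x t - x' t‖ ≤ S) {s t : ℝ} (hs : a ≤ s) (hst : s ≤ t)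
    (ht : t ≤ b) : ‖(∫ r in s..t, F r (x r)) - ∫ r in s..t, F r (x' r)‖ ≤ CF * S * (t - s) := by
  rw [← intervalIntegral.integral_sub (h.intervalIntegrable hx ha hb hs hst ht)
    (h.intervalIntegrable hx' ha hb hs hst ht)]
  have := intervalIntegral.norm_integral_le_of_norm_le_const (a := s) (b := t) (C := CF * S)
    (f := fun r => F r (x r) - F r (x' r)) (fun r hr => by
      rw [Set.uIoc_of_le hst] at hr
      exact (h.norm_F_sub_le r _ _ (by linarith [hr.1]) (by linarith [hr.2])).trans
        (mul_le_mul_of_nonneg_left (hS r (by linarith [hr.1]) (by linarith [hr.2])) h.CF_nonneg))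
  rwa [abs_of_nonneg (by linarith)] at this

lemma rpow_mul_rpow_le (h : IsMixedDriver α β T MA CF A DA F) {s u t : ℝ} (hsu : s ≤ u)
    (hut : u ≤ t) : (t - u) ^ α * (u - s) ^ (α * β) ≤ (t - s) ^ (α * (1 + β)) := by
  have hα := h.α_pos
  have hβ := h.β_pos
  rw [mul_add, mul_one, Real.rpow_add_of_nonneg (by linarith) hα.le (by positivity)]
  have h1 : 0 ≤ t - u := by linarith
  have h2 : 0 ≤ u - s := by linarith
  exact mul_le_mul (Real.rpow_le_rpow h1 (by linarith) hα.le)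
    (Real.rpow_le_rpow h2 (by linarith) (by positivity)) (by positivity)
    (Real.rpow_nonneg (by linarith) _)

lemma rpow_le_mul_rpow (h : IsMixedDriver α β T MA CF A DA F) {s t : ℝ} (hs : a ≤ s)
    (hst : s ≤ t) (ht : t ≤ b) :
    (t - s) ^ (α * (1 + β)) ≤ (b - a) ^ (α * β) * (t - s) ^ α := by
  have hα := h.α_pos
  have hβ := h.β_pos
  rw [mul_add, mul_one, Real.rpow_add_of_nonneg (by linarith) hα.le (by positivity), mul_comm]
  exact mul_le_mul_of_nonneg_right (Real.rpow_le_rpow (by linarith) (by linarith) (by positivity))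
    (Real.rpow_nonneg (by linarith) _)

lemma norm_increment_le (h : IsMixedDriver α β T MA CF A DA F) {x : ℝ → V} (hH : 0 ≤ H)
    (hx : HolderOnIcc α H a b x) (ha : 0 ≤ a) (hb : b ≤ T) {s u t : ℝ} (hs : a ≤ s)
    (hsu : s ≤ u) (hut : u ≤ t) (ht : t ≤ b) :
    ‖A t (x s) - A u (x s) - (A t (x u) - A u (x u))‖ ≤ MA * H ^ β * (t - s) ^ (α * (1 + β)) := by
  have hα := h.α_pos
  have hβ := h.β_pos
  have hMA := h.MA_nonneg
  have h1 : ‖x s - x u‖ ^ β ≤ H ^ β * (u - s) ^ (α * β) := by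
    rw [Real.rpow_mul (by linarith), ← Real.mul_rpow hH (Real.rpow_nonneg (by linarith) _),
      norm_sub_rev]
    exact Real.rpow_le_rpow (norm_nonneg _) (hx s u hs hsu (hut.trans ht)) hβ.le
  have h2 := h.rpow_mul_rpow_le hsu hut
  have h3 : 0 ≤ (t - u) ^ α := Real.rpow_nonneg (by linarith) _
  calc _ ≤ MA * (t - u) ^ α * ‖x s - x u‖ ^ β :=
        h.norm_A_sub_sub_le u t _ _ (by linarith) hut (by linarith)
    _ ≤ MA * (t - u) ^ α * (H ^ β * (u - s) ^ (α * β)) := by gcongr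
    _ = MA * H ^ β * ((t - u) ^ α * (u - s) ^ (α * β)) := by ring
    _ ≤ _ := by gcongr

/-- Existence of the integral `∫ F(r, x_r) dr + ∫ A(dr, x_r)` along a Hölder path. -/
lemma exists_integral (h : IsMixedDriver α β T MA CF A DA F)
    (hC : IsSewingConstant V (α * (1 + β)) C) (hC0 : 0 ≤ C) {x : ℝ → V} (hH : 0 ≤ H)
    (hx : HolderOnIcc α H a b x) (ha : 0 ≤ a) (hab : a ≤ b) (hb : b ≤ T) (hlen : b - a ≤ 1) :
    ∃ z : ℝ → V, z a = x a ∧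
      HolderOnIcc α (CF + MA + C * (MA * H ^ β) * (b - a) ^ (α * β)) a b z ∧
      RemainderBound A F (α * (1 + β)) (C * (MA * H ^ β)) a b x z := by
  have hMA := h.MA_nonneg
  obtain ⟨I, hI⟩ := hC a b (MA * H ^ β) (fun s t => A t (x s) - A s (x s)) hab hlen
    (by positivity) (fun s u t hs hsu hut ht => by
      refine (le_of_eq ?_).trans (h.norm_increment_le hH hx ha hb hs hsu hut ht)
      congr 1; abel)
  set z : ℝ → V := fun t => x a + (∫ r in a..t, F r (x r)) + (I t - I a) with hz
  have hzst : ∀ s t, a ≤ s → s ≤ t → t ≤ b →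
      z t - z s = (∫ r in s..t, F r (x r)) + (I t - I s) := by
    intro s t hs hst ht
    have := intervalIntegral.integral_add_adjacent_intervals
      (h.intervalIntegrable hx ha hb le_rfl hs (hst.trans ht))
      (h.intervalIntegrable hx ha hb hs hst ht)
    simp only [hz]
    rw [← this]
    abel
  have hR : RemainderBound A F (α * (1 + β)) (C * (MA * H ^ β)) a b x z := by
    intro s t hs hst ht
    rw [hzst s t hs hst ht, add_sub_cancel_left]
    exact hI s t hs hst ht
  refine ⟨z, by simp [hz], fun s t hs hst ht => ?_, hR⟩
  have h1 := hR s t hs hst ht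
  have h2 := h.norm_integral_le x (by linarith : 0 ≤ s) hst (ht.trans hb) (by linarith)
  have h3 := h.norm_A_sub_le s t (x s) (by linarith) hst (by linarith)
  have h4 := mul_le_mul_of_nonneg_left (h.rpow_le_mul_rpow hs hst ht)
    (by positivity : 0 ≤ C * (MA * H ^ β))
  have e : z t - z s = (z t - z s - (∫ r in s..t, F r (x r)) - (A t (x s) - A s (x s)))
    + (∫ r in s..t, F r (x r)) + (A t (x s) - A s (x s)) := by abel
  rw [e]
  refine (norm_add₃_le).trans ((add_le_add (add_le_add h1 h2) h3).trans ?_)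
  linarith

/-- Stability of the integral `∫ F(r, x_r) dr + ∫ A(dr, x_r)` with respect to the path `x`, with
a gain on short intervals. -/
lemma holderOnIcc_sub (h : IsMixedDriver α β T MA CF A DA F)
    (hC : IsSewingConstant V (α * (1 + β)) C) (hC0 : 0 ≤ C) {x x' z z' : ℝ → V} {L K K' : ℝ}
    (hH : 0 ≤ H) (hL : 0 ≤ L)
    (hx : HolderOnIcc α H a b x) (hx' : HolderOnIcc α H a b x') (ha : 0 ≤ a) (hab : a ≤ b)
    (hb : b ≤ T) (hlen : b - a ≤ 1) (hxa : x a = x' a)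
    (hD : HolderOnIcc α L a b (fun t => x t - x' t))
    (hz : RemainderBound A F (α * (1 + β)) K a b x z)
    (hz' : RemainderBound A F (α * (1 + β)) K' a b x' z') :
    HolderOnIcc α ((MA + CF + C * (MA * (H ^ β + 1))) * (b - a) ^ (α * β) * L) a b
      (fun t => z t - z' t) := by
  have hα := h.α_pos
  have hβ := h.β_pos
  have hMA := h.MA_nonneg
  have hCF := h.CF_nonneg
  have hγ := h.one_lt
  have hba : 0 ≤ b - a := by linarith
  set S := L * (b - a) ^ (α * β) with hSdef
  have hS0 : 0 ≤ S := by positivity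
  have hSL : S ≤ L := mul_le_of_le_one_right hL (Real.rpow_le_one hba hlen (by positivity))
  have hS : ∀ t, a ≤ t → t ≤ b → ‖x t - x' t‖ ≤ S := by
    intro t hat htb
    have := hD a t le_rfl hat htb
    simp only [hxa, sub_self, sub_zero] at this
    refine this.trans (mul_le_mul_of_nonneg_left ?_ hL)
    calc (t - a) ^ α ≤ (b - a) ^ α := Real.rpow_le_rpow (by linarith) (by linarith) hα.le
      _ ≤ (b - a) ^ (α * β) := by
        refine Real.rpow_le_rpow_of_exponent_ge_of_imp hba hlen ?_ ?_
        · nlinarith [h.β_lt_one]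
        · intro h0 h1
          exact absurd h1 hα.ne'
  set Ξ : ℝ → ℝ → V := fun s t => A t (x s) - A s (x s) - (A t (x' s) - A s (x' s)) with hΞ
  have hΞδ : ∀ s u t, a ≤ s → s ≤ u → u ≤ t → t ≤ b →
      ‖Ξ s t - Ξ s u - Ξ u t‖ ≤ MA * (H ^ β + 1) * L * (t - s) ^ (α * (1 + β)) := by
    intro s u t hs hsu hut ht
    have hu0 : 0 ≤ u := by linarith
    have htT : t ≤ T := by linarith
    have hsu' : 0 ≤ u - s := by linarith
    have htu' : 0 ≤ t - u := by linarith
    have h4 := norm_sub_sub_sub_le_of_holder_deriv (f := fun v => A t v - A u v)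
      (f' := fun v => DA t v - DA u v) (m := MA * (t - u) ^ α) (β := β)
      (fun v => (h.hasFDerivAt t v (by linarith) htT).sub (h.hasFDerivAt u v hu0 (by linarith)))
      (fun v => h.norm_DA_sub_le u t v hu0 hut htT)
      (fun v w => h.norm_DA_sub_sub_le u t v w hu0 hut htT) (x s) (x' s) (x u) (x' u)
    have e : Ξ s t - Ξ s u - Ξ u t = A t (x s) - A u (x s) - (A t (x' s) - A u (x' s))
        - (A t (x u) - A u (x u) - (A t (x' u) - A u (x' u))) := by
      simp only [hΞ]; abel
    rw [e]
    refine h4.trans ?_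
    have h5 : ‖x' s - x' u‖ ^ β ≤ H ^ β * (u - s) ^ (α * β) := by
      rw [Real.rpow_mul hsu', ← Real.mul_rpow hH (Real.rpow_nonneg hsu' _), norm_sub_rev]
      exact Real.rpow_le_rpow (norm_nonneg _) (hx' s u hs hsu (hut.trans ht)) hβ.le
    have h6 : ‖x s - x' s - (x u - x' u)‖ ≤ L * (u - s) ^ (α * β) := by
      rw [norm_sub_rev]
      refine (hD s u hs hsu (hut.trans ht)).trans (mul_le_mul_of_nonneg_left ?_ hL)
      refine Real.rpow_le_rpow_of_exponent_ge_of_imp hsu' (by linarith) ?_ ?_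
      · nlinarith [h.β_lt_one]
      · intro h0 h1
        exact absurd h1 hα.ne'
    have h7 := (hS s hs (by linarith)).trans hSL
    calc MA * (t - u) ^ α * (‖x' s - x' u‖ ^ β * ‖x s - x' s‖ + ‖x s - x' s - (x u - x' u)‖)
        ≤ MA * (t - u) ^ α * (H ^ β * (u - s) ^ (α * β) * L + L * (u - s) ^ (α * β)) := by
          gcongr
      _ = MA * (H ^ β + 1) * L * ((t - u) ^ α * (u - s) ^ (α * β)) := by ring
      _ ≤ _ := by
        have := h.rpow_mul_rpow_le hsu hut
        gcongr
  obtain ⟨I, hI⟩ := hC a b (MA * (H ^ β + 1) * L) Ξ hab hlen (by positivity) hΞδ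
  intro s t hs hst ht
  set N : ℝ → ℝ → V := fun s t => (∫ r in s..t, F r (x r)) - ∫ r in s..t, F r (x' r) with hN
  have hNadd : ∀ s t, a ≤ s → s ≤ t → t ≤ b → N a t - N a s = N s t := by
    intro s t hs hst ht
    have h1 := intervalIntegral.integral_add_adjacent_intervals
      (h.intervalIntegrable hx ha hb le_rfl hs (hst.trans ht))
      (h.intervalIntegrable hx ha hb hs hst ht)
    have h2 := intervalIntegral.integral_add_adjacent_intervals
      (h.intervalIntegrable hx' ha hb le_rfl hs (hst.trans ht))
      (h.intervalIntegrable hx' ha hb hs hst ht)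
    simp only [hN]
    rw [← h1, ← h2]
    abel
  have hJ : HolderOnIcc (α * (1 + β)) (K + K' + C * (MA * (H ^ β + 1) * L)) a b
      (fun t => z t - z' t - N a t - I t) := by
    intro s t hs hst ht
    have h1 := hz s t hs hst ht
    have h2 := hz' s t hs hst ht
    have h3 := hI s t hs hst ht
    have e : z t - z' t - N a t - I t - (z s - z' s - N a s - I s)
        = (z t - z s - (∫ r in s..t, F r (x r)) - (A t (x s) - A s (x s)))
          - (z' t - z' s - (∫ r in s..t, F r (x' r)) - (A t (x' s) - A s (x' s)))
          - (I t - I s - Ξ s t) := by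
      have : z t - z' t - N a t - I t - (z s - z' s - N a s - I s)
        = z t - z' t - (z s - z' s) - (N a t - N a s) - (I t - I s) := by abel
      rw [this, hNadd s t hs hst ht]
      simp only [hN, hΞ]
      abel
    rw [e, add_mul, add_mul]
    exact (norm_sub_le _ _).trans (add_le_add ((norm_sub_le _ _).trans (add_le_add h1 h2)) h3)
  have hJ0 := eq_of_norm_sub_le_rpow hγ hJ hs hst ht
  have e : z t - z' t - (z s - z' s) = N s t + (I t - I s - Ξ s t) + Ξ s t := by
    rw [← hNadd s t hs hst ht]
    have e1 := sub_eq_zero.mpr hJ0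
    rw [← sub_eq_zero, ← e1]
    abel
  rw [e]
  have hts : 0 ≤ t - s := by linarith
  have h1 : ‖N s t‖ ≤ CF * S * (t - s) ^ α :=
    (h.norm_integral_sub_le hx hx' ha hb hS hs hst ht).trans (mul_le_mul_of_nonneg_left
      (Real.self_le_rpow_of_le_one hts (by linarith) h.α_lt_one.le) (by positivity))
  have h2 : ‖Ξ s t‖ ≤ MA * (t - s) ^ α * S := by
    have := convex_univ.norm_image_sub_le_of_norm_hasFDerivWithin_le
      (f := fun v => A t v - A s v) (f' := fun v => DA t v - DA s v) (C := MA * (t - s) ^ α)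
      (fun v _ => ((h.hasFDerivAt t v (by linarith) (by linarith)).sub
        (h.hasFDerivAt s v (by linarith) (by linarith))).hasFDerivWithinAt)
      (fun v _ => h.norm_DA_sub_le s t v (by linarith) hst (by linarith))
      (Set.mem_univ (x' s)) (Set.mem_univ (x s))
    exact this.trans (mul_le_mul_of_nonneg_left (hS s hs (by linarith)) (by positivity))
  have h3 : ‖I t - I s - Ξ s t‖ ≤
      C * (MA * (H ^ β + 1) * L) * ((b - a) ^ (α * β) * (t - s) ^ α) :=
    (hI s t hs hst ht).trans (mul_le_mul_of_nonneg_left (h.rpow_le_mul_rpow hs hst ht)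
      (by positivity))
  refine (norm_add₃_le).trans ((add_le_add (add_le_add h1 h3) h2).trans (le_of_eq ?_))
  rw [hSdef]
  ring

lemma remainderBound_trans (h : IsMixedDriver α β T MA CF A DA F) {c K K' : ℝ} {x : ℝ → V}
    (hH : 0 ≤ H) (hK : 0 ≤ K) (hK' : 0 ≤ K') (ha : 0 ≤ a) (hc : c ≤ T)
    (hx : HolderOnIcc α H a c x)
    (h₁ : RemainderBound A F (α * (1 + β)) K a b x x)
    (h₂ : RemainderBound A F (α * (1 + β)) K' b c x x) :
    RemainderBound A F (α * (1 + β)) (K + K' + MA * H ^ β) a c x x := by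
  intro s t hs hst ht
  have hMA := h.MA_nonneg
  have hγ := h.one_lt
  have hp : 0 ≤ (t - s) ^ (α * (1 + β)) := Real.rpow_nonneg (by linarith) _
  have hH' : 0 ≤ MA * H ^ β := by positivity
  rcases le_total t b with htb | htb
  · exact (h₁ s t hs hst htb).trans (by nlinarith)
  rcases le_total b s with hbs | hbs
  · exact (h₂ s t hbs hst ht).trans (by nlinarith)
  have h1 := h₁ s b hs hbs le_rfl
  have h2 := h₂ b t le_rfl htb ht
  have h3 := h.norm_increment_le hH hx ha hc hs hbs htb ht
  have h4 := intervalIntegral.integral_add_adjacent_intervals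
    (h.intervalIntegrable hx ha hc hs hbs (htb.trans ht))
    (h.intervalIntegrable hx ha hc (hs.trans hbs) htb ht)
  have h5 : K * (b - s) ^ (α * (1 + β)) ≤ K * (t - s) ^ (α * (1 + β)) :=
    mul_le_mul_of_nonneg_left (Real.rpow_le_rpow (by linarith) (by linarith) (by linarith)) hK
  have h6 : K' * (t - b) ^ (α * (1 + β)) ≤ K' * (t - s) ^ (α * (1 + β)) :=
    mul_le_mul_of_nonneg_left (Real.rpow_le_rpow (by linarith) (by linarith) (by linarith)) hK'
  have e : x t - x s - (∫ r in s..t, F r (x r)) - (A t (x s) - A s (x s))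
      = (x b - x s - (∫ r in s..b, F r (x r)) - (A b (x s) - A s (x s)))
        + (x t - x b - (∫ r in b..t, F r (x r)) - (A t (x b) - A b (x b)))
        - (A t (x s) - A b (x s) - (A t (x b) - A b (x b))) := by
    rw [← h4]; abel
  rw [e]
  refine (norm_sub_le _ _).trans ((add_le_add ((norm_add_le _ _).trans (add_le_add h1 h2))
    h3).trans ?_)
  linarith

/-- Two solutions with the same initial value agree on short intervals. -/
lemma eqOn_of_short (h : IsMixedDriver α β T MA CF A DA F)
    (hC : IsSewingConstant V (α * (1 + β)) C) (hC0 : 0 ≤ C) (hH : 0 ≤ H) (ha : 0 ≤ a)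
    (hab : a ≤ b) (hb : b ≤ T) (hlen : b - a ≤ 1)
    (hstep : (MA + CF + C * (MA * (H ^ β + 1))) * (b - a) ^ (α * β) ≤ 1 / 2) {x x' : ℝ → V}
    {K K' : ℝ} (hx : HolderOnIcc α H a b x) (hx' : HolderOnIcc α H a b x')
    (hR : RemainderBound A F (α * (1 + β)) K a b x x)
    (hR' : RemainderBound A F (α * (1 + β)) K' a b x' x') (hxa : x a = x' a) :
    ∀ t, a ≤ t → t ≤ b → x t = x' t := by
  have key : ∀ n : ℕ, HolderOnIcc α ((1 / 2) ^ n * (2 * H)) a b (fun t => x t - x' t) := by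
    intro n
    induction n with
    | zero =>
      intro s t hs hst ht
      rw [show x t - x' t - (x s - x' s) = (x t - x s) - (x' t - x' s) by abel]
      refine (norm_sub_le _ _).trans ((add_le_add (hx s t hs hst ht)
        (hx' s t hs hst ht)).trans (le_of_eq (by ring)))
    | succ n ih =>
      refine (h.holderOnIcc_sub hC hC0 hH (by positivity) hx hx' ha hab hb hlen hxa ih hR
        hR').mono_const ?_
      rw [pow_succ, mul_comm _ (1 / 2 : ℝ), mul_assoc (1 / 2 : ℝ)]
      exact mul_le_mul_of_nonneg_right hstep (by positivity)
  intro t hat htb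
  have hlim : Tendsto (fun n : ℕ => (1 / 2 : ℝ) ^ n * (2 * H) * (t - a) ^ α) atTop
      (𝓝 (0 * (2 * H) * (t - a) ^ α)) :=
    ((tendsto_pow_atTop_nhds_zero_of_lt_one (by norm_num) (by norm_num)).mul_const _).mul_const _
  have h1 := ge_of_tendsto' hlim fun n => key n a t le_rfl hat htb
  simp only [hxa, sub_self, sub_zero, zero_mul] at h1
  exact sub_eq_zero.mp (norm_le_zero_iff.mp h1)

/-- Existence of solutions on short intervals. -/
lemma exists_solution_of_short [CompleteSpace V] (h : IsMixedDriver α β T MA CF A DA F)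
    (hC : IsSewingConstant V (α * (1 + β)) C) (hC0 : 0 ≤ C) (hH : H = CF + MA + 1) (ha : 0 ≤ a)
    (hab : a ≤ b) (hb : b ≤ T) (hlen : b - a ≤ 1)
    (hstep : (MA + CF + C * (MA * (H ^ β + 1))) * (b - a) ^ (α * β) ≤ 1 / 2) (p : V) :
    ∃ x : ℝ → V, x a = p ∧ HolderOnIcc α H a b x ∧
      RemainderBound A F (α * (1 + β)) (C * (MA * H ^ β)) a b x x := by
  have hα := h.α_pos
  have hMA := h.MA_nonneg
  have hCF := h.CF_nonneg
  have hH0 : 0 ≤ H := by rw [hH]; positivity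
  have step : ∀ x, HolderOnIcc α H a b x → ∃ z : ℝ → V, z a = x a ∧ HolderOnIcc α H a b z ∧
      RemainderBound A F (α * (1 + β)) (C * (MA * H ^ β)) a b x z := by
    intro x hx
    obtain ⟨z, h1, h2, h3⟩ := h.exists_integral hC hC0 hH0 hx ha hab hb hlen
    refine ⟨z, h1, h2.mono_const ?_, h3⟩
    have h4 : C * (MA * H ^ β) * (b - a) ^ (α * β)
        ≤ (MA + CF + C * (MA * (H ^ β + 1))) * (b - a) ^ (α * β) := by
      refine mul_le_mul_of_nonneg_right ?_ (Real.rpow_nonneg (by linarith) _)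
      have : 0 ≤ C * MA := by positivity
      nlinarith
    rw [hH] at h4 hstep ⊢
    linarith
  choose! Γ hΓa hΓH hΓR using step
  set X : ℕ → ℝ → V := fun n => Γ^[n] (fun _ => p) with hX
  have hXs : ∀ n, X (n + 1) = Γ (X n) := fun n => Function.iterate_succ_apply' _ _ _
  have hXH : ∀ n, HolderOnIcc α H a b (X n) := by
    intro n
    induction n with
    | zero =>
      intro s t hs hst ht
      simpa [hX] using mul_nonneg hH0 (Real.rpow_nonneg (by linarith : 0 ≤ t - s) α)
    | succ n ih => rw [hXs]; exact hΓH _ ih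
  have hXa : ∀ n, X n a = p := by
    intro n
    induction n with
    | zero => simp [hX]
    | succ n ih => rw [hXs, hΓa _ (hXH n), ih]
  have hXR : ∀ n, RemainderBound A F (α * (1 + β)) (C * (MA * H ^ β)) a b (X n) (X (n + 1)) := by
    intro n
    rw [hXs]
    exact hΓR _ (hXH n)
  have hdiff : ∀ n : ℕ, HolderOnIcc α ((1 / 2) ^ n * (2 * H)) a b
      (fun t => X (n + 1) t - X n t) := by
    intro n
    induction n with
    | zero =>
      intro s t hs hst ht
      rw [show X (0 + 1) t - X 0 t - (X (0 + 1) s - X 0 s)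
        = (X (0 + 1) t - X (0 + 1) s) - (X 0 t - X 0 s) by abel]
      refine (norm_sub_le _ _).trans ((add_le_add (hXH 1 s t hs hst ht)
        (hXH 0 s t hs hst ht)).trans (le_of_eq (by ring)))
    | succ n ih =>
      refine (h.holderOnIcc_sub hC hC0 hH0 (by positivity) (hXH (n + 1)) (hXH n) ha hab hb hlen
        (by rw [hXa, hXa]) ih (hXR (n + 1)) (hXR n)).mono_const ?_
      rw [pow_succ, mul_comm _ (1 / 2 : ℝ), mul_assoc (1 / 2 : ℝ)]
      exact mul_le_mul_of_nonneg_right hstep (by positivity)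
  have hdist : ∀ t, a ≤ t → t ≤ b → ∀ n, dist (X n t) (X (n + 1) t) ≤ 2 * H * (1 / 2) ^ n := by
    intro t hat htb n
    have h1 := hdiff n a t le_rfl hat htb
    simp only [hXa, sub_self, sub_zero] at h1
    rw [dist_comm, dist_eq_norm]
    refine h1.trans ?_
    have h2 : (t - a) ^ α ≤ 1 := Real.rpow_le_one (by linarith) (by linarith) hα.le
    have h3 := mul_le_mul_of_nonneg_left h2 (by positivity : 0 ≤ (1 / 2) ^ n * (2 * H))
    linarith
  have hlim : ∀ t, ∃ L, a ≤ t → t ≤ b → Tendsto (fun n => X n t) atTop (𝓝 L) := by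
    intro t
    by_cases ht : a ≤ t ∧ t ≤ b
    · obtain ⟨L, hL⟩ := cauchySeq_tendsto_of_complete
        (cauchySeq_of_le_geometric (1 / 2) (2 * H) (by norm_num) (hdist t ht.1 ht.2))
      exact ⟨L, fun _ _ => hL⟩
    · exact ⟨0, fun h1 h2 => absurd ⟨h1, h2⟩ ht⟩
  choose x hx using hlim
  have hxH : HolderOnIcc α H a b x := fun s t hs hst ht =>
    le_of_tendsto' ((hx t (hs.trans hst) ht).sub (hx s hs (hst.trans ht))).norm
      fun n => hXH n s t hs hst ht
  refine ⟨x, tendsto_nhds_unique (hx a le_rfl hab) (by simp [hXa]), hxH, ?_⟩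
  intro s t hs hst ht
  have hs' := hx s hs (hst.trans ht)
  have hint : Tendsto (fun n => ∫ r in s..t, F r (X n r)) atTop (𝓝 (∫ r in s..t, F r (x r))) := by
    refine tendsto_iff_norm_sub_tendsto_zero.mpr (squeeze_zero (fun _ => norm_nonneg _)
      (fun n => h.norm_integral_sub_le (hXH n) hxH ha hb (S := 2 * H * (1 / 2) ^ n / (1 - 1 / 2))
        (fun r hr hr' => ?_) hs hst ht) ?_)
    · rw [← dist_eq_norm]
      exact dist_le_of_le_geometric_of_tendsto (1 / 2) (2 * H) (by norm_num) (hdist r hr hr')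
        (hx r hr hr') n
    · have h1 : Tendsto (fun n : ℕ => (1 / 2 : ℝ) ^ n) atTop (𝓝 0) :=
        tendsto_pow_atTop_nhds_zero_of_lt_one (by norm_num) (by norm_num)
      simpa using (((h1.const_mul (2 * H)).div_const (1 - 1 / 2)).const_mul CF).mul_const (t - s)
  have hAt := ((h.hasFDerivAt t (x s) (by linarith) (by linarith)).continuousAt.tendsto).comp hs'
  have hAs := ((h.hasFDerivAt s (x s) (by linarith) (by linarith)).continuousAt.tendsto).comp hs'
  exact le_of_tendsto' (((((hx t (hs.trans hst) ht).comp (tendsto_add_atTop_nat 1)).sub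
    (hs'.comp (tendsto_add_atTop_nat 1))).sub hint).sub (hAt.sub hAs)).norm
    fun n => hXR n s t hs hst ht

lemma exists_step (h : IsMixedDriver α β T MA CF A DA F) (hC0 : 0 ≤ C) (hH : 0 ≤ H) :
    ∃ τ : ℝ, 0 < τ ∧ τ ≤ 1 ∧ ∀ l, 0 ≤ l → l ≤ τ →
      (MA + CF + C * (MA * (H ^ β + 1))) * l ^ (α * β) ≤ 1 / 2 := by
  have hMA := h.MA_nonneg
  have hCF := h.CF_nonneg
  exact exists_short_step (by positivity) (mul_pos h.α_pos h.β_pos)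

/-- Global uniqueness. -/
lemma eqOn [CompleteSpace V] (h : IsMixedDriver α β T MA CF A DA F) {x x' : ℝ → V}
    {H' K K' : ℝ} (hx : HolderOnIcc α H 0 T x) (hx' : HolderOnIcc α H' 0 T x')
    (hR : RemainderBound A F (α * (1 + β)) K 0 T x x)
    (hR' : RemainderBound A F (α * (1 + β)) K' 0 T x' x') (h0 : x 0 = x' 0) :
    ∀ t, 0 ≤ t → t ≤ T → x t = x' t := by
  obtain ⟨C, hC0, hC⟩ := exists_sewing (V := V) h.one_lt
  set B := max 0 (max H H') with hB
  have hB0 : 0 ≤ B := le_max_left _ _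
  replace hx := hx.mono_const ((le_max_left H H').trans (le_max_right 0 _))
  replace hx' := hx'.mono_const ((le_max_right H H').trans (le_max_right 0 _))
  obtain ⟨τ, hτ, hτ1, hstep⟩ := h.exists_step hC0 hB0
  have key : ∀ n : ℕ, ∀ t, 0 ≤ t → t ≤ n * τ → t ≤ T → x t = x' t := by
    intro n
    induction n with
    | zero =>
      intro t ht ht' _
      obtain rfl : t = 0 := le_antisymm (by simpa using ht') ht
      exact h0
    | succ n ih =>
      intro t ht htn htT
      push_cast at htn
      rcases le_total t (n * τ) with hn | hn
      · exact ih t ht hn htT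
      have hn0 : 0 ≤ n * τ := by positivity
      exact h.eqOn_of_short hC hC0 hB0 hn0 hn htT (by linarith)
        (hstep _ (by linarith) (by linarith)) (hx.mono hn0 htT) (hx'.mono hn0 htT)
        (fun s r hs hsr hr => hR s r (hn0.trans hs) hsr (hr.trans htT))
        (fun s r hs hsr hr => hR' s r (hn0.trans hs) hsr (hr.trans htT))
        (ih _ hn0 le_rfl (hn.trans htT)) t hn le_rfl
  intro t ht htT
  obtain ⟨n, hn⟩ := exists_nat_ge (t / τ)
  exact key n t ht ((div_le_iff₀ hτ).mp hn) htT

/-- Global existence. -/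
lemma exists_solution [CompleteSpace V] (h : IsMixedDriver α β T MA CF A DA F) (hT : 0 ≤ T)
    (x₀ : V) : ∃ x : ℝ → V, x 0 = x₀ ∧ (∃ H, HolderOnIcc α H 0 T x) ∧
      ∃ K, RemainderBound A F (α * (1 + β)) K 0 T x x := by
  obtain ⟨C, hC0, hC⟩ := exists_sewing (V := V) h.one_lt
  have hMA := h.MA_nonneg
  have hCF := h.CF_nonneg
  obtain ⟨H, hH⟩ : ∃ H, H = CF + MA + 1 := ⟨_, rfl⟩
  have hH0 : 0 ≤ H := by rw [hH]; positivity
  obtain ⟨τ, hτ, hτ1, hstep⟩ := h.exists_step hC0 hH0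
  have key : ∀ n : ℕ, ∃ x : ℝ → V, x 0 = x₀ ∧
      (∃ B, 0 ≤ B ∧ HolderOnIcc α B 0 (min (n * τ) T) x) ∧
      ∃ K, 0 ≤ K ∧ RemainderBound A F (α * (1 + β)) K 0 (min (n * τ) T) x x := by
    intro n
    induction n with
    | zero =>
      obtain ⟨x, hx0, hx, hR⟩ := h.exists_solution_of_short hC hC0 hH le_rfl le_rfl hT (by simp)
        (hstep _ (by simp) (by simpa using hτ.le)) x₀
      have e : min (((0 : ℕ) : ℝ) * τ) T = 0 := by simpa using hT
      rw [e]
      exact ⟨x, hx0, ⟨H, hH0, hx⟩, _, by positivity, hR⟩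
    | succ n ih =>
      obtain ⟨x, hx0, ⟨B, hB, hx⟩, K, hK, hR⟩ := ih
      set b := min (n * τ) T with hb
      set c := min (((n + 1 : ℕ) : ℝ) * τ) T with hc
      have hb0 : 0 ≤ b := le_min (by positivity) hT
      have hcT : c ≤ T := min_le_right _ _
      have hbc : b ≤ c := by
        refine min_le_min_right _ ?_
        push_cast; linarith
      have hcb : c - b ≤ τ := by
        have h1 : c ≤ n * τ + τ := (min_le_left _ _).trans (by push_cast; linarith)
        rcases min_cases (n * τ) T with h2 | h2 <;> linarith
      obtain ⟨y, hy0, hy, hRy⟩ := h.exists_solution_of_short hC hC0 hH hb0 hbc hcT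
        (hcb.trans hτ1) (hstep _ (by linarith) hcb) (x b)
      set z : ℝ → V := fun t => if t ≤ b then x t else y t with hz
      have hzx : ∀ t, 0 ≤ t → t ≤ b → z t = x t := fun t _ ht => by simp [hz, ht]
      have hzy : ∀ t, b ≤ t → t ≤ c → z t = y t := by
        intro t ht _
        obtain rfl | hlt := ht.eq_or_lt
        · rw [hzx _ hb0 le_rfl, hy0]
        · simp [hz, not_le.mpr hlt]
      have hzH := (hx.congr hzx).trans h.α_pos.le hB hH0 (hy.congr hzy)
      exact ⟨z, by rw [hzx 0 le_rfl hb0, hx0], ⟨B + H, by positivity, hzH⟩, _, by positivity,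
        h.remainderBound_trans (by positivity) hK (by positivity) le_rfl hcT hzH (hR.congr hzx)
          (hRy.congr hzy)⟩
  obtain ⟨n, hn⟩ := exists_nat_ge (T / τ)
  obtain ⟨x, hx0, ⟨B, _, hx⟩, K, _, hR⟩ := key n
  rw [min_eq_right ((div_le_iff₀ hτ).mp hn)] at hx hR
  exact ⟨x, hx0, ⟨B, hx⟩, K, hR⟩

end IsMixedDriver

end YoungEquation

/-- **Well-posedness for mixed Young–ODE equations.**  Let `α(1+β) > 1`,
`A ∈ C^α_t C^{1+β}_V`, and let `F : [0,T] × V → V` be continuous, bounded and globally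
Lipschitz in space with constant `C_F`.  Then for every `x₀ ∈ V` the equation
`x_t = x₀ + ∫_0^t F(s,x_s) ds + ∫_0^t A(ds, x_s)` has exactly one solution
`x ∈ C^α([0,T];V)`. -/
theorem mixed_yde_wellposedness
    {V : Type*} [NormedAddCommGroup V] [NormedSpace ℝ V] [CompleteSpace V]
    (α β : ℝ) (hα0 : 0 < α) (hα1 : α < 1) (hβ0 : 0 < β) (hβ1 : β < 1)
    (hαβ : 1 < α * (1 + β)) (T : ℝ) (hT : 0 < T)
    (A : ℝ → V → V) (DA : ℝ → V → (V →L[ℝ] V)) (MA : ℝ)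
    (hA0 : ∀ z : V, A 0 z = 0)
    (hderiv : ∀ t : ℝ, ∀ z : V, 0 ≤ t → t ≤ T → HasFDerivAt (A t) (DA t z) z)
    (hAbd : ∀ s t : ℝ, ∀ z : V, 0 ≤ s → s ≤ t → t ≤ T →
      ‖A t z - A s z‖ ≤ MA * (t - s) ^ α)
    (hAhol : ∀ s t : ℝ, ∀ z w : V, 0 ≤ s → s ≤ t → t ≤ T →
      ‖A t z - A s z - (A t w - A s w)‖ ≤ MA * (t - s) ^ α * ‖z - w‖ ^ β)
    (hDAbd : ∀ s t : ℝ, ∀ z : V, 0 ≤ s → s ≤ t → t ≤ T →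
      ‖DA t z - DA s z‖ ≤ MA * (t - s) ^ α)
    (hDAhol : ∀ s t : ℝ, ∀ z w : V, 0 ≤ s → s ≤ t → t ≤ T →
      ‖DA t z - DA s z - (DA t w - DA s w)‖ ≤ MA * (t - s) ^ α * ‖z - w‖ ^ β)
    (F : ℝ → V → V) (CF : ℝ) (hCF : 0 < CF)
    (hFcont : ContinuousOn (fun p : ℝ × V => F p.1 p.2) (Set.Icc 0 T ×ˢ Set.univ))
    (hFbd : ∀ t : ℝ, ∀ y : V, 0 ≤ t → t ≤ T → ‖F t y‖ ≤ CF)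
    (hFlip : ∀ t : ℝ, ∀ y z : V, 0 ≤ t → t ≤ T → ‖F t y - F t z‖ ≤ CF * ‖y - z‖) :
    ∀ x₀ : V, ∃ x : ℝ → V,
      x 0 = x₀ ∧
      (∃ Kx : ℝ, ∀ s t : ℝ, 0 ≤ s → s ≤ t → t ≤ T → ‖x t - x s‖ ≤ Kx * (t - s) ^ α) ∧
      (∃ K : ℝ, ∀ s t : ℝ, 0 ≤ s → s ≤ t → t ≤ T →
        ‖x t - x s - (∫ r in s..t, F r (x r)) - (A t (x s) - A s (x s))‖ ≤
          K * (t - s) ^ (α * (1 + β))) ∧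
      (∀ (y : ℝ → V) (Ky K' : ℝ), y 0 = x₀ →
        (∀ s t : ℝ, 0 ≤ s → s ≤ t → t ≤ T → ‖y t - y s‖ ≤ Ky * (t - s) ^ α) →
        (∀ s t : ℝ, 0 ≤ s → s ≤ t → t ≤ T →
          ‖y t - y s - (∫ r in s..t, F r (y r)) - (A t (y s) - A s (y s))‖ ≤
            K' * (t - s) ^ (α * (1 + β))) →
        ∀ t : ℝ, 0 ≤ t → t ≤ T → y t = x t) := by
  have hMA : 0 ≤ MA := by
    have h := (norm_nonneg _).trans (hAbd 0 T 0 le_rfl hT.le le_rfl)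
    rw [sub_zero] at h
    exact nonneg_of_mul_nonneg_left h (Real.rpow_pos_of_pos hT α)
  have h : IsMixedDriver α β T MA CF A DA F :=
    ⟨hα0, hα1, hβ0, hβ1, hαβ, hMA, hCF.le, hderiv, hAbd, hAhol, hDAbd, hDAhol, hFcont, hFbd, hFlip⟩
  intro x₀
  obtain ⟨x, hx0, ⟨H, hx⟩, K, hR⟩ := h.exists_solution hT.le x₀
  exact ⟨x, hx0, ⟨H, hx⟩, ⟨K, hR⟩, fun y Ky K' hy0 hy hRy =>
    h.eqOn hy hx hRy hR (hy0.trans hx0.symm)⟩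
end

section
/- Well-posedness when ∂ₜA exists: Let α, β ∈ (0,1) with α + β > 1 and let A ∈ C^α_t C^{1+β}_V be such that the time derivative ∂ₜA : [0,T] × V → V exists at every point, is jointly continuous, and is bounded. Then for every x₀ ∈ V there exists exactly one continuous path x : [0,T] → V satisfying x_t = x₀ + ∫_0^t ∂ₜA(s, x_s) ds for all t ∈ [0,T] (Bochner integral). -/
open Set Filter Topology
open scoped NNReal

/-- A function of intervals that is subadditive up to a superlinear defect and has vanishing
local slope is controlled by the defect. -/
theorem le_rpow_of_midpoint_defect {f : ℝ → ℝ → ℝ} {a b K θ : ℝ} (hθ : 1 < θ) (hK : 0 ≤ K)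
    (hadd : ∀ s m t, a ≤ s → s ≤ m → m ≤ t → t ≤ b →
      f s t ≤ f s m + f m t + K * (t - s) ^ θ)
    (hsmall : ∀ ε > 0, ∃ δ > 0, ∀ s t, a ≤ s → s ≤ t → t ≤ b → t - s ≤ δ → f s t ≤ ε * (t - s))
    {s t : ℝ} (has : a ≤ s) (hst : s ≤ t) (htb : t ≤ b) :
    f s t ≤ (1 - 2 ^ (1 - θ))⁻¹ * K * (t - s) ^ θ := by
  set c : ℝ := (1 - 2 ^ (1 - θ))⁻¹ with hc
  have hpos : 0 < 1 - (2 : ℝ) ^ (1 - θ) :=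
    sub_pos.2 (Real.rpow_lt_one_of_one_lt_of_neg one_lt_two (by linarith))
  have hfix : c * 2 ^ (1 - θ) + 1 = c := by
    have : c * (1 - 2 ^ (1 - θ)) = 1 := inv_mul_cancel₀ hpos.ne'
    linarith
  have hhalf : ∀ h : ℝ, 0 ≤ h → 2 * (h / 2) ^ θ = 2 ^ (1 - θ) * h ^ θ := by
    intro h hh
    rw [Real.div_rpow hh zero_le_two, Real.rpow_sub two_pos, Real.rpow_one]
    ring
  have key : ∀ ε > 0, f s t ≤ c * K * (t - s) ^ θ + ε * (t - s) := by
    intro ε hε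
    obtain ⟨δ, hδ, hloc⟩ := hsmall ε hε
    have hind : ∀ n : ℕ, ∀ s t, a ≤ s → s ≤ t → t ≤ b → t - s ≤ 2 ^ n * δ →
        f s t ≤ c * K * (t - s) ^ θ + ε * (t - s) := by
      intro n
      induction n with
      | zero =>
        intro s t has hst htb hlen
        have h1 := hloc s t has hst htb (by simpa using hlen)
        have h2 : 0 ≤ c * K * (t - s) ^ θ :=
          mul_nonneg (mul_nonneg (inv_nonneg.2 hpos.le) hK)
            (Real.rpow_nonneg (sub_nonneg.2 hst) _)
        linarith
      | succ n ih =>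
        intro s t has hst htb hlen
        rw [pow_succ] at hlen
        have e1 : (s + t) / 2 - s = (t - s) / 2 := by ring
        have e2 : t - (s + t) / 2 = (t - s) / 2 := by ring
        have h1 := ih s ((s + t) / 2) has (by linarith) (by linarith) (by linarith)
        have h2 := ih ((s + t) / 2) t (by linarith) (by linarith) htb (by linarith)
        have h3 := hadd s ((s + t) / 2) t has (by linarith) (by linarith) htb
        rw [e1] at h1
        rw [e2] at h2
        have h4 := hhalf (t - s) (sub_nonneg.2 hst)
        calc f s t ≤ c * K * (2 * ((t - s) / 2) ^ θ) + K * (t - s) ^ θ + ε * (t - s) := by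
              linarith
          _ = (c * 2 ^ (1 - θ) + 1) * K * (t - s) ^ θ + ε * (t - s) := by rw [h4]; ring
          _ = _ := by rw [hfix]
    obtain ⟨n, hn⟩ := pow_unbounded_of_one_lt ((t - s) / δ) (one_lt_two : (1 : ℝ) < 2)
    exact hind n s t has hst htb ((div_lt_iff₀ hδ).1 hn).le
  refine le_of_forall_pos_le_add fun η hη => ?_
  have hd : 0 < t - s + 1 := by linarith
  refine (key (η / (t - s + 1)) (by positivity)).trans ?_
  gcongr
  rw [div_mul_eq_mul_div, div_le_iff₀ hd]
  nlinarith

theorem exists_rpow_add_rpow_le_half {γ θ : ℝ} (hγ : 0 < γ) (hθ : γ < θ) (a b : ℝ) :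
    ∃ τ : ℝ, 0 < τ ∧ τ ≤ 1 ∧ a * τ ^ γ + b * τ ^ (θ - γ) ≤ 1 / 2 := by
  have h : ContinuousAt (fun τ : ℝ => a * τ ^ γ + b * τ ^ (θ - γ)) 0 :=
    (continuousAt_const.mul (Real.continuousAt_rpow_const _ _ (Or.inr hγ.le))).add
      (continuousAt_const.mul (Real.continuousAt_rpow_const _ _ (Or.inr (sub_pos.2 hθ).le)))
  have h0 : Tendsto (fun τ : ℝ => a * τ ^ γ + b * τ ^ (θ - γ)) (𝓝[>] 0) (𝓝 0) := by
    have := h.tendsto.mono_left (nhdsWithin_le_nhds (s := Ioi 0))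
    simpa [Real.zero_rpow hγ.ne', Real.zero_rpow (sub_pos.2 hθ).ne'] using this
  have hunit : ∀ᶠ τ : ℝ in 𝓝[>] 0, τ ∈ Ioc 0 1 := Ioc_mem_nhdsGT one_pos
  obtain ⟨τ, h1, h2⟩ := ((h0.eventually
    (gt_mem_nhds (by norm_num : (0 : ℝ) < 1 / 2))).and hunit).exists
  exact ⟨τ, h2.1, h2.2, h1.le⟩

section Interpolation

variable {V W : Type*} [NormedAddCommGroup V] [NormedSpace ℝ V]
  [NormedAddCommGroup W] [NormedSpace ℝ W]

/-- Interpolation: the differential of a bounded function with Hölder differential. -/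
theorem opNorm_fderiv_le_of_bounded_of_holder {f : V → W} {f' : V → V →L[ℝ] W} {P Q β ε : ℝ}
    (hβ : 0 ≤ β) (hε : 0 < ε) (hP : 0 ≤ P) (hQ : 0 ≤ Q) (hf : ∀ z, HasFDerivAt f (f' z) z)
    (hbd : ∀ z, ‖f z‖ ≤ P) (hhol : ∀ z w, ‖f' z - f' w‖ ≤ Q * ‖z - w‖ ^ β) (z : V) :
    ‖f' z‖ ≤ 2 * P / ε + Q * ε ^ β := by
  refine ContinuousLinearMap.opNorm_le_bound _ (by positivity) fun v => ?_
  rcases eq_or_ne v 0 with rfl | hv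
  · simp
  have hv' : 0 < ‖v‖ := norm_pos_iff.2 hv
  set w : V := (ε / ‖v‖) • v with hw
  have hnw : ‖w‖ = ε := by
    rw [hw, norm_smul, Real.norm_of_nonneg (by positivity), div_mul_cancel₀ _ hv'.ne']
  have htaylor : ‖f (z + w) - f z - f' z (z + w - z)‖ ≤ Q * ε ^ β * ‖z + w - z‖ := by
    refine (convex_closedBall z ε).norm_image_sub_le_of_norm_hasFDerivWithin_le'
      (f' := f') (fun y _ => (hf y).hasFDerivWithinAt) (fun y hy => ?_)
      (Metric.mem_closedBall_self hε.le) (by simp [hnw])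
    refine (hhol y z).trans ?_
    gcongr
    simpa [dist_eq_norm] using hy
  rw [add_sub_cancel_left, hnw] at htaylor
  have h1 : ‖f' z w‖ ≤ 2 * P + Q * ε ^ β * ε := by
    have e : f' z w = f (z + w) - f z - (f (z + w) - f z - f' z w) := by abel
    rw [e]
    refine (norm_sub_le _ _).trans (add_le_add ((norm_sub_le _ _).trans ?_) htaylor)
    linarith [hbd (z + w), hbd z]
  rw [hw, map_smul, norm_smul, Real.norm_of_nonneg (by positivity)] at h1
  have h2 : ‖f' z v‖ = ε / ‖v‖ * ‖f' z v‖ * (‖v‖ / ε) := by field_simp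
  rw [h2]
  calc ε / ‖v‖ * ‖f' z v‖ * (‖v‖ / ε) ≤ (2 * P + Q * ε ^ β * ε) * (‖v‖ / ε) := by gcongr
    _ = _ := by field_simp

/-- Second-order difference estimate for a function with bounded Hölder differential. -/
theorem norm_fourPoint_le {f : V → W} {f' : V → V →L[ℝ] W} {Λ Q β : ℝ}
    (hf : ∀ z, HasFDerivAt f (f' z) z) (hΛ : ∀ z, ‖f' z‖ ≤ Λ)
    (hhol : ∀ z w, ‖f' z - f' w‖ ≤ Q * ‖z - w‖ ^ β) (x₁ y₁ x₂ y₂ : V) :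
    ‖f x₂ - f y₂ - (f x₁ - f y₁)‖ ≤
      Λ * ‖(x₂ - y₂) - (x₁ - y₁)‖ + Q * ‖y₂ - y₁‖ ^ β * ‖x₁ - y₁‖ := by
  have h1 : ‖f x₂ - f (x₁ + (y₂ - y₁))‖ ≤ Λ * ‖x₂ - (x₁ + (y₂ - y₁))‖ :=
    convex_univ.norm_image_sub_le_of_norm_hasFDerivWithin_le
      (fun y _ => (hf y).hasFDerivWithinAt) (fun y _ => hΛ y) (mem_univ _) (mem_univ _)
  have hg : ∀ z, HasFDerivAt (fun z => f (z + (y₂ - y₁)) - f z)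
      (f' (z + (y₂ - y₁)) - f' z) z := fun z =>
    ((hasFDerivAt_comp_add_right (y₂ - y₁)).2 (hf (z + (y₂ - y₁)))).sub (hf z)
  have h2 := convex_univ.norm_image_sub_le_of_norm_hasFDerivWithin_le
    (C := Q * ‖y₂ - y₁‖ ^ β) (fun y _ => (hg y).hasFDerivWithinAt)
    (fun y _ => by simpa using hhol (y + (y₂ - y₁)) y) (mem_univ y₁) (mem_univ x₁)
  simp only [add_sub_cancel] at h2
  have e1 : x₂ - (x₁ + (y₂ - y₁)) = (x₂ - y₂) - (x₁ - y₁) := by abel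
  have e2 : f x₂ - f y₂ - (f x₁ - f y₁) = (f x₂ - f (x₁ + (y₂ - y₁))) +
      (f (x₁ + (y₂ - y₁)) - f x₁ - (f y₂ - f y₁)) := by abel
  rw [e1] at h1
  rw [e2]
  exact (norm_add_le _ _).trans (add_le_add h1 h2)

end Interpolation

/-- A bounded continuous time-dependent field whose time integrals satisfy a four-point
estimate with exponents in the range where linear Young estimates close. -/
structure IsYoungField {V : Type*} [NormedAddCommGroup V] [NormedSpace ℝ V]
    (F : ℝ → V → V) (T : ℝ) (C : ℝ≥0) (L M α β γ : ℝ) : Prop where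
  α_pos : 0 < α
  β_pos : 0 < β
  one_lt_add : 1 < α + β
  half_lt : 1 < 2 * γ
  γ_lt_one : γ < 1
  L_nonneg : 0 ≤ L
  M_nonneg : 0 ≤ M
  continuousOn : ContinuousOn (fun p : ℝ × V => F p.1 p.2) (Icc 0 T ×ˢ univ)
  norm_le : ∀ t ∈ Icc 0 T, ∀ z, ‖F t z‖ ≤ C
  fourPoint : ∀ s t, 0 ≤ s → s ≤ t → t ≤ T → ∀ x₁ y₁ x₂ y₂,
    ‖(∫ r in s..t, F r x₂) - (∫ r in s..t, F r y₂) -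
        ((∫ r in s..t, F r x₁) - ∫ r in s..t, F r y₁)‖ ≤
      L * (t - s) ^ γ * ‖(x₂ - y₂) - (x₁ - y₁)‖ +
        M * (t - s) ^ α * ‖y₂ - y₁‖ ^ β * ‖x₁ - y₁‖

namespace IsYoungField

variable {V : Type*} [NormedAddCommGroup V] [NormedSpace ℝ V]
  {F : ℝ → V → V} {T : ℝ} {C : ℝ≥0} {L M α β γ : ℝ}

theorem continuousOn_comp (hF : IsYoungField F T C L M α β γ) {x : ℝ → V}
    (hx : ContinuousOn x (Icc 0 T)) : ContinuousOn (fun r => F r (x r)) (Icc 0 T) :=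
  hF.continuousOn.comp (continuousOn_id.prodMk hx) fun _ hr => ⟨hr, mem_univ _⟩

theorem intervalIntegrable (hF : IsYoungField F T C L M α β γ) {x : ℝ → V}
    (hx : ContinuousOn x (Icc 0 T)) {s t : ℝ} (hs : s ∈ Icc 0 T) (ht : t ∈ Icc 0 T) :
    IntervalIntegrable (fun r => F r (x r)) MeasureTheory.volume s t :=
  ((hF.continuousOn_comp hx).mono (uIcc_subset_Icc hs ht)).intervalIntegrable

theorem norm_integral_le (hF : IsYoungField F T C L M α β γ) (x : ℝ → V) {s t : ℝ}
    (hs : s ∈ Icc 0 T) (ht : t ∈ Icc 0 T) : ‖∫ r in s..t, F r (x r)‖ ≤ C * |t - s| :=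
  intervalIntegral.norm_integral_le_of_norm_le_const fun r hr =>
    hF.norm_le r (uIcc_subset_Icc hs ht (uIoc_subset_uIcc hr)) _

/-- Solutions and Picard iterates are Lipschitz in time. -/
theorem lipschitzOnWith_of_eq (hF : IsYoungField F T C L M α β γ) {x y : ℝ → V} {x₀ : V}
    (hx : ContinuousOn x (Icc 0 T))
    (hy : ∀ t ∈ Icc 0 T, y t = x₀ + ∫ r in (0 : ℝ)..t, F r (x r)) :
    LipschitzOnWith C y (Icc 0 T) := by
  refine LipschitzOnWith.of_dist_le_mul fun s hs t ht => ?_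
  have h0 : (0 : ℝ) ∈ Icc 0 T := ⟨le_rfl, hs.1.trans hs.2⟩
  rw [dist_eq_norm, hy s hs, hy t ht, add_sub_add_left_eq_sub,
    intervalIntegral.integral_interval_sub_left (hF.intervalIntegrable hx h0 hs)
      (hF.intervalIntegrable hx h0 ht), Real.dist_eq]
  exact hF.norm_integral_le x ht hs

/-- Freezing the path at the left endpoint costs `o(t - s)`, uniformly. -/
theorem exists_norm_integral_sub_le (hF : IsYoungField F T C L M α β γ) {x : ℝ → V}
    (hx : ContinuousOn x (Icc 0 T)) {ε : ℝ} (hε : 0 < ε) :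
    ∃ δ > 0, ∀ s t, 0 ≤ s → s ≤ t → t ≤ T → t - s ≤ δ →
      ‖(∫ r in s..t, F r (x r)) - ∫ r in s..t, F r (x s)‖ ≤ ε * (t - s) := by
  have hcont : ContinuousOn (fun p : ℝ × ℝ => F p.1 (x p.2)) (Icc 0 T ×ˢ Icc 0 T) :=
    hF.continuousOn.comp
      (continuousOn_fst.prodMk (hx.comp continuousOn_snd fun _ hp => hp.2))
      fun _ hp => ⟨hp.1, mem_univ _⟩
  have hunif := (isCompact_Icc.prod isCompact_Icc).uniformContinuousOn_of_continuous hcont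
  obtain ⟨δ, hδ, h⟩ := Metric.uniformContinuousOn_iff.1 hunif ε hε
  refine ⟨δ / 2, half_pos hδ, fun s t hs hst ht hlen => ?_⟩
  have hs' : s ∈ Icc 0 T := ⟨hs, hst.trans ht⟩
  have ht' : t ∈ Icc 0 T := ⟨hs.trans hst, ht⟩
  rw [← intervalIntegral.integral_sub (hF.intervalIntegrable hx hs' ht')
    (hF.intervalIntegrable continuousOn_const hs' ht')]
  refine (intervalIntegral.norm_integral_le_of_norm_le_const (C := ε) fun r hr => ?_).trans_eq
    (by rw [abs_of_nonneg (sub_nonneg.2 hst)])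
  rw [uIoc_of_le hst] at hr
  have hr' : r ∈ Icc 0 T := ⟨hs.trans hr.1.le, hr.2.trans ht⟩
  rw [← dist_eq_norm]
  refine (h (r, r) ⟨hr', hr'⟩ (r, s) ⟨hr', hs'⟩ ?_).le
  rw [Prod.dist_eq, dist_self, Real.dist_eq, abs_of_nonneg (by linarith [hr.1])]
  exact max_lt hδ (by linarith [hr.2])

/-- On short intervals, the Picard map contracts the `γ`-Hölder seminorm of the difference of
two Lipschitz paths, up to a multiple of the initial difference. -/
theorem exists_contraction (hF : IsYoungField F T C L M α β γ) :
    ∃ τ K : ℝ, 0 < τ ∧ τ ≤ 1 ∧ 0 ≤ K ∧ ∀ (x y : ℝ → V) (a b S N : ℝ),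
      LipschitzOnWith C x (Icc 0 T) → LipschitzOnWith C y (Icc 0 T) →
      0 ≤ a → b ≤ T → b - a ≤ τ → 0 ≤ N → ‖x a - y a‖ ≤ S →
      (∀ s t, a ≤ s → s ≤ t → t ≤ b → ‖(x t - y t) - (x s - y s)‖ ≤ N * (t - s) ^ γ) →
      ∀ s t, a ≤ s → s ≤ t → t ≤ b →
        ‖(∫ r in s..t, F r (x r)) - ∫ r in s..t, F r (y r)‖ ≤
          (K * S + 1 / 2 * N) * (t - s) ^ γ := by
  have hα := hF.α_pos
  have hβ := hF.β_pos
  have hL := hF.L_nonneg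
  have hM := hF.M_nonneg
  have hγ : 0 < γ := by linarith [hF.half_lt]
  set θ : ℝ := min (2 * γ) (α + β) with hθdef
  have hθ : 1 < θ := lt_min hF.half_lt hF.one_lt_add
  set c : ℝ := (1 - 2 ^ (1 - θ))⁻¹ with hc
  have hcpos : 0 < c := inv_pos.2
    (sub_pos.2 (Real.rpow_lt_one_of_one_lt_of_neg one_lt_two (by linarith)))
  set M' : ℝ := M * (C : ℝ) ^ β with hM'
  have hM'0 : 0 ≤ M' := by positivity
  obtain ⟨τ, hτ0, hτ1, hτ⟩ := exists_rpow_add_rpow_le_half hγ (hF.γ_lt_one.trans hθ) L (c * (L + M'))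
  refine ⟨τ, L + c * M', hτ0, hτ1, by positivity, ?_⟩
  intro x y a b S N hx hy ha hb hba hN hS hxy s t has hst htb
  have hS0 : 0 ≤ S := (norm_nonneg _).trans hS
  have hmem : ∀ r, a ≤ r → r ≤ b → r ∈ Icc 0 T := fun r h1 h2 => ⟨ha.trans h1, h2.trans hb⟩
  have hdiff : ∀ r, a ≤ r → r ≤ b → ‖x r - y r‖ ≤ S + N * τ ^ γ := by
    intro r h1 h2
    have h3 := hxy a r le_rfl h1 h2
    have h4 : (r - a) ^ γ ≤ τ ^ γ :=
      Real.rpow_le_rpow (sub_nonneg.2 h1) (by linarith) hγ.le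
    calc ‖x r - y r‖ = ‖(x a - y a) + ((x r - y r) - (x a - y a))‖ := by congr 1; abel
      _ ≤ S + N * τ ^ γ := (norm_add_le _ _).trans (add_le_add hS (h3.trans (by gcongr)))
  have hτγ : τ ^ γ ≤ 1 := Real.rpow_le_one hτ0.le hτ1 hγ.le
  set germ : ℝ → ℝ → V := fun s t => (∫ r in s..t, F r (x s)) - ∫ r in s..t, F r (y s)
    with hgerm
  set incr : ℝ → ℝ → V := fun s t => (∫ r in s..t, F r (x r)) - ∫ r in s..t, F r (y r)
    with hincr
  have hrem : ‖incr s t - germ s t‖ ≤ c * (L * N + M' * (S + N)) * (t - s) ^ θ := by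
    refine le_rpow_of_midpoint_defect (f := fun s t => ‖incr s t - germ s t‖) (a := a) (b := b)
      hθ (by positivity) ?_ ?_ has hst htb
    · intro s m t has hsm hmt htb
      have hs := hmem s has (by linarith)
      have hm := hmem m (by linarith) (by linarith)
      have ht := hmem t (by linarith) htb
      have split : ∀ z : ℝ → V, ContinuousOn z (Icc 0 T) →
          (∫ r in s..t, F r (z r)) = (∫ r in s..m, F r (z r)) + ∫ r in m..t, F r (z r) :=
        fun z hz => (intervalIntegral.integral_add_adjacent_intervals
          (hF.intervalIntegrable hz hs hm) (hF.intervalIntegrable hz hm ht)).symm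
      have e : incr s t - germ s t = (incr s m - germ s m) + (incr m t - germ m t) +
          ((∫ r in m..t, F r (x m)) - (∫ r in m..t, F r (y m)) -
            ((∫ r in m..t, F r (x s)) - ∫ r in m..t, F r (y s))) := by
        simp only [hincr, hgerm]
        rw [split x hx.continuousOn, split y hy.continuousOn,
          split (fun _ => x s) continuousOn_const, split (fun _ => y s) continuousOn_const]
        abel
      have h4 := hF.fourPoint m t hm.1 hmt ht.2 (x s) (y s) (x m) (y m)
      have hst0 : 0 ≤ t - s := by linarith
      have hst1 : t - s ≤ 1 := by linarith
      have hd1 := hxy s m has hsm (by linarith)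
      have hd2 : ‖x s - y s‖ ≤ S + N :=
        (hdiff s has (by linarith)).trans (by nlinarith)
      have hd3 : ‖y m - y s‖ ≤ C * (t - s) := by
        refine (hy.norm_sub_le hm hs).trans ?_
        rw [Real.norm_of_nonneg (by linarith)]
        gcongr
      have hp1 : (t - m) ^ γ ≤ (t - s) ^ γ :=
        Real.rpow_le_rpow (by linarith) (by linarith) hγ.le
      have hp2 : (m - s) ^ γ ≤ (t - s) ^ γ :=
        Real.rpow_le_rpow (by linarith) (by linarith) hγ.le
      have hp3 : (t - m) ^ α ≤ (t - s) ^ α :=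
        Real.rpow_le_rpow (by linarith) (by linarith) hα.le
      have hq1 : (t - s) ^ γ * (t - s) ^ γ ≤ (t - s) ^ θ := by
        rw [← Real.rpow_add_of_nonneg hst0 hγ.le hγ.le, ← two_mul]
        exact Real.rpow_le_rpow_of_exponent_ge_of_imp hst0 hst1 (min_le_left _ _)
          (fun _ h => by linarith)
      have hq2 : (t - s) ^ α * (t - s) ^ β ≤ (t - s) ^ θ := by
        rw [← Real.rpow_add_of_nonneg hst0 hα.le hβ.le]
        exact Real.rpow_le_rpow_of_exponent_ge_of_imp hst0 hst1 (min_le_right _ _)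
          (fun _ h => by linarith)
      have hb1 : L * (t - m) ^ γ * ‖(x m - y m) - (x s - y s)‖ ≤ L * N * (t - s) ^ θ :=
        calc _ ≤ L * (t - s) ^ γ * (N * (t - s) ^ γ) := by
              gcongr
              exact hd1.trans (by gcongr)
          _ = L * N * ((t - s) ^ γ * (t - s) ^ γ) := by ring
          _ ≤ _ := by gcongr
      have hb2 : M * (t - m) ^ α * ‖y m - y s‖ ^ β * ‖x s - y s‖ ≤
          M' * (S + N) * (t - s) ^ θ :=
        calc _ ≤ M * (t - s) ^ α * (C * (t - s)) ^ β * (S + N) := by gcongr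
          _ = M' * (S + N) * ((t - s) ^ α * (t - s) ^ β) := by
              rw [Real.mul_rpow C.coe_nonneg hst0, hM']; ring
          _ ≤ _ := by gcongr
      show ‖incr s t - germ s t‖ ≤ _
      rw [e]
      refine (norm_add_le _ _).trans (add_le_add (norm_add_le _ _) ?_)
      linarith
    · intro ε hε
      obtain ⟨δ₁, hδ₁, h₁⟩ := hF.exists_norm_integral_sub_le hx.continuousOn (half_pos hε)
      obtain ⟨δ₂, hδ₂, h₂⟩ := hF.exists_norm_integral_sub_le hy.continuousOn (half_pos hε)
      refine ⟨min δ₁ δ₂, lt_min hδ₁ hδ₂, fun s t has hst htb hlen => ?_⟩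
      have k₁ := h₁ s t (ha.trans has) hst (htb.trans hb) (hlen.trans (min_le_left _ _))
      have k₂ := h₂ s t (ha.trans has) hst (htb.trans hb) (hlen.trans (min_le_right _ _))
      have e : incr s t - germ s t =
          ((∫ r in s..t, F r (x r)) - ∫ r in s..t, F r (x s)) -
            ((∫ r in s..t, F r (y r)) - ∫ r in s..t, F r (y s)) := by
        simp only [hincr, hgerm]
        abel
      show ‖incr s t - germ s t‖ ≤ _
      rw [e]
      exact (norm_sub_le _ _).trans (by linarith)
  have hst0 : 0 ≤ t - s := sub_nonneg.2 hst
  have hg : ‖germ s t‖ ≤ L * (t - s) ^ γ * (S + N * τ ^ γ) := by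
    have h := hF.fourPoint s t (ha.trans has) hst (htb.trans hb) (y s) (y s) (x s) (y s)
    have h' : ‖germ s t‖ ≤ L * (t - s) ^ γ * ‖x s - y s‖ := by simpa using h
    refine h'.trans ?_
    gcongr
    exact hdiff s has (hst.trans htb)
  have hpow : (t - s) ^ θ ≤ τ ^ (θ - γ) * (t - s) ^ γ := by
    have hθγ : 0 ≤ θ - γ := by linarith [hF.γ_lt_one]
    calc (t - s) ^ θ = (t - s) ^ (θ - γ) * (t - s) ^ γ := by
          rw [← Real.rpow_add_of_nonneg hst0 hθγ hγ.le, sub_add_cancel]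
      _ ≤ _ := by
          gcongr
          linarith
  have hτθ : τ ^ (θ - γ) ≤ 1 := Real.rpow_le_one hτ0.le hτ1 (by linarith [hF.γ_lt_one])
  calc ‖incr s t‖ = ‖(incr s t - germ s t) + germ s t‖ := by rw [sub_add_cancel]
    _ ≤ c * (L * N + M' * (S + N)) * (τ ^ (θ - γ) * (t - s) ^ γ) +
          L * (t - s) ^ γ * (S + N * τ ^ γ) :=
        (norm_add_le _ _).trans (add_le_add (hrem.trans (by gcongr)) hg)
    _ = (L * S + c * M' * S * τ ^ (θ - γ) +
          N * (L * τ ^ γ + c * (L + M') * τ ^ (θ - γ))) * (t - s) ^ γ := by ring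
    _ ≤ (L * S + c * M' * S * 1 + N * (1 / 2)) * (t - s) ^ γ := by gcongr
    _ = _ := by ring

/-- Two Picard sequences with the same initial value approach each other geometrically. -/
theorem exists_geometric_bound (hF : IsYoungField F T C L M α β γ) {x₀ : V} {u v : ℕ → ℝ → V}
    (hu : ∀ n, LipschitzOnWith C (u n) (Icc 0 T)) (hv : ∀ n, LipschitzOnWith C (v n) (Icc 0 T))
    (h0 : ∀ n, u n 0 = v n 0)
    (hu' : ∀ n, ∀ t ∈ Icc 0 T, u (n + 1) t = x₀ + ∫ r in (0 : ℝ)..t, F r (u n r))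
    (hv' : ∀ n, ∀ t ∈ Icc 0 T, v (n + 1) t = x₀ + ∫ r in (0 : ℝ)..t, F r (v n r)) :
    ∃ D : ℝ, ∀ n, ∀ t ∈ Icc 0 T, ‖u n t - v n t‖ ≤ D * (3 / 4) ^ n := by
  obtain ⟨τ, K, hτ0, hτ1, hK, hcontr⟩ := hF.exists_contraction
  have hγ : 0 < γ := by linarith [hF.half_lt]
  have hstep : ∀ n, ∀ s ∈ Icc 0 T, ∀ t ∈ Icc 0 T,
      (u (n + 1) t - v (n + 1) t) - (u (n + 1) s - v (n + 1) s) =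
        (∫ r in s..t, F r (u n r)) - ∫ r in s..t, F r (v n r) := by
    intro n s hs t ht
    have hz : (0 : ℝ) ∈ Icc 0 T := ⟨le_rfl, hs.1.trans hs.2⟩
    have iu := fun r (hr : r ∈ Icc 0 T) => hF.intervalIntegrable (hu n).continuousOn hz hr
    have iv := fun r (hr : r ∈ Icc 0 T) => hF.intervalIntegrable (hv n).continuousOn hz hr
    rw [hu' n t ht, hu' n s hs, hv' n t ht, hv' n s hs,
      ← intervalIntegral.integral_interval_sub_left (iu t ht) (iu s hs),
      ← intervalIntegral.integral_interval_sub_left (iv t ht) (iv s hs)]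
    abel
  have hind : ∀ j : ℕ, ∃ D : ℝ, ∀ n, ∀ t ∈ Icc 0 T, t ≤ j * τ →
      ‖u n t - v n t‖ ≤ D * (3 / 4) ^ n := by
    intro j
    induction j with
    | zero =>
      refine ⟨0, fun n t ht hle => ?_⟩
      have : t = 0 := le_antisymm (by simpa using hle) ht.1
      simp [this, h0 n]
    | succ j ih =>
      obtain ⟨D, hD⟩ := ih
      by_cases hT : T < j * τ
      · exact ⟨D, fun n t ht _ => hD n t ht (ht.2.trans hT.le)⟩
      rw [not_lt] at hT
      set a : ℝ := j * τ with ha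
      have ha0 : 0 ≤ a := by positivity
      have haT : a ∈ Icc 0 T := ⟨ha0, hT⟩
      set b : ℝ := min (a + τ) T with hb
      have hbT : b ≤ T := min_le_right _ _
      have hba : b - a ≤ τ := by linarith [min_le_left (a + τ) T]
      have hD0 : 0 ≤ D := by simpa using (norm_nonneg _).trans (hD 0 a haT le_rfl)
      set N : ℝ := max (4 * K * D) (2 * C) with hN
      have hN0 : 0 ≤ N := le_max_of_le_right (by positivity)
      have hinc : ∀ n, ∀ s t, a ≤ s → s ≤ t → t ≤ b →
          ‖(u n t - v n t) - (u n s - v n s)‖ ≤ N * (3 / 4) ^ n * (t - s) ^ γ := by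
        intro n
        induction n with
        | zero =>
          intro s t has hst htb
          have hs : s ∈ Icc 0 T := ⟨ha0.trans has, by linarith⟩
          have ht : t ∈ Icc 0 T := ⟨hs.1.trans hst, by linarith⟩
          have hst0 : 0 ≤ t - s := sub_nonneg.2 hst
          have h1 := (hu 0).norm_sub_le ht hs
          have h2 := (hv 0).norm_sub_le ht hs
          rw [Real.norm_of_nonneg hst0] at h1 h2
          have h3 : t - s ≤ (t - s) ^ γ := by
            simpa using Real.rpow_le_rpow_of_exponent_ge_of_imp hst0
              (by linarith : t - s ≤ 1) hF.γ_lt_one.le (fun _ h => absurd h one_ne_zero)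
          calc ‖(u 0 t - v 0 t) - (u 0 s - v 0 s)‖
              = ‖(u 0 t - u 0 s) - (v 0 t - v 0 s)‖ := by congr 1; abel
            _ ≤ 2 * C * (t - s) := (norm_sub_le _ _).trans (by linarith)
            _ ≤ N * (t - s) ^ γ := by
              gcongr
              exact le_max_right _ _
            _ = _ := by simp
        | succ n ihn =>
          intro s t has hst htb
          have hs : s ∈ Icc 0 T := ⟨ha0.trans has, by linarith⟩
          have ht : t ∈ Icc 0 T := ⟨hs.1.trans hst, by linarith⟩
          have hst0 : 0 ≤ t - s := sub_nonneg.2 hst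
          rw [hstep n s hs t ht]
          refine (hcontr (u n) (v n) a b (D * (3 / 4) ^ n) (N * (3 / 4) ^ n) (hu n) (hv n) ha0
            hbT hba (by positivity) (hD n a haT le_rfl) ihn s t has hst htb).trans ?_
          gcongr
          have h1 : 4 * K * D ≤ N := le_max_left _ _
          have h2 : (0 : ℝ) < (3 / 4) ^ n := by positivity
          rw [pow_succ]
          nlinarith
      refine ⟨D + N, fun n t ht hle => ?_⟩
      have hp : (0 : ℝ) ≤ (3 / 4) ^ n := by positivity
      rcases le_total t a with hta | hat
      · exact (hD n t ht hta).trans (by gcongr; linarith)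
      · have htb : t ≤ b := le_min (hle.trans_eq (by push_cast; ring)) ht.2
        have h1 := hinc n a t le_rfl hat htb
        have h2 : (t - a) ^ γ ≤ 1 :=
          Real.rpow_le_one (sub_nonneg.2 hat) (by linarith) hγ.le
        calc ‖u n t - v n t‖
            = ‖(u n a - v n a) + ((u n t - v n t) - (u n a - v n a))‖ := by congr 1; abel
          _ ≤ D * (3 / 4) ^ n + N * (3 / 4) ^ n * 1 :=
            (norm_add_le _ _).trans (add_le_add (hD n a haT le_rfl) (h1.trans (by gcongr)))
          _ = _ := by ring
  obtain ⟨j, hj⟩ := exists_nat_ge (T / τ)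
  obtain ⟨D, hD⟩ := hind j
  exact ⟨D, fun n t ht => hD n t ht (ht.2.trans ((div_le_iff₀ hτ0).1 hj))⟩

theorem eqOn_of_isSolution (hF : IsYoungField F T C L M α β γ) (hT : 0 ≤ T) {x₀ : V}
    {x y : ℝ → V} (hx : ContinuousOn x (Icc 0 T)) (hy : ContinuousOn y (Icc 0 T))
    (hx' : ∀ t ∈ Icc 0 T, x t = x₀ + ∫ r in (0 : ℝ)..t, F r (x r))
    (hy' : ∀ t ∈ Icc 0 T, y t = x₀ + ∫ r in (0 : ℝ)..t, F r (y r)) :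
    EqOn x y (Icc 0 T) := by
  have hz : (0 : ℝ) ∈ Icc 0 T := ⟨le_rfl, hT⟩
  obtain ⟨D, hD⟩ := hF.exists_geometric_bound (u := fun _ => x) (v := fun _ => y)
    (fun _ => hF.lipschitzOnWith_of_eq hx hx') (fun _ => hF.lipschitzOnWith_of_eq hy hy')
    (fun _ => by rw [hx' 0 hz, hy' 0 hz]; simp) (fun _ => hx') (fun _ => hy')
  intro t ht
  have hlim : Tendsto (fun n : ℕ => D * (3 / 4 : ℝ) ^ n) atTop (𝓝 (D * 0)) :=
    (tendsto_pow_atTop_nhds_zero_of_lt_one (by norm_num) (by norm_num)).const_mul D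
  have h := ge_of_tendsto' hlim fun n => hD n t ht
  rw [mul_zero] at h
  exact sub_eq_zero.1 (norm_le_zero_iff.1 h)

theorem exists_isSolution [CompleteSpace V] (hF : IsYoungField F T C L M α β γ) (x₀ : V) :
    ∃ x : ℝ → V, ContinuousOn x (Icc 0 T) ∧
      ∀ t ∈ Icc 0 T, x t = x₀ + ∫ r in (0 : ℝ)..t, F r (x r) := by
  let X : ℕ → ℝ → V := fun n =>
    n.rec (fun _ => x₀) fun _ x t => x₀ + ∫ r in (0 : ℝ)..t, F r (x r)
  have hX : ∀ n t, X (n + 1) t = x₀ + ∫ r in (0 : ℝ)..t, F r (X n r) := fun _ _ => rfl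
  have hlip : ∀ n, LipschitzOnWith C (X n) (Icc 0 T) := by
    intro n
    induction n with
    | zero => exact (LipschitzWith.const' x₀).lipschitzOnWith
    | succ n ih => exact hF.lipschitzOnWith_of_eq ih.continuousOn fun t _ => hX n t
  have hzero : ∀ n, X n 0 = x₀ := by
    intro n
    cases n with
    | zero => rfl
    | succ n => simp [hX]
  obtain ⟨D, hD⟩ := hF.exists_geometric_bound (u := X) (v := fun n => X (n + 1)) hlip
    (fun n => hlip (n + 1)) (fun n => (hzero n).trans (hzero (n + 1)).symm) (fun n t _ => hX n t)
    (fun n t _ => hX (n + 1) t)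
  have hlim : ∀ t, ∃ z, t ∈ Icc 0 T → Tendsto (fun n => X n t) atTop (𝓝 z) := by
    intro t
    by_cases ht : t ∈ Icc 0 T
    · obtain ⟨z, hz⟩ := cauchySeq_tendsto_of_complete (cauchySeq_of_le_geometric (3 / 4) D
        (by norm_num) fun n => (dist_eq_norm (X n t) (X (n + 1) t)).trans_le (hD n t ht))
      exact ⟨z, fun _ => hz⟩
    · exact ⟨x₀, fun h => absurd h ht⟩
  choose x hx using hlim
  have hxlip : LipschitzOnWith C x (Icc 0 T) :=
    LipschitzOnWith.of_dist_le_mul fun s hs t ht =>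
      le_of_tendsto' ((hx s hs).dist (hx t ht)) fun n => (hlip n).dist_le_mul s hs t ht
  refine ⟨x, hxlip.continuousOn, fun t ht => ?_⟩
  have hz : (0 : ℝ) ∈ Icc 0 T := ⟨le_rfl, ht.1.trans ht.2⟩
  have hsub : uIoc 0 t ⊆ Icc 0 T := uIoc_subset_uIcc.trans (uIcc_subset_Icc hz ht)
  have hint : Tendsto (fun n => ∫ r in (0 : ℝ)..t, F r (X n r)) atTop
      (𝓝 (∫ r in (0 : ℝ)..t, F r (x r))) := by
    refine intervalIntegral.tendsto_integral_filter_of_dominated_convergence (fun _ => (C : ℝ))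
      (Eventually.of_forall fun n => ?_) (Eventually.of_forall fun n => ?_)
      intervalIntegrable_const ?_
    · exact (hF.intervalIntegrable (hlip n).continuousOn hz ht).aestronglyMeasurable_restrict_uIoc
    · exact Eventually.of_forall fun r hr => hF.norm_le r (hsub hr) _
    · refine Eventually.of_forall fun r hr => ?_
      have hr' := hsub hr
      exact (hF.continuousOn (r, x r) ⟨hr', mem_univ _⟩).tendsto.comp
        (tendsto_nhdsWithin_iff.2 ⟨tendsto_const_nhds.prodMk_nhds (hx r hr'),
          Eventually.of_forall fun n => ⟨hr', mem_univ _⟩⟩)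
  exact tendsto_nhds_unique ((hx t ht).comp (tendsto_add_atTop_nat 1)) (hint.const_add x₀)

end IsYoungField

section TimeDerivative

variable {V : Type*} [NormedAddCommGroup V] [NormedSpace ℝ V] [CompleteSpace V]

/-- The time derivative of an averaged field in `C^α_t C^{1+β}_V` is a Young field: boundedness
of `∂ₜA` interpolates the time regularity of `A` as a Lipschitz function in space up to
`(α + β) / (1 + β) > 1 / 2`. -/
theorem isYoungField_of_timeDeriv {α β T : ℝ} (hα0 : 0 < α) (hα1 : α < 1) (hβ0 : 0 < β)
    (hβ1 : β < 1) (hαβ : 1 < α + β) {A : ℝ → V → V} {DA : ℝ → V → (V →L[ℝ] V)}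
    {At : ℝ → V → V} {MA : ℝ} {C : ℝ≥0} (hMA : 0 ≤ MA)
    (hderiv : ∀ t z, 0 ≤ t → t ≤ T → HasFDerivAt (A t) (DA t z) z)
    (hDAhol : ∀ s t z w, 0 ≤ s → s ≤ t → t ≤ T →
      ‖DA t z - DA s z - (DA t w - DA s w)‖ ≤ MA * (t - s) ^ α * ‖z - w‖ ^ β)
    (htderiv : ∀ t z, t ∈ Icc (0 : ℝ) T →
      HasDerivWithinAt (fun τ : ℝ => A τ z) (At t z) (Icc (0 : ℝ) T) t)
    (htcont : ContinuousOn (fun p : ℝ × V => At p.1 p.2) (Icc (0 : ℝ) T ×ˢ univ))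
    (htbd : ∀ t ∈ Icc (0 : ℝ) T, ∀ z, ‖At t z‖ ≤ C) :
    IsYoungField At T C (2 * C + MA) MA α β ((α + β) / (1 + β)) where
  α_pos := hα0
  β_pos := hβ0
  one_lt_add := hαβ
  half_lt := by
    rw [← mul_div_assoc, lt_div_iff₀ (by linarith)]
    linarith
  γ_lt_one := by
    rw [div_lt_one (by linarith)]
    linarith
  L_nonneg := by positivity
  M_nonneg := hMA
  continuousOn := htcont
  norm_le := htbd
  fourPoint := by
    intro s t hs hst ht x₁ y₁ x₂ y₂
    have hs' : s ∈ Icc 0 T := ⟨hs, hst.trans ht⟩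
    have ht' : t ∈ Icc 0 T := ⟨hs.trans hst, ht⟩
    have hFTC : ∀ z, ∫ r in s..t, At r z = A t z - A s z := by
      intro z
      refine intervalIntegral.integral_eq_sub_of_hasDerivAt_of_le
        (f := fun τ => A τ z) hst ?_ ?_ ?_
      · exact fun r hr => ((htderiv r z ⟨hs.trans hr.1, hr.2.trans ht⟩).continuousWithinAt).mono
          (Icc_subset_Icc hs ht)
      · exact fun r hr => (htderiv r z ⟨hs.trans hr.1.le, hr.2.le.trans ht⟩).hasDerivAt
          (Icc_mem_nhds (hs.trans_lt hr.1) (hr.2.trans_le ht))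
      · have hc : ContinuousOn (fun r => At r z) (Icc 0 T) :=
          htcont.comp (continuousOn_id.prodMk continuousOn_const) fun _ hr => ⟨hr, mem_univ _⟩
        exact (hc.mono (uIcc_subset_Icc hs' ht')).intervalIntegrable
    have hbd : ∀ z, ‖A t z - A s z‖ ≤ C * (t - s) := by
      intro z
      have := (convex_Icc 0 T).norm_image_sub_le_of_norm_hasDerivWithin_le
        (f := fun τ => A τ z) (fun r hr => htderiv r z hr) (fun r hr => htbd r hr z) hs' ht'
      rwa [Real.norm_of_nonneg (sub_nonneg.2 hst)] at this
    simp only [hFTC]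
    rcases hst.eq_or_lt with rfl | hlt
    · simp only [sub_self, norm_zero]
      positivity
    have h0 : 0 < t - s := sub_pos.2 hlt
    have hβ' : 0 < 1 + β := by linarith
    have hfd : ∀ z, HasFDerivAt (fun z => A t z - A s z) (DA t z - DA s z) z := fun z =>
      (hderiv t z ht'.1 ht'.2).sub (hderiv s z hs'.1 hs'.2)
    have hhol := fun z w => hDAhol s t z w hs hst ht
    refine norm_fourPoint_le hfd (fun z => ?_) hhol x₁ y₁ x₂ y₂
    have h := opNorm_fderiv_le_of_bounded_of_holder hβ0.le
      (Real.rpow_pos_of_pos h0 ((1 - α) / (1 + β))) (by positivity) (by positivity) hfd hbd hhol z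
    refine h.trans_eq ?_
    have e1 : (t - s) / (t - s) ^ ((1 - α) / (1 + β)) = (t - s) ^ ((α + β) / (1 + β)) := by
      rw [div_eq_iff (Real.rpow_pos_of_pos h0 _).ne', ← Real.rpow_add h0, ← add_div,
        show α + β + (1 - α) = 1 + β by ring, div_self hβ'.ne', Real.rpow_one]
    have e2 : (t - s) ^ α * ((t - s) ^ ((1 - α) / (1 + β))) ^ β =
        (t - s) ^ ((α + β) / (1 + β)) := by
      rw [← Real.rpow_mul h0.le, ← Real.rpow_add h0]
      congr 1
      field_simp
      ring
    rw [mul_assoc MA, e2, ← mul_assoc, mul_div_assoc, e1]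
    ring

end TimeDerivative

/-- **Well-posedness of the YDE when `∂ₜA` exists.**  Let `α + β > 1` and
`A ∈ C^α_t C^{1+β}_V` be such that the time derivative `∂ₜA` exists at every point of
`[0,T] × V`, is jointly continuous and bounded.  Then for every `x₀ ∈ V` there is exactly
one continuous path `x` with `x_t = x₀ + ∫_0^t ∂ₜA(s, x_s) ds` on `[0,T]`. -/
theorem yde_wellposedness_time_derivative
    {V : Type*} [NormedAddCommGroup V] [NormedSpace ℝ V] [CompleteSpace V]
    (α β : ℝ) (hα0 : 0 < α) (hα1 : α < 1) (hβ0 : 0 < β) (hβ1 : β < 1)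
    (hαβ : 1 < α + β) (T : ℝ) (hT : 0 < T)
    (A : ℝ → V → V) (DA : ℝ → V → (V →L[ℝ] V)) (At : ℝ → V → V) (MA Cb : ℝ)
    (hA0 : ∀ z : V, A 0 z = 0)
    (hderiv : ∀ t : ℝ, ∀ z : V, 0 ≤ t → t ≤ T → HasFDerivAt (A t) (DA t z) z)
    (hAbd : ∀ s t : ℝ, ∀ z : V, 0 ≤ s → s ≤ t → t ≤ T →
      ‖A t z - A s z‖ ≤ MA * (t - s) ^ α)
    (hAhol : ∀ s t : ℝ, ∀ z w : V, 0 ≤ s → s ≤ t → t ≤ T →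
      ‖A t z - A s z - (A t w - A s w)‖ ≤ MA * (t - s) ^ α * ‖z - w‖ ^ β)
    (hDAbd : ∀ s t : ℝ, ∀ z : V, 0 ≤ s → s ≤ t → t ≤ T →
      ‖DA t z - DA s z‖ ≤ MA * (t - s) ^ α)
    (hDAhol : ∀ s t : ℝ, ∀ z w : V, 0 ≤ s → s ≤ t → t ≤ T →
      ‖DA t z - DA s z - (DA t w - DA s w)‖ ≤ MA * (t - s) ^ α * ‖z - w‖ ^ β)
    (htderiv : ∀ t : ℝ, ∀ z : V, t ∈ Set.Icc (0 : ℝ) T →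
      HasDerivWithinAt (fun τ : ℝ => A τ z) (At t z) (Set.Icc (0 : ℝ) T) t)
    (htcont : ContinuousOn (fun p : ℝ × V => At p.1 p.2) (Set.Icc (0 : ℝ) T ×ˢ Set.univ))
    (htbd : ∀ t : ℝ, ∀ z : V, 0 ≤ t → t ≤ T → ‖At t z‖ ≤ Cb) :
    ∀ x₀ : V, ∃ x : ℝ → V,
      ContinuousOn x (Set.Icc (0 : ℝ) T) ∧
      (∀ t : ℝ, 0 ≤ t → t ≤ T → x t = x₀ + ∫ s in (0 : ℝ)..t, At s (x s)) ∧
      (∀ y : ℝ → V, ContinuousOn y (Set.Icc (0 : ℝ) T) →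
        (∀ t : ℝ, 0 ≤ t → t ≤ T → y t = x₀ + ∫ s in (0 : ℝ)..t, At s (y s)) →
        ∀ t : ℝ, 0 ≤ t → t ≤ T → y t = x t) := by
  have hMA : 0 ≤ MA := by
    by_contra! hneg
    have h := (norm_nonneg _).trans (hAbd 0 T 0 le_rfl hT.le le_rfl)
    rw [sub_zero] at h
    exact (mul_neg_of_neg_of_pos hneg (Real.rpow_pos_of_pos hT α)).not_ge h
  have hCb : 0 ≤ Cb := (norm_nonneg _).trans (htbd 0 0 le_rfl hT.le)
  have hF := isYoungField_of_timeDeriv (C := ⟨Cb, hCb⟩) hα0 hα1 hβ0 hβ1 hαβ hMA hderiv hDAhol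
    htderiv htcont fun t ht z => htbd t z ht.1 ht.2
  intro x₀
  obtain ⟨x, hx, hx'⟩ := hF.exists_isSolution x₀
  exact ⟨x, hx, fun t h0 h1 => hx' t ⟨h0, h1⟩, fun y hy hy' t h0 h1 =>
    hF.eqOn_of_isSolution hT.le hy hx (fun s hs => hy' s hs.1 hs.2) hx' ⟨h0, h1⟩⟩
end

section
/- Linear operator-valued YDEs and Duhamel formula: Let α ∈ (1/2,1), V a Banach space and L ∈ C^α([0,T]; L(V;V)). Then: (1) there exists a unique M ∈ C^α([0,T]; L(V;V)) with M_0 = Id such that for some K, ‖M_t − M_s − (L_t − L_s)∘M_s‖_{L(V;V)} ≤ K(t−s)^{2α} for all s ≤ t; (2) M_t is an invertible element of L(V;V) for every t, and N_t := M_t^{−1} defines the unique path N ∈ C^α([0,T];L(V;V)) with N_0 = Id such that for some K, ‖N_t − N_s + N_s∘(L_t − L_s)‖_{L(V;V)} ≤ K(t−s)^{2α} for all s ≤ t; (3) for every y₀ ∈ V and ψ ∈ C^α([0,T];V) with ψ_0 = 0, the unique y ∈ C^α([0,T];V) with y_0 = y₀ such that for some K, ‖y_t − y_s − (L_t − L_s)(y_s)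 − (ψ_t − ψ_s)‖_V ≤ K(t−s)^{2α} for all s ≤ t, is given by y_t = M_t(y₀ + z_t), where z ∈ C^α([0,T];V) is the unique path with z_0 = 0 such that for some K, ‖z_t − z_s − N_s(ψ_t − ψ_s)‖_V ≤ K(t−s)^{2α} (the Young integral z_t = ∫_0^t N_s dψ_s). -/
section EulerProducts

variable {A : Type*} [NormedRing A]

/-- The ordered product `(1 + L_{(a+n-1)h,(a+n)h}) ⋯ (1 + L_{ah,(a+1)h})` over `n` grid steps of
size `h`, starting from the grid point `a * h`. -/
def eulerProd (L : ℝ → A) (h : ℝ) (a : ℕ) : ℕ → A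
  | 0 => 1
  | n + 1 => (1 + (L (((a + n + 1 : ℕ) : ℝ) * h) - L (((a + n : ℕ) : ℝ) * h))) * eulerProd L h a n

theorem eulerProd_zero (L : ℝ → A) (h : ℝ) (a : ℕ) : eulerProd L h a 0 = 1 := rfl

theorem eulerProd_succ (L : ℝ → A) (h : ℝ) (a n : ℕ) :
    eulerProd L h a (n + 1) =
      (1 + (L (((a + n + 1 : ℕ) : ℝ) * h) - L (((a + n : ℕ) : ℝ) * h))) * eulerProd L h a n := rfl

theorem eulerProd_add (L : ℝ → A) (h : ℝ) (a m n : ℕ) :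
    eulerProd L h a (m + n) = eulerProd L h (a + m) n * eulerProd L h a m := by
  induction n with
  | zero => simp [eulerProd_zero]
  | succ n ih => rw [← add_assoc, eulerProd_succ, eulerProd_succ, ih, mul_assoc, add_assoc a m n]

theorem rpow_add_rpow_le_of_le_two_thirds {θ x y : ℝ} (hθ : 1 < θ) (hx : 0 < x) (hy : 0 < y)
    (hxy : x ≤ 2 / 3 * (x + y)) (hyx : y ≤ 2 / 3 * (x + y)) :
    x ^ θ + y ^ θ ≤ (2 / 3 : ℝ) ^ (θ - 1) * (x + y) ^ θ := by
  have key : ∀ z : ℝ, 0 < z → z ≤ 2 / 3 * (x + y) →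
      z ^ θ ≤ z * ((2 / 3 : ℝ) ^ (θ - 1) * (x + y) ^ (θ - 1)) := by
    intro z hz hzle
    rw [← Real.mul_rpow (by norm_num) (by positivity)]
    calc z ^ θ = z * z ^ (θ - 1) := by
          rw [Real.rpow_sub_one hz.ne', mul_div_cancel₀ _ hz.ne']
      _ ≤ _ := by gcongr
  have hs : (x + y) ^ θ = (x + y) * (x + y) ^ (θ - 1) := by
    rw [Real.rpow_sub_one (by positivity)]; field_simp
  calc x ^ θ + y ^ θ ≤ _ := add_le_add (key x hx hxy) (key y hy hyx)
    _ = _ := by rw [hs]; ring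

variable {L : ℝ → A} {K α h C ε δ : ℝ}

theorem norm_grid_increment_le (hL : ∀ s t : ℝ, s ≤ t → ‖L t - L s‖ ≤ K * (t - s) ^ α)
    (hh : 0 < h) (a n : ℕ) :
    ‖L (((a + n : ℕ) : ℝ) * h) - L ((a : ℝ) * h)‖ ≤ K * (n * h) ^ α := by
  have := hL (a * h) (((a + n : ℕ) : ℝ) * h) (by gcongr; omega)
  convert this using 3
  push_cast; ring

/-- Davie's estimate: a discrete version of the multiplicative sewing lemma. -/
theorem norm_eulerProd_sub_le (h1 : ‖(1 : A)‖ ≤ 1) (hα : 1 / 2 < α) (hK : 0 ≤ K)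
    (hL : ∀ s t : ℝ, s ≤ t → ‖L t - L s‖ ≤ K * (t - s) ^ α) (hh : 0 < h)
    (hC : 0 ≤ C) (hε : K * δ ^ α + C * δ ^ (2 * α) ≤ ε)
    (hCε : K ^ 2 + (2 / 3 : ℝ) ^ (2 * α - 1) * (1 + ε) * C ≤ C) (n : ℕ) :
    ∀ a : ℕ, n * h ≤ δ →
      ‖eulerProd L h a n - 1 - (L (((a + n : ℕ) : ℝ) * h) - L ((a : ℝ) * h))‖
        ≤ C * (n * h) ^ (2 * α) := by
  induction n using Nat.strong_induction_on with
  | _ n ih =>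
  intro a hn
  rcases Nat.lt_or_ge n 2 with hn2 | hn2
  · interval_cases n
    · simp [eulerProd_zero]; positivity
    · simp only [eulerProd_succ, eulerProd_zero]
      simp only [add_zero, mul_one, add_sub_cancel_left, sub_self, norm_zero]
      positivity
  obtain ⟨m, k, rfl, hm, hk, hmk, hkm⟩ : ∃ m k, n = m + k ∧ 0 < m ∧ 0 < k ∧
      3 * m ≤ 2 * (m + k) ∧ 3 * k ≤ 2 * (m + k) :=
    ⟨n / 2, n - n / 2, by omega, by omega, by omega, by omega, by omega⟩
  have hxm : 0 < (m : ℝ) * h := by positivity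
  have hxk : 0 < (k : ℝ) * h := by positivity
  push_cast at hn
  rw [add_mul] at hn
  have hδ : 0 < δ := by linarith
  have bound : ∀ x : ℝ, 0 < x → x ≤ δ → K * x ^ α + C * x ^ (2 * α) ≤ ε := fun x hx hxδ =>
    le_trans (by gcongr) hε
  have hR₁ := ih m (by omega) a (by linarith)
  have hR₂ := ih k (by omega) (a + m) (by linarith)
  have hl₁ := norm_grid_increment_le hL hh a m
  have hl₂ := norm_grid_increment_le hL hh (a + m) k
  rw [eulerProd_add, ← add_assoc]
  set P₁ := eulerProd L h a m
  set P₂ := eulerProd L h (a + m) k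
  set l₁ := L (((a + m : ℕ) : ℝ) * h) - L ((a : ℝ) * h) with hl₁d
  set l₂ := L (((a + m + k : ℕ) : ℝ) * h) - L (((a + m : ℕ) : ℝ) * h) with hl₂d
  have hsplit : L (((a + m + k : ℕ) : ℝ) * h) - L ((a : ℝ) * h) = l₂ + l₁ := by
    rw [hl₁d, hl₂d]; abel
  rw [hsplit]
  have hid : P₂ * P₁ - 1 - (l₂ + l₁) =
      l₂ * l₁ + (P₂ - 1 - l₂) * P₁ + (1 + l₂) * (P₁ - 1 - l₁) := by noncomm_ring
  have hP₁ : ‖P₁‖ ≤ 1 + ε := by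
    have : P₁ = 1 + l₁ + (P₁ - 1 - l₁) := by abel
    rw [this]
    have := bound _ hxm (by linarith)
    have := norm_add₃_le (a := (1 : A)) (b := l₁) (c := P₁ - 1 - l₁)
    linarith
  have hQ₂ : ‖1 + l₂‖ ≤ 1 + ε := by
    have := bound _ hxk (by linarith)
    have := norm_add_le (1 : A) l₂
    have : 0 ≤ C * (k * h) ^ (2 * α) := by positivity
    linarith
  have hε0 : 0 ≤ 1 + ε := (norm_nonneg _).trans hP₁
  have hll : ‖l₂ * l₁‖ ≤ K ^ 2 * (m * h + k * h) ^ (2 * α) := by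
    calc ‖l₂ * l₁‖ ≤ ‖l₂‖ * ‖l₁‖ := norm_mul_le _ _
      _ ≤ (K * (m * h + k * h) ^ α) * (K * (m * h + k * h) ^ α) := by
          refine mul_le_mul (hl₂.trans ?_) (hl₁.trans ?_) (norm_nonneg _) (by positivity)
          · gcongr; linarith
          · gcongr; linarith
      _ = _ := by rw [two_mul, Real.rpow_add (by positivity)]; ring
  have hA : ‖(P₂ - 1 - l₂) * P₁‖ ≤ C * (k * h) ^ (2 * α) * (1 + ε) :=
    (norm_mul_le _ _).trans (mul_le_mul hR₂ hP₁ (norm_nonneg _) (by positivity))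
  have hB : ‖(1 + l₂) * (P₁ - 1 - l₁)‖ ≤ (1 + ε) * (C * (m * h) ^ (2 * α)) :=
    (norm_mul_le _ _).trans (mul_le_mul hQ₂ hR₁ (norm_nonneg _) hε0)
  have hsum := rpow_add_rpow_le_of_le_two_thirds (θ := 2 * α) (by linarith) hxm hxk
    (by have : (3 * m : ℝ) ≤ 2 * (m + k) := by exact_mod_cast hmk
        nlinarith)
    (by have : (3 * k : ℝ) ≤ 2 * (m + k) := by exact_mod_cast hkm
        nlinarith)
  rw [hid]
  rw [Nat.cast_add, add_mul (m : ℝ)]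
  set X := ((m : ℝ) * h + k * h) ^ (2 * α)
  have hX : 0 ≤ X := by positivity
  calc _ ≤ ‖l₂ * l₁‖ + ‖(P₂ - 1 - l₂) * P₁‖ + ‖(1 + l₂) * (P₁ - 1 - l₁)‖ := norm_add₃_le
    _ ≤ K ^ 2 * X + (1 + ε) * C * ((m * h) ^ (2 * α) + (k * h) ^ (2 * α)) := by linarith
    _ ≤ K ^ 2 * X + (1 + ε) * C * ((2 / 3 : ℝ) ^ (2 * α - 1) * X) := by gcongr
    _ = (K ^ 2 + (2 / 3 : ℝ) ^ (2 * α - 1) * (1 + ε) * C) * X := by ring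
    _ ≤ C * X := by gcongr

theorem norm_eulerProd_le_two_pow (h1 : ‖(1 : A)‖ ≤ 1) {p : ℕ}
    (hp : ∀ a n : ℕ, n ≤ p → ‖eulerProd L h a n‖ ≤ 2) (k : ℕ) :
    ∀ a n : ℕ, n ≤ k * p → ‖eulerProd L h a n‖ ≤ 2 ^ k := by
  induction k with
  | zero =>
    intro a n hn
    obtain rfl : n = 0 := by omega
    simpa [eulerProd_zero] using h1
  | succ k ih =>
    intro a n hn
    rw [add_mul, one_mul] at hn
    obtain ⟨m, j, rfl, hm, hj⟩ : ∃ m j, n = m + j ∧ m ≤ k * p ∧ j ≤ p :=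
      ⟨min n (k * p), n - min n (k * p), by omega, by omega, by omega⟩
    rw [eulerProd_add, pow_succ']
    exact (norm_mul_le _ _).trans
      (mul_le_mul (hp _ _ hj) (ih _ _ hm) (norm_nonneg _) (by norm_num))

/-- Effect of halving the mesh on Euler products. -/
theorem norm_eulerProd_half_sub_le {B T : ℝ} (hα : 1 / 2 < α) (hK : 0 ≤ K)
    (hL : ∀ s t : ℝ, s ≤ t → ‖L t - L s‖ ≤ K * (t - s) ^ α) (hh : 0 < h)
    (hB : ∀ a n : ℕ, n * h ≤ T → ‖eulerProd L h a n‖ ≤ B)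
    (hB' : ∀ a n : ℕ, n * (h / 2) ≤ T → ‖eulerProd L (h / 2) a n‖ ≤ B) (j : ℕ) :
    ∀ k : ℕ, ((k + j : ℕ) : ℝ) * h ≤ T →
      ‖eulerProd L (h / 2) (2 * k) (2 * j) * eulerProd L h 0 k - eulerProd L h 0 (k + j)‖
        ≤ j * (B ^ 2 * K ^ 2 * h ^ (2 * α)) := by
  induction j with
  | zero => intro k _; simp [eulerProd_zero]
  | succ j ih =>
    intro k hkj
    have hkj' : (k : ℝ) * h + j * h + h ≤ T := by push_cast at hkj; linarith
    have hk0 : 0 ≤ (k : ℝ) * h := by positivity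
    have hj0 : 0 ≤ (j : ℝ) * h := by positivity
    have hIH := ih (k + 1) (by push_cast; linarith)
    have e1 : L (((2 * k + 1 + 1 : ℕ) : ℝ) * (h / 2)) = L (((k + 1 : ℕ) : ℝ) * h) := by
      congr 1; push_cast; ring
    have e2 : L (((2 * k : ℕ) : ℝ) * (h / 2)) = L ((k : ℝ) * h) := by
      congr 1; push_cast; ring
    have hl₁ := norm_grid_increment_le hL (half_pos hh) (2 * k) 1
    have hl₂ := norm_grid_increment_le hL (half_pos hh) (2 * k + 1) 1
    rw [e1] at hl₂
    rw [e2] at hl₁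
    have hhalf : K * (((1 : ℕ) : ℝ) * (h / 2)) ^ α ≤ K * h ^ α := by
      gcongr; push_cast; linarith
    set l₁ := L (((2 * k + 1 : ℕ) : ℝ) * (h / 2)) - L ((k : ℝ) * h) with hl₁d
    set l₂ := L (((k + 1 : ℕ) : ℝ) * h) - L (((2 * k + 1 : ℕ) : ℝ) * (h / 2)) with hl₂d
    have hfine : eulerProd L (h / 2) (2 * k) (2 * (j + 1)) =
        eulerProd L (h / 2) (2 * (k + 1)) (2 * j) * ((1 + l₂) * (1 + l₁)) := by
      rw [show 2 * (j + 1) = 2 + 2 * j by ring, eulerProd_add,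
        show 2 * (k + 1) = 2 * k + 2 by ring]
      congr 1
      rw [eulerProd_succ, eulerProd_succ, eulerProd_zero, add_zero, mul_one, e1, e2]
    have hcoarse : eulerProd L h 0 (k + 1) = (1 + (l₂ + l₁)) * eulerProd L h 0 k := by
      rw [eulerProd_succ, hl₁d, hl₂d, sub_add_sub_cancel, zero_add]
    rw [show k + (j + 1) = k + 1 + j by ring, hfine]
    have hid : eulerProd L (h / 2) (2 * (k + 1)) (2 * j) * ((1 + l₂) * (1 + l₁)) *
          eulerProd L h 0 k - eulerProd L h 0 (k + 1 + j) =
        eulerProd L (h / 2) (2 * (k + 1)) (2 * j) * (l₂ * l₁) * eulerProd L h 0 k +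
        (eulerProd L (h / 2) (2 * (k + 1)) (2 * j) * eulerProd L h 0 (k + 1) -
          eulerProd L h 0 (k + 1 + j)) := by
      rw [hcoarse]; noncomm_ring
    have hll : ‖l₂ * l₁‖ ≤ K ^ 2 * h ^ (2 * α) := by
      calc ‖l₂ * l₁‖ ≤ ‖l₂‖ * ‖l₁‖ := norm_mul_le _ _
        _ ≤ (K * h ^ α) * (K * h ^ α) :=
            mul_le_mul (hl₂.trans hhalf) (hl₁.trans hhalf) (norm_nonneg _) (by positivity)
        _ = _ := by rw [two_mul, Real.rpow_add hh]; ring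
    have hb₁ := hB' (2 * (k + 1)) (2 * j) (by push_cast; linarith)
    have hb₂ := hB 0 k (by linarith)
    have hB0 : 0 ≤ B := (norm_nonneg _).trans hb₂
    have hterm : ‖eulerProd L (h / 2) (2 * (k + 1)) (2 * j) * (l₂ * l₁) * eulerProd L h 0 k‖ ≤
        B * (K ^ 2 * h ^ (2 * α)) * B :=
      (norm_mul_le _ _).trans (mul_le_mul ((norm_mul_le _ _).trans
        (mul_le_mul hb₁ hll (norm_nonneg _) hB0)) hb₂ (norm_nonneg _) (by positivity))
    rw [hid]
    refine (norm_add_le _ _).trans ((add_le_add hterm hIH).trans (le_of_eq ?_))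
    push_cast; ring

theorem norm_eulerProd_floor_half_sub_le {B T t : ℝ} (hα : 1 / 2 < α) (hα1 : α ≤ 1) (hK : 0 ≤ K)
    (hL : ∀ s t : ℝ, s ≤ t → ‖L t - L s‖ ≤ K * (t - s) ^ α) (hh : 0 < h) (hδ : h ≤ δ)
    (hB : ∀ a n : ℕ, n * h ≤ T → ‖eulerProd L h a n‖ ≤ B)
    (hB' : ∀ a n : ℕ, n * (h / 2) ≤ T → ‖eulerProd L (h / 2) a n‖ ≤ B)
    (ht : 0 ≤ t) (htT : t ≤ T) :
    ‖eulerProd L (h / 2) 0 ⌊t / (h / 2)⌋₊ - eulerProd L h 0 ⌊t / h⌋₊‖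
      ≤ (T * (B ^ 2 * K ^ 2) + K * B * δ ^ (1 - α)) * h ^ (2 * α - 1) := by
  have hNt : (⌊t / h⌋₊ : ℝ) * h ≤ t :=
    (le_div_iff₀ hh).1 (Nat.floor_le (by positivity))
  have hh2 : 2 * (t / h) = t / (h / 2) := by field_simp
  have hlow : 2 * ⌊t / h⌋₊ ≤ ⌊t / (h / 2)⌋₊ := by
    apply Nat.le_floor
    push_cast
    rw [← hh2]
    gcongr
    exact Nat.floor_le (by positivity)
  have hupp : ⌊t / (h / 2)⌋₊ < 2 * ⌊t / h⌋₊ + 2 := by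
    rw [Nat.floor_lt (by positivity), ← hh2]
    push_cast
    linarith [Nat.lt_floor_add_one (t / h)]
  have hB0 : 0 ≤ B := (norm_nonneg _).trans (hB 0 0 (by simpa using ht.trans htT))
  have hmain := norm_eulerProd_half_sub_le hα hK hL hh hB hB' ⌊t / h⌋₊ 0 (by simpa using hNt.trans htT)
  simp only [mul_zero, zero_add, eulerProd_zero, mul_one] at hmain
  have hmain' : ‖eulerProd L (h / 2) 0 (2 * ⌊t / h⌋₊) - eulerProd L h 0 ⌊t / h⌋₊‖ ≤
      T * (B ^ 2 * K ^ 2) * h ^ (2 * α - 1) := by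
    refine hmain.trans ?_
    have : h ^ (2 * α) = h * h ^ (2 * α - 1) := by
      rw [Real.rpow_sub_one hh.ne', mul_div_cancel₀ _ hh.ne']
    rw [this]
    calc _ = (⌊t / h⌋₊ * h) * (B ^ 2 * K ^ 2) * h ^ (2 * α - 1) := by ring
      _ ≤ _ := by gcongr; exact hNt.trans htT
  have hlast : ‖eulerProd L (h / 2) 0 ⌊t / (h / 2)⌋₊ - eulerProd L (h / 2) 0 (2 * ⌊t / h⌋₊)‖ ≤
      K * B * δ ^ (1 - α) * h ^ (2 * α - 1) := by
    have hδ0 : 0 < δ := hh.trans_le hδ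
    rcases (by omega : ⌊t / (h / 2)⌋₊ = 2 * ⌊t / h⌋₊ ∨ ⌊t / (h / 2)⌋₊ = 2 * ⌊t / h⌋₊ + 1) with e | e
    · rw [e, sub_self, norm_zero]; positivity
    rw [e, eulerProd_succ, add_mul, one_mul, add_sub_cancel_left]
    have hx := norm_grid_increment_le hL (half_pos hh) (0 + 2 * ⌊t / h⌋₊) 1
    have hsmall : K * (((1 : ℕ) : ℝ) * (h / 2)) ^ α ≤ K * (δ ^ (1 - α) * h ^ (2 * α - 1)) := by
      calc _ ≤ K * h ^ α := by gcongr; push_cast; linarith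
        _ = K * (h ^ (1 - α) * h ^ (2 * α - 1)) := by
          rw [← Real.rpow_add hh]; congr 2; ring
        _ ≤ _ := by gcongr
    refine (norm_mul_le _ _).trans ((mul_le_mul (hx.trans hsmall) (hB' _ _ ?_) (norm_nonneg _)
      (by positivity)).trans (le_of_eq (by ring)))
    push_cast
    linarith
  calc _ ≤ _ := norm_sub_le_norm_sub_add_norm_sub _ (eulerProd L (h / 2) 0 (2 * ⌊t / h⌋₊)) _
    _ ≤ _ := by linarith

open Filter Topology in
theorem exists_pos_rpow_add_rpow_le (hα : 0 < α) (K C : ℝ) (hε : 0 < ε) :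
    ∃ δ > 0, K * δ ^ α + C * δ ^ (2 * α) ≤ ε := by
  have hc : Tendsto (fun x : ℝ => K * x ^ α + C * x ^ (2 * α)) (𝓝 0) (𝓝 0) := by
    have h1 := Real.continuousAt_rpow_const 0 α (Or.inr hα.le)
    have h2 := Real.continuousAt_rpow_const 0 (2 * α) (Or.inr (by positivity))
    simpa [Real.zero_rpow hα.ne', Real.zero_rpow (by positivity : 2 * α ≠ 0)] using
      (h1.tendsto.const_mul K).add (h2.tendsto.const_mul C)
  obtain ⟨δ, h1, h2⟩ := (((hc.mono_left nhdsWithin_le_nhds).eventually_le_const hε).and (self_mem_nhdsWithin (s := Set.Ioi 0))).exists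
  exact ⟨δ, h2, h1⟩

open Filter Topology in
/-- Existence for the linear Young equation `dM = dL * M`, `M 0 = 1`, in a Banach algebra. -/
theorem exists_linear_young_solution [CompleteSpace A] (h1 : ‖(1 : A)‖ ≤ 1) (hα : 1 / 2 < α)
    (hα1 : α ≤ 1) (hK : 0 ≤ K) (hL : ∀ s t : ℝ, s ≤ t → ‖L t - L s‖ ≤ K * (t - s) ^ α)
    {T : ℝ} (hT : 0 ≤ T) :
    ∃ M : ℝ → A, M 0 = 1 ∧ ∃ D : ℝ, ∀ s t : ℝ, 0 ≤ s → s ≤ t → t ≤ T →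
      ‖M t - M s - (L t - L s) * M s‖ ≤ D * (t - s) ^ (2 * α) := by
  obtain ⟨q, hq⟩ : ∃ q : ℝ, q = (2 / 3 : ℝ) ^ (2 * α - 1) := ⟨_, rfl⟩
  have hq0 : 0 < q := by rw [hq]; positivity
  have hq1 : q < 1 := by rw [hq]; exact Real.rpow_lt_one (by norm_num) (by norm_num) (by linarith)
  obtain ⟨C, hC⟩ : ∃ C : ℝ, C = 2 * K ^ 2 / (1 - q) := ⟨_, rfl⟩
  have hC0 : 0 ≤ C := by rw [hC]; exact div_nonneg (by positivity) (by linarith)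
  have hCq : (1 - q) * C = 2 * K ^ 2 := by
    rw [hC, mul_div_cancel₀ _ (by linarith)]
  obtain ⟨δ, hδ, hδε⟩ := exists_pos_rpow_add_rpow_le (α := α) (by linarith) K C
    (ε := (1 - q) / 2) (by linarith)
  have hCε : K ^ 2 + (2 / 3 : ℝ) ^ (2 * α - 1) * (1 + (1 - q) / 2) * C ≤ C := by
    rw [← hq]; nlinarith [mul_nonneg (mul_nonneg (sub_nonneg.2 hq1.le) (sub_nonneg.2 hq1.le)) hC0]
  have hdavie : ∀ h : ℝ, 0 < h → ∀ a n : ℕ, n * h ≤ δ → _ := fun h hh a n hn =>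
    norm_eulerProd_sub_le h1 hα hK hL hh hC0 hδε hCε n a hn
  have hlocal : ∀ h : ℝ, 0 < h → ∀ a n : ℕ, n * h ≤ δ → ‖eulerProd L h a n‖ ≤ 2 := by
    intro h hh a n hn
    have hd := hdavie h hh a n hn
    have hi := norm_grid_increment_le hL hh a n
    have : eulerProd L h a n = 1 + (L (((a + n : ℕ) : ℝ) * h) - L ((a : ℝ) * h)) +
      (eulerProd L h a n - 1 - (L (((a + n : ℕ) : ℝ) * h) - L ((a : ℝ) * h))) := by abel
    rw [this]
    have hm : K * (n * h) ^ α + C * (n * h) ^ (2 * α) ≤ K * δ ^ α + C * δ ^ (2 * α) := by gcongr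
    refine norm_add₃_le.trans ?_
    linarith
  obtain ⟨B, hBd⟩ : ∃ B : ℝ, B = 2 ^ ⌈T / δ⌉₊ := ⟨_, rfl⟩
  let h : ℕ → ℝ := fun n => δ / 2 ^ n
  have hh : ∀ n, 0 < h n := fun n => by positivity
  have hhδ : ∀ n, h n ≤ δ := fun n => div_le_self hδ.le (one_le_pow₀ (by norm_num))
  have hhs : ∀ n, h (n + 1) = h n / 2 := fun n => by simp only [h, pow_succ]; field_simp
  have hh0 : Tendsto h atTop (𝓝 0) := by
    have := (tendsto_pow_atTop_nhds_zero_of_lt_one (r := (1 / 2 : ℝ)) (by norm_num)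
      (by norm_num)).const_mul δ
    rw [mul_zero] at this
    refine this.congr fun n => ?_
    simp only [h, div_eq_mul_inv, one_mul, inv_pow]
  have hB : ∀ i a n : ℕ, n * h i ≤ T → ‖eulerProd L (h i) a n‖ ≤ B := by
    intro i a n hn
    rw [hBd]
    refine norm_eulerProd_le_two_pow h1 (p := 2 ^ i) (fun a n hn => hlocal _ (hh i) a n ?_) _ a n ?_
    · have : (n : ℝ) ≤ 2 ^ i := by exact_mod_cast hn
      simp only [h]
      rw [← mul_div_assoc, div_le_iff₀ (by positivity), mul_comm δ]
      gcongr
    · have h2 : (n : ℝ) ≤ T / δ * 2 ^ i := by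
        simp only [h] at hn
        rw [← mul_div_assoc, div_le_iff₀ (by positivity)] at hn
        rw [div_mul_eq_mul_div, le_div_iff₀ hδ]
        exact hn
      have h3 : (n : ℝ) ≤ ⌈T / δ⌉₊ * 2 ^ i := h2.trans (by gcongr; exact Nat.le_ceil _)
      exact_mod_cast h3
  have hB0 : 0 ≤ B := by rw [hBd]; positivity
  let Y : ℕ → ℝ → A := fun n t => eulerProd L (h n) 0 ⌊t / h n⌋₊
  have hfloor : ∀ n t, 0 ≤ t → (⌊t / h n⌋₊ : ℝ) * h n ≤ t := fun n t ht =>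
    (le_div_iff₀ (hh n)).1 (Nat.floor_le (div_nonneg ht (hh n).le))
  have hgrid : ∀ t, 0 ≤ t → Tendsto (fun n => (⌊t / h n⌋₊ : ℝ) * h n) atTop (𝓝 t) := by
    intro t ht
    have hlow : Tendsto (fun n => t - h n) atTop (𝓝 t) := by
      simpa using hh0.const_sub t
    refine tendsto_of_tendsto_of_tendsto_of_le_of_le hlow tendsto_const_nhds (fun n => ?_)
      (fun n => hfloor n t ht)
    have := (div_lt_iff₀ (hh n)).1 (Nat.lt_floor_add_one (t / h n))
    dsimp only
    linarith
  have hYB : ∀ n t, 0 ≤ t → t ≤ T → ‖Y n t‖ ≤ B := fun n t ht htT =>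
    hB n 0 _ ((hfloor n t ht).trans htT)
  have hlim : ∀ t, ∃ m, 0 ≤ t → t ≤ T → Tendsto (fun n => Y n t) atTop (𝓝 m) := by
    intro t
    by_cases ht : 0 ≤ t ∧ t ≤ T
    swap
    · exact ⟨0, fun h1 h2 => absurd ⟨h1, h2⟩ ht⟩
    have hcauchy : CauchySeq fun n => Y n t := by
      refine cauchySeq_of_le_geometric ((1 / 2 : ℝ) ^ (2 * α - 1))
        ((T * (B ^ 2 * K ^ 2) + K * B * δ ^ (1 - α)) * δ ^ (2 * α - 1))
        (Real.rpow_lt_one (by norm_num) (by norm_num) (by linarith)) fun n => ?_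
      have := norm_eulerProd_floor_half_sub_le hα hα1 hK hL (hh n) (hhδ n) (hB n)
        (by rw [← hhs]; exact hB (n + 1)) ht.1 ht.2
      rw [← hhs] at this
      rw [dist_comm, dist_eq_norm]
      refine this.trans (le_of_eq ?_)
      simp only [h]
      rw [mul_assoc (_ + _), Real.rpow_pow_comm (by norm_num), ← Real.mul_rpow hδ.le (by positivity),
        one_div, inv_pow, div_eq_mul_inv]
    obtain ⟨m, hm⟩ := cauchySeq_tendsto_of_complete hcauchy
    exact ⟨m, fun _ _ => hm⟩
  choose M hM using hlim
  have hMB : ∀ t, 0 ≤ t → t ≤ T → ‖M t‖ ≤ B := fun t ht htT =>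
    le_of_tendsto (hM t ht htT).norm (Eventually.of_forall fun n => hYB n t ht htT)
  have hLc : Continuous L := by
    rw [continuous_iff_continuousAt]
    intro t
    rw [ContinuousAt, tendsto_iff_norm_sub_tendsto_zero]
    have hb : ∀ s, ‖L s - L t‖ ≤ K * |s - t| ^ α := by
      intro s
      rcases le_total t s with hst | hst
      · rw [abs_of_nonneg (by linarith)]; exact hL t s hst
      · rw [norm_sub_rev, abs_sub_comm, abs_of_nonneg (by linarith)]; exact hL s t hst
    refine squeeze_zero (fun _ => norm_nonneg _) hb ?_
    have : ContinuousAt (fun s : ℝ => K * |s - t| ^ α) t :=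
      ((continuous_abs.comp (continuous_id.sub continuous_const)).continuousAt.rpow_const
        (Or.inr (by linarith))).const_mul K
    simpa [ContinuousAt, Real.zero_rpow (by linarith : α ≠ 0)] using this
  refine ⟨M, ?_, max (C * B) ((B + B + K * T ^ α * B) / δ ^ (2 * α)), fun s t hs hst htT => ?_⟩
  · refine tendsto_nhds_unique (hM 0 le_rfl hT) ?_
    simp only [Y, zero_div, Nat.floor_zero, eulerProd_zero]
    exact tendsto_const_nhds
  have ht := hs.trans hst
  have hsT := hst.trans htT
  have hts : 0 ≤ t - s := sub_nonneg.2 hst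
  rcases lt_or_ge (t - s) δ with hsmall | hlarge
  · refine le_trans ?_ (mul_le_mul_of_nonneg_right (le_max_left _ _) (by positivity))
    have hlhs : Tendsto (fun n => ‖Y n t - Y n s -
        (L (⌊t / h n⌋₊ * h n) - L (⌊s / h n⌋₊ * h n)) * Y n s‖) atTop
        (𝓝 ‖M t - M s - (L t - L s) * M s‖) :=
      (((hM t ht htT).sub (hM s hs hsT)).sub
        (((hLc.continuousAt.tendsto.comp (hgrid t ht)).sub
          (hLc.continuousAt.tendsto.comp (hgrid s hs))).mul (hM s hs hsT))).norm
    have hdiff := (hgrid t ht).sub (hgrid s hs)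
    have hrhs : Tendsto (fun n => C * B *
        ((⌊t / h n⌋₊ : ℝ) * h n - ⌊s / h n⌋₊ * h n) ^ (2 * α)) atTop
        (𝓝 (C * B * (t - s) ^ (2 * α))) :=
      (hdiff.rpow_const (Or.inr (by linarith))).const_mul _
    refine le_of_tendsto_of_tendsto hlhs hrhs ?_
    filter_upwards [hdiff.eventually_lt_const hsmall] with n hn
    obtain ⟨k, hk⟩ : ∃ k, ⌊t / h n⌋₊ = ⌊s / h n⌋₊ + k :=
      Nat.exists_eq_add_of_le (Nat.floor_mono (div_le_div_of_nonneg_right hst (hh n).le))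
    simp only [Y]
    rw [hk] at hn ⊢
    have hsub : ((⌊s / h n⌋₊ + k : ℕ) : ℝ) * h n - ⌊s / h n⌋₊ * h n = k * h n := by
      push_cast; ring
    rw [hsub] at hn ⊢
    have hd := hdavie (h n) (hh n) ⌊s / h n⌋₊ k hn.le
    rw [eulerProd_add, zero_add]
    set P₁ := eulerProd L (h n) 0 ⌊s / h n⌋₊
    set P₂ := eulerProd L (h n) ⌊s / h n⌋₊ k
    have hP₁ : ‖P₁‖ ≤ B := hYB n s hs hsT
    have hid : P₂ * P₁ - P₁ - (L (((⌊s / h n⌋₊ + k : ℕ) : ℝ) * h n) - L (⌊s / h n⌋₊ * h n)) * P₁ =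
        (P₂ - 1 - (L (((⌊s / h n⌋₊ + k : ℕ) : ℝ) * h n) - L (⌊s / h n⌋₊ * h n))) * P₁ := by
      noncomm_ring
    rw [hid]
    have hkh : 0 ≤ (k : ℝ) * h n := mul_nonneg k.cast_nonneg (hh n).le
    exact (norm_mul_le _ _).trans ((mul_le_mul hd hP₁ (norm_nonneg _) (by positivity)).trans
      (le_of_eq (by ring)))
  · refine le_trans ?_ (mul_le_mul_of_nonneg_right (le_max_right _ _) (by positivity))
    have hbig : 1 ≤ (t - s) ^ (2 * α) / δ ^ (2 * α) := by
      rw [one_le_div (by positivity)]; gcongr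
    have hLM : ‖(L t - L s) * M s‖ ≤ K * T ^ α * B :=
      (norm_mul_le _ _).trans (mul_le_mul ((hL s t hst).trans (by gcongr; linarith))
        (hMB s hs hsT) (norm_nonneg _) (by positivity))
    have h₁ := norm_sub_le (M t - M s) ((L t - L s) * M s)
    have h₂ := norm_sub_le (M t) (M s)
    have h₃ := hMB t ht htT
    have h₄ := hMB s hs hsT
    have hD : 0 ≤ B + B + K * T ^ α * B := by positivity
    calc _ ≤ (B + B + K * T ^ α * B) * 1 := by linarith
      _ ≤ (B + B + K * T ^ α * B) * ((t - s) ^ (2 * α) / δ ^ (2 * α)) := by gcongr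
      _ = _ := by ring

end EulerProducts

section IncrementBound

variable {E F G : Type*} [NormedAddCommGroup E] [NormedAddCommGroup F] [NormedAddCommGroup G]

/-- The two-parameter map `g` is `O((t - s) ^ β)` on the simplex `0 ≤ s ≤ t ≤ T`. -/
def IncrementBound (T β : ℝ) (g : ℝ → ℝ → E) : Prop :=
  ∃ C : ℝ, ∀ s t : ℝ, 0 ≤ s → s ≤ t → t ≤ T → ‖g s t‖ ≤ C * (t - s) ^ β

namespace IncrementBound

variable {T β γ : ℝ} {g g' : ℝ → ℝ → E} {f : ℝ → ℝ → F}

theorem exists_nonneg (hg : IncrementBound T β g) :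
    ∃ C : ℝ, 0 ≤ C ∧ ∀ s t : ℝ, 0 ≤ s → s ≤ t → t ≤ T → ‖g s t‖ ≤ C * (t - s) ^ β := by
  obtain ⟨C, hC⟩ := hg
  refine ⟨|C|, abs_nonneg _, fun s t hs hst ht => (hC s t hs hst ht).trans ?_⟩
  have := Real.rpow_nonneg (sub_nonneg.2 hst) β
  gcongr
  exact le_abs_self C

theorem of_norm_le (hg : IncrementBound T β g)
    (h : ∀ s t : ℝ, 0 ≤ s → s ≤ t → t ≤ T → ‖f s t‖ ≤ ‖g s t‖) : IncrementBound T β f := by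
  obtain ⟨C, hC⟩ := hg
  exact ⟨C, fun s t hs hst ht => (h s t hs hst ht).trans (hC s t hs hst ht)⟩

theorem congr (hg : IncrementBound T β g)
    (h : ∀ s t : ℝ, 0 ≤ s → s ≤ t → t ≤ T → g' s t = g s t) : IncrementBound T β g' :=
  hg.of_norm_le fun s t hs hst ht => by rw [h s t hs hst ht]

theorem add (hg : IncrementBound T β g) (hg' : IncrementBound T β g') :
    IncrementBound T β fun s t => g s t + g' s t := by
  obtain ⟨C, hC⟩ := hg
  obtain ⟨C', hC'⟩ := hg'
  refine ⟨C + C', fun s t hs hst ht => (norm_add_le _ _).trans ?_⟩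
  rw [add_mul]
  exact add_le_add (hC s t hs hst ht) (hC' s t hs hst ht)

theorem bilin (hβ : 0 ≤ β) (hγ : 0 ≤ γ) (hg : IncrementBound T β g)
    (hf : IncrementBound T γ f) {k : ℝ → ℝ → G}
    (hk : ∀ s t : ℝ, 0 ≤ s → s ≤ t → t ≤ T → ‖k s t‖ ≤ ‖g s t‖ * ‖f s t‖) :
    IncrementBound T (β + γ) k := by
  obtain ⟨C, hC0, hC⟩ := hg.exists_nonneg
  obtain ⟨D, hD⟩ := hf
  refine ⟨C * D, fun s t hs hst ht => (hk s t hs hst ht).trans ?_⟩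
  have hts := sub_nonneg.2 hst
  rw [Real.rpow_add_of_nonneg hts hβ hγ]
  refine (mul_le_mul (hC s t hs hst ht) (hD s t hs hst ht) (norm_nonneg _)
    (by positivity)).trans (le_of_eq (by ring))

theorem mono (hβ : 0 ≤ β) (hβγ : β ≤ γ) (hg : IncrementBound T γ g) : IncrementBound T β g := by
  obtain ⟨C, hC0, hC⟩ := hg.exists_nonneg
  refine ⟨C * T ^ (γ - β), fun s t hs hst ht => (hC s t hs hst ht).trans ?_⟩
  have hts := sub_nonneg.2 hst
  have h : (t - s) ^ γ = (t - s) ^ (γ - β) * (t - s) ^ β := by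
    rw [← Real.rpow_add_of_nonneg hts (sub_nonneg.2 hβγ) hβ, sub_add_cancel]
  rw [h, mul_assoc]
  have : 0 ≤ γ - β := sub_nonneg.2 hβγ
  gcongr
  linarith

/-- A path whose increments are `O((t - s) ^ β)` with `1 < β` is constant. -/
theorem eq_of_one_lt (hβ : 1 < β) {f : ℝ → E} (hf : IncrementBound T β fun s t => f t - f s)
    {t : ℝ} (ht : 0 ≤ t) (htT : t ≤ T) : f t = f 0 := by
  obtain ⟨C, hC⟩ := hf
  have hhalf : ∀ x : ℝ, 0 ≤ x → 2 * (x / 2) ^ β = (2 : ℝ) ^ (1 - β) * x ^ β := by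
    intro x hx
    rw [Real.div_rpow hx (by norm_num), Real.rpow_sub (by norm_num), Real.rpow_one]
    ring
  have key : ∀ n : ℕ, ∀ s t : ℝ, 0 ≤ s → s ≤ t → t ≤ T →
      ‖f t - f s‖ ≤ ((2 : ℝ) ^ (1 - β)) ^ n * (C * (t - s) ^ β) := by
    intro n
    induction n with
    | zero => intro s t hs hst ht; simpa using hC s t hs hst ht
    | succ n ih =>
      intro s t hs hst ht
      have h₁ := ih s ((s + t) / 2) hs (by linarith) (by linarith)
      have h₂ := ih ((s + t) / 2) t (by linarith) (by linarith) ht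
      rw [show (s + t) / 2 - s = (t - s) / 2 by ring] at h₁
      rw [show t - (s + t) / 2 = (t - s) / 2 by ring] at h₂
      have h₃ := norm_sub_le_norm_sub_add_norm_sub (f t) (f ((s + t) / 2)) (f s)
      calc ‖f t - f s‖ ≤ ((2 : ℝ) ^ (1 - β)) ^ n * C * (2 * ((t - s) / 2) ^ β) := by linarith
        _ = _ := by rw [hhalf _ (sub_nonneg.2 hst), pow_succ]; ring
  have hr : (2 : ℝ) ^ (1 - β) < 1 :=
    Real.rpow_lt_one_of_one_lt_of_neg (by norm_num) (by linarith)
  have hlim := (tendsto_pow_atTop_nhds_zero_of_lt_one (by positivity) hr).mul_const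
    (C * (t - 0) ^ β)
  rw [zero_mul] at hlim
  have := ge_of_tendsto' hlim fun n => key n 0 t le_rfl ht htT
  exact sub_eq_zero.1 (norm_le_zero_iff.1 this)

theorem continuousOn (hβ : 0 < β) {f : ℝ → E} (hf : IncrementBound T β fun s t => f t - f s) :
    ContinuousOn f (Set.Icc 0 T) := by
  obtain ⟨C, hC⟩ := hf
  intro t ht
  rw [ContinuousWithinAt, tendsto_iff_norm_sub_tendsto_zero]
  have hb : ∀ s ∈ Set.Icc 0 T, ‖f s - f t‖ ≤ C * |s - t| ^ β := by
    intro s hs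
    rcases le_total t s with hst | hst
    · rw [abs_of_nonneg (by linarith)]; exact hC t s ht.1 hst hs.2
    · rw [norm_sub_rev, abs_sub_comm, abs_of_nonneg (by linarith)]; exact hC s t hs.1 hst ht.2
  have hc : ContinuousAt (fun s : ℝ => C * |s - t| ^ β) t :=
    ((continuous_abs.comp (continuous_id.sub continuous_const)).continuousAt.rpow_const
      (Or.inr hβ.le)).const_mul C
  have hc' : Filter.Tendsto (fun s : ℝ => C * |s - t| ^ β) (nhdsWithin t (Set.Icc 0 T))
      (nhds 0) := by
    have := hc.tendsto
    simp only [sub_self, abs_zero, Real.zero_rpow hβ.ne', mul_zero] at this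
    exact this.mono_left nhdsWithin_le_nhds
  refine squeeze_zero' (Filter.Eventually.of_forall fun _ => norm_nonneg _) ?_ hc'
  filter_upwards [self_mem_nhdsWithin] with s hs using hb s hs

/-- Solutions of linear Young equations are bounded. -/
theorem bounded_of_remainder {α : ℝ} (hα : 0 ≤ α) {y : ℝ → E} {g : ℝ → ℝ → E} {l : ℝ → ℝ → F}
    {p : ℝ → ℝ → G} (hr : IncrementBound T (2 * α) fun s t => y t - y s - g s t)
    (hl : IncrementBound T α l) (hp : IncrementBound T α p)
    (hg : ∀ s t : ℝ, ‖g s t‖ ≤ ‖l s t‖ * ‖y s‖ + ‖p s t‖) :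
    IncrementBound T 0 fun s _ => y s := by
  obtain ⟨R, hR0, hR⟩ := (hr.mono le_rfl (by positivity)).exists_nonneg
  obtain ⟨K, hK0, hK⟩ := (hl.mono le_rfl hα).exists_nonneg
  obtain ⟨Q, hQ0, hQ⟩ := (hp.mono le_rfl hα).exists_nonneg
  refine ⟨‖y 0‖ + R + K * ‖y 0‖ + Q, fun s t hs hst ht => ?_⟩
  have h₁ := hR 0 s le_rfl hs (hst.trans ht)
  have h₂ := hK 0 s le_rfl hs (hst.trans ht)
  have h₃ := hQ 0 s le_rfl hs (hst.trans ht)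
  rw [Real.rpow_zero, mul_one] at *
  have h₄ := mul_le_mul_of_nonneg_right h₂ (norm_nonneg (y 0))
  have h₅ : ‖y s‖ ≤ ‖y 0‖ + ‖g 0 s‖ + ‖y s - y 0 - g 0 s‖ := by
    have := norm_add₃_le (a := y 0) (b := g 0 s) (c := y s - y 0 - g 0 s)
    rwa [show y 0 + g 0 s + (y s - y 0 - g 0 s) = y s by abel] at this
  have := hg 0 s
  linarith

/-- Solutions of linear Young equations are Hölder continuous. -/
theorem holder_of_remainder {α : ℝ} (hα : 0 ≤ α) {y : ℝ → E} {g : ℝ → ℝ → E} {l : ℝ → ℝ → F}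
    {p : ℝ → ℝ → G} (hr : IncrementBound T (2 * α) fun s t => y t - y s - g s t)
    (hl : IncrementBound T α l) (hp : IncrementBound T α p)
    (hg : ∀ s t : ℝ, ‖g s t‖ ≤ ‖l s t‖ * ‖y s‖ + ‖p s t‖) :
    IncrementBound T α fun s t => y t - y s := by
  have hly : IncrementBound T (α + 0) fun s t => ‖l s t‖ * ‖y s‖ :=
    hl.bilin hα le_rfl (bounded_of_remainder hα hr hl hp hg) fun s t _ _ _ => by simp
  rw [add_zero] at hly
  have hp' : IncrementBound T α fun s t => ‖p s t‖ := hp.of_norm_le fun s t _ _ _ => by simp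
  have hg' : IncrementBound T α g := (hly.add hp').of_norm_le fun s t _ _ _ =>
    (hg s t).trans (le_abs_self _)
  exact ((hr.mono hα (by linarith)).add hg').congr fun s t _ _ _ => by abel

/-- Existence for linear Young equations in a Banach algebra, for drivers given on `[0, T]`. -/
theorem exists_linear_young_solution {A : Type*} [NormedRing A] [CompleteSpace A]
    (h1 : ‖(1 : A)‖ ≤ 1) {α : ℝ} (hα : 1 / 2 < α) (hα1 : α ≤ 1) (hT : 0 ≤ T) {L : ℝ → A}
    (hL : IncrementBound T α fun s t => L t - L s) :
    ∃ M : ℝ → A, M 0 = 1 ∧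
      IncrementBound T (2 * α) fun s t => M t - M s - (L t - L s) * M s := by
  obtain ⟨K, hK0, hK⟩ := hL.exists_nonneg
  let c : ℝ → ℝ := fun t => Set.projIcc 0 T hT t
  have hc : ∀ t, 0 ≤ t → t ≤ T → c t = t := fun t h0 hT' => by
    simp only [c, Set.projIcc_of_mem hT ⟨h0, hT'⟩]
  have hLc : ∀ s t : ℝ, s ≤ t → ‖L (c t) - L (c s)‖ ≤ K * (t - s) ^ α := by
    intro s t hst
    have hmono : c s ≤ c t := Set.monotone_projIcc hT hst
    have hle : c t - c s ≤ t - s := by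
      have := Set.abs_projIcc_sub_projIcc (h := hT) (c := t) (d := s)
      rw [abs_of_nonneg (sub_nonneg.2 hst)] at this
      exact (le_abs_self _).trans this
    refine (hK _ _ (Set.projIcc 0 T hT s).2.1 hmono (Set.projIcc 0 T hT t).2.2).trans ?_
    have := sub_nonneg.2 hmono
    gcongr
  obtain ⟨M, hM0, D, hD⟩ := _root_.exists_linear_young_solution h1 hα hα1 hK0 hLc hT
  refine ⟨M, hM0, D, fun s t hs hst ht => ?_⟩
  have := hD s t hs hst ht
  rwa [hc t (hs.trans hst) ht, hc s hs (hst.trans ht)] at this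

end IncrementBound

end IncrementBound

section LinearYoungEquations

variable {V : Type*} [NormedAddCommGroup V] [NormedSpace ℝ V] {α T : ℝ} {L M N : ℝ → V →L[ℝ] V}

theorem holder_of_left_equation (hα : 0 ≤ α) (hL : IncrementBound T α fun s t => L t - L s)
    (hM : IncrementBound T (2 * α) fun s t => M t - M s - (L t - L s) * M s) :
    IncrementBound T α fun s t => M t - M s :=
  IncrementBound.holder_of_remainder hα hM hL hL fun _ _ =>
    (norm_mul_le _ _).trans (le_add_of_nonneg_right (norm_nonneg _))

theorem holder_of_right_equation (hα : 0 ≤ α) (hL : IncrementBound T α fun s t => L t - L s)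
    (hN : IncrementBound T (2 * α) fun s t => N t - N s + N s * (L t - L s)) :
    IncrementBound T α fun s t => N t - N s :=
  IncrementBound.holder_of_remainder (g := fun s t => -(N s * (L t - L s))) hα
    (hN.congr fun s t _ _ _ => by rw [sub_neg_eq_add]) hL hL fun s t => by
      rw [norm_neg, mul_comm ‖L t - L s‖]
      exact (norm_mul_le _ _).trans (le_add_of_nonneg_right (norm_nonneg _))

theorem bounded_of_right_equation (hα : 0 ≤ α) (hL : IncrementBound T α fun s t => L t - L s)
    (hN : IncrementBound T (2 * α) fun s t => N t - N s + N s * (L t - L s)) :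
    IncrementBound T 0 fun s _ => N s :=
  IncrementBound.bounded_of_remainder (g := fun s t => -(N s * (L t - L s))) hα
    (hN.congr fun s t _ _ _ => by rw [sub_neg_eq_add]) hL hL fun s t => by
      rw [norm_neg, mul_comm ‖L t - L s‖]
      exact (norm_mul_le _ _).trans (le_add_of_nonneg_right (norm_nonneg _))

section Forced

variable {y ψ : ℝ → V}

theorem holder_of_forced_equation (hα : 0 ≤ α)
    (hL : IncrementBound T α fun s t => L t - L s) (hψ : IncrementBound T α fun s t => ψ t - ψ s)
    (hy : IncrementBound T (2 * α) fun s t => y t - y s - (L t - L s) (y s) - (ψ t - ψ s)) :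
    IncrementBound T α fun s t => y t - y s :=
  IncrementBound.holder_of_remainder (g := fun s t => (L t - L s) (y s) + (ψ t - ψ s)) hα
    (hy.congr fun s t _ _ _ => by abel) hL hψ fun s t =>
      (norm_add_le _ _).trans (by gcongr; exact ContinuousLinearMap.le_opNorm _ _)

theorem bounded_of_forced_equation (hα : 0 ≤ α)
    (hL : IncrementBound T α fun s t => L t - L s) (hψ : IncrementBound T α fun s t => ψ t - ψ s)
    (hy : IncrementBound T (2 * α) fun s t => y t - y s - (L t - L s) (y s) - (ψ t - ψ s)) :
    IncrementBound T 0 fun s _ => y s :=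
  IncrementBound.bounded_of_remainder (g := fun s t => (L t - L s) (y s) + (ψ t - ψ s)) hα
    (hy.congr fun s t _ _ _ => by abel) hL hψ fun s t =>
      (norm_add_le _ _).trans (by gcongr; exact ContinuousLinearMap.le_opNorm _ _)

/-- Variation of constants: if `dN = -N dL` and `dy = dL y + dψ`, then `d(N y) = N dψ`. -/
theorem right_solution_apply_remainder (hα : 0 ≤ α)
    (hL : IncrementBound T α fun s t => L t - L s) (hψ : IncrementBound T α fun s t => ψ t - ψ s)
    (hN : IncrementBound T (2 * α) fun s t => N t - N s + N s * (L t - L s))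
    (hy : IncrementBound T (2 * α) fun s t => y t - y s - (L t - L s) (y s) - (ψ t - ψ s)) :
    IncrementBound T (2 * α) fun s t => N t (y t) - N s (y s) - N s (ψ t - ψ s) := by
  have hα2 : 0 ≤ 2 * α := by positivity
  have h₁ : IncrementBound T (0 + 2 * α)
      fun s t => N s (y t - y s - (L t - L s) (y s) - (ψ t - ψ s)) :=
    (bounded_of_right_equation hα hL hN).bilin le_rfl hα2 hy
      fun s t _ _ _ => ContinuousLinearMap.le_opNorm _ _
  have h₂ : IncrementBound T (2 * α + 0) fun s t => (N t - N s + N s * (L t - L s)) (y s) :=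
    hN.bilin hα2 le_rfl (bounded_of_forced_equation hα hL hψ hy)
      fun s t _ _ _ => ContinuousLinearMap.le_opNorm _ _
  have h₃ : IncrementBound T (α + α) fun s t => (N t - N s) (y t - y s) :=
    (holder_of_right_equation hα hL hN).bilin hα hα (holder_of_forced_equation hα hL hψ hy)
      fun s t _ _ _ => ContinuousLinearMap.le_opNorm _ _
  rw [zero_add] at h₁
  rw [add_zero] at h₂
  rw [← two_mul] at h₃
  refine ((h₁.add h₂).add h₃).congr fun s t _ _ _ => ?_
  simp only [map_sub, add_apply, sub_apply, mul_apply_eq_comp]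
  abel

/-- Young integrals are determined by their local expansion. -/
theorem eq_of_same_expansion (hα : 1 / 2 < α) {E : Type*} [NormedAddCommGroup E] {z z' : ℝ → E}
    {g : ℝ → ℝ → E} (h0 : z' 0 = z 0) (hz : IncrementBound T (2 * α) fun s t => z t - z s - g s t)
    (hz' : IncrementBound T (2 * α) fun s t => z' t - z' s - g s t) {t : ℝ} (ht : 0 ≤ t)
    (htT : t ≤ T) : z' t = z t := by
  have hneg : IncrementBound T (2 * α) fun s t => -(z t - z s - g s t) :=
    hz.of_norm_le fun s t _ _ _ => (norm_neg _).le
  have hd : IncrementBound T (2 * α) fun s t => (z' t - z t) - (z' s - z s) :=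
    (hz'.add hneg).congr fun s t _ _ _ => by abel
  have := hd.eq_of_one_lt (f := fun t => z' t - z t) (by linarith) ht htT
  rwa [h0, sub_self, sub_eq_zero] at this

end Forced

theorem right_solution_mul_left_solution (hα : 1 / 2 < α)
    (hL : IncrementBound T α fun s t => L t - L s) (hN0 : N 0 = 1)
    (hN : IncrementBound T (2 * α) fun s t => N t - N s + N s * (L t - L s)) (hM0 : M 0 = 1)
    (hM : IncrementBound T (2 * α) fun s t => M t - M s - (L t - L s) * M s) {t : ℝ} (ht : 0 ≤ t)
    (htT : t ≤ T) : N t * M t = 1 := by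
  ext v
  have hψ : IncrementBound T α fun _ _ : ℝ => (0 : V) - 0 :=
    hL.of_norm_le fun s t _ _ _ => by simp
  obtain ⟨C, hC⟩ := hM
  have hy : IncrementBound T (2 * α)
      fun s t => M t v - M s v - (L t - L s) (M s v) - ((0 : V) - 0) := by
    refine ⟨C * ‖v‖, fun s t hs hst ht => ?_⟩
    have h := ContinuousLinearMap.le_of_opNorm_le _ (hC s t hs hst ht) v
    rw [mul_right_comm]
    simpa using h
  have hc := right_solution_apply_remainder (ψ := fun _ => 0) (by linarith) hL hψ hN hy
  have := IncrementBound.eq_of_one_lt (f := fun t => N t (M t v)) (by linarith)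
    (hc.congr fun s t _ _ _ => by simp) ht htT
  simpa [hM0, hN0] using this

/-- A one-sided inverse along a continuous path starting at `1` is two-sided. -/
theorem mul_eq_one_of_continuousOn {A : Type*} [NormedRing A] {M N : ℝ → A}
    (hM : ContinuousOn M (Set.Icc 0 T)) (hN : ContinuousOn N (Set.Icc 0 T))
    (hM0 : M 0 = 1) (hN0 : N 0 = 1) (hNM : ∀ t : ℝ, 0 ≤ t → t ≤ T → N t * M t = 1) {t : ℝ}
    (ht : 0 ≤ t) (htT : t ≤ T) : M t * N t = 1 := by
  have hidem : ∀ s, 0 ≤ s → s ≤ T →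
      (1 - M s * N s) * (1 - M s * N s) = 1 - M s * N s := fun s hs hsT => by
    have h : M s * N s * (M s * N s) = M s * N s := by
      rw [mul_assoc, ← mul_assoc (N s), hNM s hs hsT, one_mul]
    rw [sub_mul, mul_sub (M s * N s), h]; simp
  have hnorm : ∀ s, 0 ≤ s → s ≤ T → ‖1 - M s * N s‖ ≤ ‖1 - M s * N s‖ * ‖1 - M s * N s‖ :=
    fun s hs hsT => (congrArg norm (hidem s hs hsT)).ge.trans (norm_mul_le _ _)
  have hcont : ContinuousOn (fun s => ‖1 - M s * N s‖) (Set.Icc 0 t) :=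
    ((continuousOn_const.sub (hM.mul hN)).norm).mono (Set.Icc_subset_Icc_right htT)
  have hsmall : ‖1 - M t * N t‖ < 1 / 2 := by
    by_contra! hge
    have h0 : ‖1 - M 0 * N 0‖ ≤ 1 / 2 := by rw [hM0, hN0]; norm_num
    obtain ⟨s, hs, hs2⟩ := intermediate_value_Icc ht hcont ⟨h0, hge⟩
    have := hnorm s hs.1 (hs.2.trans htT)
    dsimp only at hs2
    rw [hs2] at this
    norm_num at this
  have h0 : ‖1 - M t * N t‖ ≤ 0 := by
    have := hnorm t ht htT
    have := norm_nonneg (1 - M t * N t)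
    nlinarith
  exact (sub_eq_zero.1 (norm_le_zero_iff.1 h0)).symm

theorem exists_right_solution [CompleteSpace V] (hα : 1 / 2 < α) (hα1 : α ≤ 1) (hT : 0 ≤ T)
    (hL : IncrementBound T α fun s t => L t - L s) :
    ∃ N : ℝ → V →L[ℝ] V, N 0 = 1 ∧
      IncrementBound T (2 * α) fun s t => N t - N s + N s * (L t - L s) := by
  have hop : IncrementBound T α
      fun s t => MulOpposite.op (-(L t)) - MulOpposite.op (-(L s)) :=
    hL.of_norm_le fun s t _ _ _ => by
      rw [← MulOpposite.op_sub, MulOpposite.norm_op, ← neg_sub', norm_neg]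
  obtain ⟨P, hP0, hP⟩ := IncrementBound.exists_linear_young_solution
    (A := (V →L[ℝ] V)ᵐᵒᵖ) ContinuousLinearMap.norm_id_le hα hα1 hT hop
  refine ⟨fun t => (P t).unop, by simp [hP0], hP.of_norm_le fun s t _ _ _ => le_of_eq ?_⟩
  rw [← MulOpposite.norm_unop (P t - P s - _)]
  simp only [MulOpposite.unop_sub, MulOpposite.unop_mul, MulOpposite.unop_op]
  congr 1
  noncomm_ring

theorem exists_forced_solution [CompleteSpace V] (hα : 1 / 2 < α) (hα1 : α ≤ 1) (hT : 0 ≤ T)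
    (hL : IncrementBound T α fun s t => L t - L s) {ψ : ℝ → V}
    (hψ : IncrementBound T α fun s t => ψ t - ψ s) (y₀ : V) :
    ∃ y : ℝ → V, y 0 = y₀ ∧
      IncrementBound T (2 * α) fun s t => y t - y s - (L t - L s) (y s) - (ψ t - ψ s) := by
  let Λ : ℝ → V × ℝ →L[ℝ] V × ℝ := fun t =>
    ((L t).comp (ContinuousLinearMap.fst ℝ V ℝ) +
      (ContinuousLinearMap.snd ℝ V ℝ).smulRight (ψ t)).prod 0
  have hΛapp : ∀ s t w, (Λ t - Λ s) w = ((L t - L s) w.1 + w.2 • (ψ t - ψ s), 0) := by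
    intro s t w
    ext
    · simp [Λ, smul_sub]; abel
    · simp [Λ]
  have hΛ : IncrementBound T α fun s t => Λ t - Λ s := by
    have hsum := (hL.of_norm_le (f := fun s t => ‖L t - L s‖) fun s t _ _ _ => by simp).add
      (hψ.of_norm_le (f := fun s t => ‖ψ t - ψ s‖) fun s t _ _ _ => by simp)
    refine hsum.of_norm_le fun s t _ _ _ => ?_
    rw [Real.norm_of_nonneg (by positivity)]
    refine ContinuousLinearMap.opNorm_le_bound _ (by positivity) fun w => ?_
    rw [hΛapp, Prod.norm_mk, norm_zero, max_eq_left (norm_nonneg _), add_mul]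
    refine (norm_add_le _ _).trans (add_le_add ?_ ?_)
    · exact (ContinuousLinearMap.le_opNorm _ _).trans (by gcongr; exact norm_fst_le w)
    · rw [norm_smul, mul_comm]
      gcongr
      exact norm_snd_le w
  obtain ⟨P, hP0, C, hC⟩ := IncrementBound.exists_linear_young_solution
    (A := V × ℝ →L[ℝ] V × ℝ) ContinuousLinearMap.norm_id_le hα hα1 hT hΛ
  have hw : IncrementBound T (2 * α)
      fun s t => P t (y₀, 1) - P s (y₀, 1) - (Λ t - Λ s) (P s (y₀, 1)) := by
    refine ⟨C * ‖((y₀, 1) : V × ℝ)‖, fun s t hs hst ht => ?_⟩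
    have h := ContinuousLinearMap.le_of_opNorm_le _ (hC s t hs hst ht) (y₀, 1)
    rw [mul_right_comm]
    exact h
  have hsnd : ∀ t, 0 ≤ t → t ≤ T → (P t (y₀, 1)).2 = 1 := by
    intro t ht htT
    have := IncrementBound.eq_of_one_lt (f := fun t => (P t (y₀, 1)).2) (by linarith)
      (hw.of_norm_le fun s t _ _ _ => le_trans (le_of_eq (by rw [hΛapp]; simp))
        (norm_snd_le (P t (y₀, 1) - P s (y₀, 1) - (Λ t - Λ s) (P s (y₀, 1))))) ht htT
    simpa [hP0] using this
  refine ⟨fun t => (P t (y₀, 1)).1, by simp [hP0], hw.of_norm_le fun s t hs hst ht => ?_⟩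
  refine le_trans (le_of_eq ?_)
    (norm_fst_le (P t (y₀, 1) - P s (y₀, 1) - (Λ t - Λ s) (P s (y₀, 1))))
  rw [hΛapp, hsnd s hs (hst.trans ht), one_smul, Prod.fst_sub, Prod.fst_sub, sub_sub]

end LinearYoungEquations


/-- **Linear operator-valued YDEs and the Duhamel formula.**  Let `α ∈ (1/2,1)` and
`L ∈ C^α([0,T]; L(V;V))`.  Then: (1) there is a unique `M ∈ C^α` with `M 0 = Id` solving
`dM_t = L_{dt} ∘ M_t`; (2) each `M t` is invertible and `N t := (M t)⁻¹` is the unique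
solution of `dN_t = - N_t ∘ L_{dt}` with `N 0 = Id`; (3) for every `y₀` and `ψ ∈ C^α` with
`ψ 0 = 0`, the unique solution of `dy_t = L_{dt}(y_t) + dψ_t`, `y 0 = y₀`, is
`y t = M t (y₀ + z t)` where `z` is the Young integral `z_t = ∫_0^t N_s dψ_s`. -/
theorem linear_yde_duhamel
    {V : Type*} [NormedAddCommGroup V] [NormedSpace ℝ V] [CompleteSpace V]
    (α : ℝ) (hα0 : 1/2 < α) (hα1 : α < 1) (T : ℝ) (hT : 0 < T)
    (L : ℝ → V →L[ℝ] V) (KL : ℝ)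
    (hL : ∀ s t : ℝ, 0 ≤ s → s ≤ t → t ≤ T → ‖L t - L s‖ ≤ KL * (t - s) ^ α) :
    ∃ M N : ℝ → V →L[ℝ] V,
      -- (1) M is the unique solution of dM = L_{dt} ∘ M, M 0 = Id
      M 0 = ContinuousLinearMap.id ℝ V ∧
      (∃ KM : ℝ, ∀ s t : ℝ, 0 ≤ s → s ≤ t → t ≤ T → ‖M t - M s‖ ≤ KM * (t - s) ^ α) ∧
      (∃ K : ℝ, ∀ s t : ℝ, 0 ≤ s → s ≤ t → t ≤ T →
        ‖M t - M s - (L t - L s).comp (M s)‖ ≤ K * (t - s) ^ (2 * α)) ∧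
      (∀ M' : ℝ → V →L[ℝ] V, M' 0 = ContinuousLinearMap.id ℝ V →
        (∃ K' : ℝ, ∀ s t : ℝ, 0 ≤ s → s ≤ t → t ≤ T → ‖M' t - M' s‖ ≤ K' * (t - s) ^ α) →
        (∃ K' : ℝ, ∀ s t : ℝ, 0 ≤ s → s ≤ t → t ≤ T →
          ‖M' t - M' s - (L t - L s).comp (M' s)‖ ≤ K' * (t - s) ^ (2 * α)) →
        ∀ t : ℝ, 0 ≤ t → t ≤ T → M' t = M t) ∧
      -- (2) each M t is invertible with inverse N t, and N is the unique solution of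
      -- dN = - N ∘ L_{dt}, N 0 = Id
      (∀ t : ℝ, 0 ≤ t → t ≤ T →
        (M t).comp (N t) = ContinuousLinearMap.id ℝ V ∧
        (N t).comp (M t) = ContinuousLinearMap.id ℝ V) ∧
      N 0 = ContinuousLinearMap.id ℝ V ∧
      (∃ KN : ℝ, ∀ s t : ℝ, 0 ≤ s → s ≤ t → t ≤ T → ‖N t - N s‖ ≤ KN * (t - s) ^ α) ∧
      (∃ K : ℝ, ∀ s t : ℝ, 0 ≤ s → s ≤ t → t ≤ T →
        ‖N t - N s + (N s).comp (L t - L s)‖ ≤ K * (t - s) ^ (2 * α)) ∧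
      (∀ N' : ℝ → V →L[ℝ] V, N' 0 = ContinuousLinearMap.id ℝ V →
        (∃ K' : ℝ, ∀ s t : ℝ, 0 ≤ s → s ≤ t → t ≤ T → ‖N' t - N' s‖ ≤ K' * (t - s) ^ α) →
        (∃ K' : ℝ, ∀ s t : ℝ, 0 ≤ s → s ≤ t → t ≤ T →
          ‖N' t - N' s + (N' s).comp (L t - L s)‖ ≤ K' * (t - s) ^ (2 * α)) →
        ∀ t : ℝ, 0 ≤ t → t ≤ T → N' t = N t) ∧
      -- (3) Duhamel formula
      (∀ (y₀ : V) (ψ : ℝ → V) (Kψ : ℝ), ψ 0 = 0 →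
        (∀ s t : ℝ, 0 ≤ s → s ≤ t → t ≤ T → ‖ψ t - ψ s‖ ≤ Kψ * (t - s) ^ α) →
        ∃ z : ℝ → V,
          z 0 = 0 ∧
          (∃ Kz : ℝ, ∀ s t : ℝ, 0 ≤ s → s ≤ t → t ≤ T → ‖z t - z s‖ ≤ Kz * (t - s) ^ α) ∧
          (∃ K : ℝ, ∀ s t : ℝ, 0 ≤ s → s ≤ t → t ≤ T →
            ‖z t - z s - N s (ψ t - ψ s)‖ ≤ K * (t - s) ^ (2 * α)) ∧
          (∀ z' : ℝ → V, z' 0 = 0 →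
            (∃ K' : ℝ, ∀ s t : ℝ, 0 ≤ s → s ≤ t → t ≤ T → ‖z' t - z' s‖ ≤ K' * (t - s) ^ α) →
            (∃ K' : ℝ, ∀ s t : ℝ, 0 ≤ s → s ≤ t → t ≤ T →
              ‖z' t - z' s - N s (ψ t - ψ s)‖ ≤ K' * (t - s) ^ (2 * α)) →
            ∀ t : ℝ, 0 ≤ t → t ≤ T → z' t = z t) ∧
          ∃ y : ℝ → V,
            y 0 = y₀ ∧
            (∃ Ky : ℝ, ∀ s t : ℝ, 0 ≤ s → s ≤ t → t ≤ T → ‖y t - y s‖ ≤ Ky * (t - s) ^ α) ∧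
            (∃ K : ℝ, ∀ s t : ℝ, 0 ≤ s → s ≤ t → t ≤ T →
              ‖y t - y s - (L t - L s) (y s) - (ψ t - ψ s)‖ ≤ K * (t - s) ^ (2 * α)) ∧
            (∀ t : ℝ, 0 ≤ t → t ≤ T → y t = M t (y₀ + z t)) ∧
            (∀ y' : ℝ → V, y' 0 = y₀ →
              (∃ K' : ℝ, ∀ s t : ℝ, 0 ≤ s → s ≤ t → t ≤ T →
                ‖y' t - y' s‖ ≤ K' * (t - s) ^ α) →
              (∃ K' : ℝ, ∀ s t : ℝ, 0 ≤ s → s ≤ t → t ≤ T →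
                ‖y' t - y' s - (L t - L s) (y' s) - (ψ t - ψ s)‖ ≤ K' * (t - s) ^ (2 * α)) →
              ∀ t : ℝ, 0 ≤ t → t ≤ T → y' t = y t)) := by
  have hα : 0 ≤ α := by linarith
  have hLb : IncrementBound T α fun s t => L t - L s := ⟨KL, hL⟩
  obtain ⟨M, hM0, hM⟩ := IncrementBound.exists_linear_young_solution
    (A := V →L[ℝ] V) ContinuousLinearMap.norm_id_le hα0 hα1.le hT.le hLb
  obtain ⟨N, hN0, hN⟩ := exists_right_solution hα0 hα1.le hT.le hLb
  have hMh := holder_of_left_equation hα hLb hM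
  have hNh := holder_of_right_equation hα hLb hN
  have hNM : ∀ t, 0 ≤ t → t ≤ T → N t * M t = 1 := fun t ht htT =>
    right_solution_mul_left_solution hα0 hLb hN0 hN hM0 hM ht htT
  have hMN : ∀ t, 0 ≤ t → t ≤ T → M t * N t = 1 := fun t ht htT =>
    mul_eq_one_of_continuousOn (hMh.continuousOn (by linarith)) (hNh.continuousOn (by linarith))
      hM0 hN0 hNM ht htT
  refine ⟨M, N, hM0, hMh, hM, fun M' hM'0 _ hM' t ht htT => ?_,
    fun t ht htT => ⟨hMN t ht htT, hNM t ht htT⟩, hN0, hNh, hN,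
    fun N' hN'0 _ hN' t ht htT => ?_, fun y₀ ψ Kψ _ hψ => ?_⟩
  · exact (left_inv_eq_right_inv (hMN t ht htT)
      (right_solution_mul_left_solution hα0 hLb hN0 hN hM'0 hM' ht htT)).symm
  · exact left_inv_eq_right_inv (right_solution_mul_left_solution hα0 hLb hN'0 hN' hM0 hM ht htT)
      (hMN t ht htT)
  have hψb : IncrementBound T α fun s t => ψ t - ψ s := ⟨Kψ, hψ⟩
  obtain ⟨y, hy0, hy⟩ := exists_forced_solution hα0 hα1.le hT.le hLb hψb y₀
  have hyh := holder_of_forced_equation hα hLb hψb hy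
  have hMN_apply : ∀ t, 0 ≤ t → t ≤ T → ∀ v, M t (N t v) = v := fun t ht htT v =>
    DFunLike.congr_fun (hMN t ht htT) v
  have expansion : ∀ y' : ℝ → V,
      (IncrementBound T (2 * α) fun s t => y' t - y' s - (L t - L s) (y' s) - (ψ t - ψ s)) →
      IncrementBound T (2 * α) fun s t =>
        (N t (y' t) - y₀) - (N s (y' s) - y₀) - N s (ψ t - ψ s) := fun y' hy' =>
    (right_solution_apply_remainder hα hLb hψb hN hy').congr fun s t _ _ _ => by abel
  have hz0 : N 0 (y 0) - y₀ = 0 := by simp [hN0, hy0]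
  have hzh : IncrementBound T α fun s t => (N t (y t) - y₀) - (N s (y s) - y₀) :=
    IncrementBound.holder_of_remainder (y := fun t => N t (y t) - y₀) hα (expansion y hy) hNh
      (((bounded_of_right_equation hα hLb hN).bilin le_rfl hα hψb
        (k := fun s t => N s (ψ t - ψ s)) fun s t _ _ _ =>
          ContinuousLinearMap.le_opNorm _ _).mono hα (zero_add α).ge)
      fun s t => le_add_of_nonneg_left (by positivity)
  refine ⟨fun t => N t (y t) - y₀, hz0, hzh, expansion y hy, fun z' hz'0 _ hz' t ht htT => ?_,
    y, hy0, hyh, hy, fun t ht htT => ?_, fun y' hy'0 _ hy' t ht htT => ?_⟩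
  · exact eq_of_same_expansion (z := fun t => N t (y t) - y₀) hα0 (hz'0.trans hz0.symm)
      (expansion y hy) hz' ht htT
  · rw [add_sub_cancel, hMN_apply t ht htT]
  · have h := eq_of_same_expansion (z := fun t => N t (y t) - y₀)
      (z' := fun t => N t (y' t) - y₀) hα0 (by rw [hy0, hy'0]) (expansion y hy)
      (expansion y' hy') ht htT
    rw [← hMN_apply t ht htT (y' t), ← hMN_apply t ht htT (y t), sub_left_injective h]
end

section
/- Conditional uniqueness from flow regularity (van Kampen-type theorem): Let α, β ∈ (0,1) with α(1+β) > 1, λ ∈ (0,1] with β + λ ≤ 1, and A ∈ C^α_t C^{β,λ}_V. Suppose the YDE associated to A admits a flow Φ : Δ₂ × V → V, meaning: Φ(t,t,x) = x for all t, x; for every s ∈ [0,T] and x ∈ V the path t ↦ Φ(s,t,x) belongs to C^α([s,T];V) and there is K(s,x) with ‖Φ(s,t,x) − Φ(s,r,x) − A_{r,t}(Φ(s,r,x))‖_V ≤ K(s,x)(t−r)^{α(1+β)} for all s ≤ r ≤ t ≤ T; Φ(u,t,Φ(s,u,x)) = Φ(s,t,x) for all s ≤ u ≤ t and x; and each map Φ(s,t,·)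 : V → V is a bijection. Assume moreover that Φ is locally γ-Hölder uniformly in time, for some γ ∈ (0,1): for every R > 0 there is C_R < ∞ with ‖Φ(s,t,x) − Φ(s,t,y)‖_V ≤ C_R ‖x−y‖_V^γ and ‖Φ(s,t,·)^{−1}(x) − Φ(s,t,·)^{−1}(y)‖_V ≤ C_R ‖x−y‖_V^γ for all (s,t) ∈ Δ₂ and ‖x‖_V, ‖y‖_V ≤ R. If αγ(1+β) > 1, then for every x₀ ∈ V the path t ↦ Φ(0,t,x₀) is the unique x ∈ C^α([0,T];V) with x(0) = x₀ satisfying, for some K, ‖x_t − x_s − A_{s,t}(x_s)‖_V ≤ K(t−s)^{α(1+β)} for all s ≤ t. -/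
open Set Filter Topology

/-- A path satisfying a one-sided Hölder bound of positive exponent on `[a, b]` is continuous. -/
lemma continuousOn_Icc_of_norm_sub_le_rpow {V : Type*} [NormedAddCommGroup V]
    {w : ℝ → V} {a b K p : ℝ} (hp : 0 < p)
    (hw : ∀ s t : ℝ, a ≤ s → s ≤ t → t ≤ b → ‖w t - w s‖ ≤ K * (t - s) ^ p) :
    ContinuousOn w (Icc a b) := by
  intro u hu
  have hbound : ∀ s ∈ Icc a b, ‖w s - w u‖ ≤ K * |s - u| ^ p := by
    intro s hs
    rcases le_total u s with h | h
    · rw [abs_of_nonneg (sub_nonneg.2 h)]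
      exact hw u s hu.1 h hs.2
    · rw [norm_sub_rev, abs_sub_comm, abs_of_nonneg (sub_nonneg.2 h)]
      exact hw s u hs.1 h hu.2
  have hlim : Tendsto (fun s : ℝ => K * |s - u| ^ p) (𝓝[Icc a b] u) (𝓝 0) := by
    have hcont : Continuous (fun s : ℝ => K * |s - u| ^ p) :=
      continuous_const.mul
        ((continuous_id.sub continuous_const).abs.rpow_const fun _ => Or.inr hp.le)
    simpa [Real.zero_rpow hp.ne'] using (hcont.tendsto u).mono_left nhdsWithin_le_nhds
  rw [ContinuousWithinAt, tendsto_iff_norm_sub_tendsto_zero]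
  exact squeeze_zero' (Eventually.of_forall fun _ => norm_nonneg _)
    (eventually_mem_nhdsWithin.mono hbound) hlim

/-- An increment bound by a power larger than one forces the right derivative to vanish. -/
lemma hasDerivWithinAt_Ici_zero_of_norm_sub_le_rpow {V : Type*} [NormedAddCommGroup V]
    [NormedSpace ℝ V] {f : ℝ → V} {u b C p : ℝ} (hub : u < b) (hp : 1 < p)
    (hf : ∀ s : ℝ, u ≤ s → s ≤ b → ‖f s - f u‖ ≤ C * (s - u) ^ p) :
    HasDerivWithinAt f 0 (Ici u) u := by
  rw [hasDerivWithinAt_iff_isLittleO, Asymptotics.isLittleO_iff]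
  intro c hc
  have hp' : 0 < p - 1 := by linarith
  have hcont : Continuous (fun s : ℝ => C * (s - u) ^ (p - 1)) :=
    continuous_const.mul
      ((continuous_id.sub continuous_const).rpow_const fun _ => Or.inr hp'.le)
  have hlim : Tendsto (fun s : ℝ => C * (s - u) ^ (p - 1)) (𝓝[Ici u] u) (𝓝 0) := by
    simpa [Real.zero_rpow hp'.ne'] using (hcont.tendsto u).mono_left nhdsWithin_le_nhds
  filter_upwards [hlim.eventually (gt_mem_nhds hc), eventually_mem_nhdsWithin,
    mem_nhdsWithin_of_mem_nhds (Iio_mem_nhds hub)] with s hsc hus hsb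
  have hs0 : 0 ≤ s - u := sub_nonneg.2 hus
  have hsplit : (s - u) ^ p = (s - u) ^ (p - 1) * (s - u) := by
    rw [← Real.rpow_add_one' hs0 (by linarith), sub_add_cancel]
  calc ‖f s - f u - (s - u) • (0 : V)‖ = ‖f s - f u‖ := by simp
    _ ≤ C * (s - u) ^ p := hf s hus (le_of_lt hsb)
    _ = C * (s - u) ^ (p - 1) * (s - u) := by rw [hsplit, mul_assoc]
    _ ≤ c * (s - u) := mul_le_mul_of_nonneg_right hsc.le hs0
    _ = c * ‖s - u‖ := by rw [Real.norm_of_nonneg hs0]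

/-- **Conditional uniqueness from flow regularity (van Kampen-type theorem).**
Let `α(1+β) > 1`, `β + λ ≤ 1`, `A ∈ C^α_t C^{β,λ}_V` and suppose the YDE associated to `A`
admits a flow `Φ` (with inverse maps `Ψ`) which is locally `γ`-Hölder, uniformly in time,
together with its inverse.  If `αγ(1+β) > 1`, then for every `x₀` the path `t ↦ Φ 0 t x₀` is
the unique `C^α` solution of the YDE starting at `x₀`. -/
theorem van_kampen_uniqueness
    {V : Type*} [NormedAddCommGroup V] [NormedSpace ℝ V]
    (α β γ lam : ℝ) (hα0 : 0 < α) (hα1 : α < 1) (hβ0 : 0 < β) (hβ1 : β < 1)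
    (hγ0 : 0 < γ) (hγ1 : γ < 1) (hlam0 : 0 < lam) (hlam1 : lam ≤ 1)
    (hβlam : β + lam ≤ 1) (hαβ : 1 < α * (1 + β)) (hαγβ : 1 < α * γ * (1 + β))
    (T : ℝ) (hT : 0 < T)
    (A : ℝ → V → V) (MA : ℝ)
    (hA0 : ∀ z : V, A 0 z = 0)
    (hA1 : ∀ s t : ℝ, 0 ≤ s → s ≤ t → t ≤ T → ‖A t 0 - A s 0‖ ≤ MA * (t - s) ^ α)
    (hA2 : ∀ s t : ℝ, 0 ≤ s → s ≤ t → t ≤ T → ∀ R : ℝ, 1 ≤ R → ∀ z w : V,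
      ‖z‖ ≤ R → ‖w‖ ≤ R →
      ‖A t z - A s z - (A t w - A s w)‖ ≤ MA * R ^ lam * (t - s) ^ α * ‖z - w‖ ^ β)
    (Φ Ψ : ℝ → ℝ → V → V)
    -- Φ(t,t,x) = x
    (hid : ∀ t : ℝ, 0 ≤ t → t ≤ T → ∀ x : V, Φ t t x = x)
    -- t ↦ Φ(s,t,x) is α-Hölder on [s,T]
    (hhol : ∀ s : ℝ, 0 ≤ s → s ≤ T → ∀ x : V, ∃ KH : ℝ, ∀ r t : ℝ,
      s ≤ r → r ≤ t → t ≤ T → ‖Φ s t x - Φ s r x‖ ≤ KH * (t - r) ^ α)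
    -- t ↦ Φ(s,t,x) solves the YDE on [s,T]
    (hsolflow : ∀ s : ℝ, 0 ≤ s → s ≤ T → ∀ x : V, ∃ K : ℝ, ∀ r t : ℝ,
      s ≤ r → r ≤ t → t ≤ T →
      ‖Φ s t x - Φ s r x - (A t (Φ s r x) - A r (Φ s r x))‖ ≤ K * (t - r) ^ (α * (1 + β)))
    -- group property
    (hgroup : ∀ s u t : ℝ, 0 ≤ s → s ≤ u → u ≤ t → t ≤ T → ∀ x : V,
      Φ u t (Φ s u x) = Φ s t x)
    -- each Φ(s,t,·) is a bijection with inverse Ψ(s,t,·)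
    (hbij : ∀ s t : ℝ, 0 ≤ s → s ≤ t → t ≤ T → Function.Bijective (Φ s t))
    (hinv : ∀ s t : ℝ, 0 ≤ s → s ≤ t → t ≤ T → ∀ x : V,
      Ψ s t (Φ s t x) = x ∧ Φ s t (Ψ s t x) = x)
    -- Φ and its inverse are locally γ-Hölder, uniformly in time
    (hΦhol : ∀ R : ℝ, 0 < R → ∃ CR : ℝ, ∀ s t : ℝ, 0 ≤ s → s ≤ t → t ≤ T →
      ∀ x y : V, ‖x‖ ≤ R → ‖y‖ ≤ R →
        ‖Φ s t x - Φ s t y‖ ≤ CR * ‖x - y‖ ^ γ ∧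
        ‖Ψ s t x - Ψ s t y‖ ≤ CR * ‖x - y‖ ^ γ) :
    ∀ (x₀ : V) (x : ℝ → V) (Kx K : ℝ),
      x 0 = x₀ →
      (∀ s t : ℝ, 0 ≤ s → s ≤ t → t ≤ T → ‖x t - x s‖ ≤ Kx * (t - s) ^ α) →
      (∀ s t : ℝ, 0 ≤ s → s ≤ t → t ≤ T →
        ‖x t - x s - (A t (x s) - A s (x s))‖ ≤ K * (t - s) ^ (α * (1 + β))) →
      ∀ t : ℝ, 0 ≤ t → t ≤ T → x t = Φ 0 t x₀ := by
  intro x₀ x Kx K hx0 hxhol hxsol t ht0 htT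
  have hxcont : ContinuousOn x (Icc 0 T) := continuousOn_Icc_of_norm_sub_le_rpow hα0 hxhol
  obtain ⟨Bx, hBx⟩ := isCompact_Icc.exists_bound_of_continuousOn hxcont
  -- Compare `x` with the trajectory `z` of the flow that passes through `x u` at time `u`.
  have key : ∀ u : ℝ, 0 ≤ u → u ≤ t → ∃ (z : ℝ → V) (C K' : ℝ), 0 ≤ C ∧ z u = x u ∧
      ContinuousOn z (Icc 0 T) ∧
      (∀ s, u ≤ s → s ≤ T →
        ‖z s - z u - (A s (z u) - A u (z u))‖ ≤ K' * (s - u) ^ (α * (1 + β))) ∧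
      ∀ s, 0 ≤ s → s ≤ t → ‖Φ s t (x s) - Φ u t (x u)‖ ≤ C * ‖x s - z s‖ ^ γ := by
    intro u hu0 hut
    have huT := hut.trans htT
    obtain ⟨y, hy⟩ := (hbij 0 u le_rfl hu0 huT).surjective (x u)
    obtain ⟨KH, hKH⟩ := hhol 0 le_rfl hT.le y
    obtain ⟨K', hK'⟩ := hsolflow 0 le_rfl hT.le y
    have hzcont : ContinuousOn (fun s => Φ 0 s y) (Icc 0 T) :=
      continuousOn_Icc_of_norm_sub_le_rpow hα0 hKH
    obtain ⟨Bz, hBz⟩ := isCompact_Icc.exists_bound_of_continuousOn hzcont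
    obtain ⟨CR, hCR⟩ := hΦhol (max 1 (max Bx Bz)) (lt_max_of_lt_left one_pos)
    refine ⟨fun s => Φ 0 s y, |CR|, K', abs_nonneg _, hy, hzcont,
      fun s hus hsT => hK' u s hu0 hus hsT, fun s hs0 hst => ?_⟩
    have hsT := hst.trans htT
    have hflow : Φ u t (x u) = Φ s t (Φ 0 s y) := by
      rw [← hy, hgroup 0 u t le_rfl hu0 hut htT, hgroup 0 s t le_rfl hs0 hst htT]
    rw [hflow]
    refine (hCR s t hs0 hst htT _ _ ?_ ?_).1.trans
      (mul_le_mul_of_nonneg_right (le_abs_self CR) (by positivity))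
    · exact (hBx s ⟨hs0, hsT⟩).trans ((le_max_left _ _).trans (le_max_right _ _))
    · exact (hBz s ⟨hs0, hsT⟩).trans ((le_max_right _ _).trans (le_max_right _ _))
  have hcont : ContinuousOn (fun s => Φ s t (x s)) (Icc 0 t) := by
    intro u hu
    obtain ⟨z, C, K', -, hzu, hzcont, -, hz⟩ := key u hu.1 hu.2
    have hsub : Icc 0 t ⊆ Icc 0 T := Icc_subset_Icc_right htT
    have hlim : Tendsto (fun s => C * ‖x s - z s‖ ^ γ) (𝓝[Icc 0 t] u) (𝓝 0) := by
      have h : ContinuousOn (fun s => C * ‖x s - z s‖ ^ γ) (Icc 0 t) :=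
        continuousOn_const.mul (((hxcont.mono hsub).sub (hzcont.mono hsub)).norm.rpow_const
          fun _ _ => Or.inr hγ0.le)
      simpa [ContinuousWithinAt, hzu, Real.zero_rpow hγ0.ne'] using h u hu
    rw [ContinuousWithinAt, tendsto_iff_norm_sub_tendsto_zero]
    exact squeeze_zero' (Eventually.of_forall fun _ => norm_nonneg _)
      (eventually_mem_nhdsWithin.mono fun s hs => hz s hs.1 hs.2) hlim
  have hderiv : ∀ u ∈ Ico 0 t,
      HasDerivWithinAt (fun s => Φ s t (x s)) 0 (Ici u) u := by
    intro u hu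
    obtain ⟨z, C, K', hC, hzu, -, hzsol, hz⟩ := key u hu.1 hu.2.le
    refine hasDerivWithinAt_Ici_zero_of_norm_sub_le_rpow
      (C := C * (|K| + |K'|) ^ γ) hu.2 hαγβ fun s hus hst => ?_
    have hsu : 0 ≤ s - u := sub_nonneg.2 hus
    have hpow : 0 ≤ (s - u) ^ (α * (1 + β)) := Real.rpow_nonneg hsu _
    have hdiff : ‖x s - z s‖ ≤ (|K| + |K'|) * (s - u) ^ (α * (1 + β)) := by
      have h1 := hxsol u s hu.1 hus (hst.trans htT)
      have h2 := hzsol s hus (hst.trans htT)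
      rw [hzu] at h2
      calc ‖x s - z s‖
          = ‖(x s - x u - (A s (x u) - A u (x u)))
              - (z s - x u - (A s (x u) - A u (x u)))‖ := by congr 1; abel
        _ ≤ K * (s - u) ^ (α * (1 + β)) + K' * (s - u) ^ (α * (1 + β)) :=
          (norm_sub_le _ _).trans (add_le_add h1 h2)
        _ = (K + K') * (s - u) ^ (α * (1 + β)) := by ring
        _ ≤ _ := mul_le_mul_of_nonneg_right
          (add_le_add (le_abs_self K) (le_abs_self K')) hpow
    calc ‖Φ s t (x s) - Φ u t (x u)‖ ≤ C * ‖x s - z s‖ ^ γ := hz s (hu.1.trans hus) hst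
      _ ≤ C * ((|K| + |K'|) * (s - u) ^ (α * (1 + β))) ^ γ := by gcongr
      _ = C * (|K| + |K'|) ^ γ * (s - u) ^ (α * γ * (1 + β)) := by
        rw [mul_right_comm α γ, Real.mul_rpow (by positivity) hpow, ← Real.rpow_mul hsu,
          ← mul_assoc C]
  have hconst := constant_of_has_deriv_right_zero hcont hderiv t ⟨ht0, le_rfl⟩
  simpa [hid t ht0 htT, hx0] using hconst
end
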